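/- For every α > 0 and r, s, t ∈ ℕ, there exists C = C(r, s, t, α) > 0 such that the following holds. Let F be a strictly 1-balanced graph on s vertices with t edges and chromatic number r, and let H = {H_1, …, H_{trn}} be any graph system on srn vertices, where each H_i is a balanced r-partite graph with each vertex class of size sn, with δ*(H) ≥ (δ_F^{T*} + α)·sn. If p ≥ C·n^{−1/d_1(F) − 1}·(log n)^{1/t}, then with high probability the random sparsification H(p) = {H_1(p), …, H_{trn}(p)} contains a transversal F-factor. -/

import Mathlib

open Classical in
/-- A simple graph `F` on `Fin s` is strictly 1-balanced. -/
def SGStrictlyOneBalanced {s : ℕ} (F : SimpleGraph (Fin s)) : Prop :=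
  ∀ (W : Finset (Fin s)) (E' : Finset (Sym2 (Fin s))),
    E' ⊆ F.edgeFinset → (∀ e ∈ E', ∀ v ∈ e, v ∈ W) → 2 ≤ W.card →
    (W ≠ Finset.univ ∨ E' ≠ F.edgeFinset) →
    (E'.card : ℝ) / ((W.card : ℝ) - 1) < (F.edgeFinset.card : ℝ) / ((s : ℝ) - 1)

open Classical in
/-- The 1-density `d₁(F) = e(F)/(|V(F)|-1)` of a simple graph. -/
noncomputable def sgOneDensity {s : ℕ} (F : SimpleGraph (Fin s)) : ℝ :=
  (F.edgeFinset.card : ℝ) / ((s : ℝ) - 1)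

open Classical in
/-- The graph system `Hs` contains a transversal `F`-factor with `m` pairwise disjoint
copies of `F`, whose colored edge set uses exactly one edge from each member. -/
def HasTransversalFactorSG {s : ℕ} (F : SimpleGraph (Fin s)) {W : Type*} {M : ℕ}
    (Hs : Fin M → SimpleGraph W) (m : ℕ) : Prop :=
  ∃ φ : Fin m → Fin s → W,
    (∀ j, Function.Injective (φ j)) ∧
    (∀ j j' : Fin m, j ≠ j' → ∀ a b, φ j a ≠ φ j' b) ∧
    ∃ c : Fin m × {e // e ∈ F.edgeFinset} → Fin M,
      Function.Bijective c ∧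
      ∀ (j : Fin m) (e : {e // e ∈ F.edgeFinset}),
        Sym2.map (φ j) e.1 ∈ (Hs (c (j, e))).edgeSet

open Classical in
/-- The multipartite Dirac threshold `δ_F^{T*}` for graph systems. -/
noncomputable def multipartiteTransversalDirac (r s t : ℕ) (F : SimpleGraph (Fin s)) : ℝ :=
  sInf {δ : ℝ | ∀ α : ℝ, 0 < α → ∃ n₀ : ℕ, ∀ n : ℕ, n₀ ≤ n →
    ∀ Hs : Fin (t * r * n) → SimpleGraph (Fin r × Fin (s * n)),
      (∀ i, ∀ a b : Fin r × Fin (s * n), a.1 = b.1 → ¬ (Hs i).Adj a b) →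
      (∀ i' : Fin (t * r * n), ∀ i j : Fin r, i ≠ j → ∀ v : Fin (s * n),
        (δ + α) * (s * n : ℕ) ≤
          ((Finset.univ.filter fun w => (Hs i').Adj (i, v) (j, w)).card : ℝ)) →
      HasTransversalFactorSG F Hs (r * n)}

open Classical in
/-- The probability that the independent random sparsification of the graph system `Hs`
(each edge of each `Hs i` kept independently with probability `p`) satisfies `E`. -/
noncomputable def sysEdgeSparsProb {M : ℕ} {W : Type*} [Fintype W] [DecidableEq W]
    (Hs : Fin M → SimpleGraph W) (p : ℝ)
    (E : (Fin M → Finset (Sym2 W)) → Prop) : ℝ :=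
  ∑ σ ∈ Fintype.piFinset (fun i => (Hs i).edgeFinset.powerset),
    if E σ then ∏ i, p ^ (σ i).card * (1 - p) ^ ((Hs i).edgeFinset.card - (σ i).card) else 0

namespace TransversalFactor

set_option linter.unusedSectionVars false

section ProductExpectation

variable {I A : Type*} [Fintype I] [DecidableEq I] [Fintype A]

/-- Expectation of `φ` under the product over `I` of the weight `ν` on `A`. -/
noncomputable def prodExp (ν : A → ℝ) (φ : (I → A) → ℝ) : ℝ :=
  ∑ f, (∏ i, ν (f i)) * φ f

theorem prodExp_mono {ν : A → ℝ} (hν : ∀ a, 0 ≤ ν a) {φ ψ : (I → A) → ℝ}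
    (h : ∀ f, φ f ≤ ψ f) : prodExp ν φ ≤ prodExp ν ψ :=
  Finset.sum_le_sum fun f _ =>
    mul_le_mul_of_nonneg_left (h f) (Finset.prod_nonneg fun _ _ => hν _)

theorem prodExp_nonneg {ν : A → ℝ} (hν : ∀ a, 0 ≤ ν a) {φ : (I → A) → ℝ}
    (h : ∀ f, 0 ≤ φ f) : 0 ≤ prodExp ν φ :=
  Finset.sum_nonneg fun f _ => mul_nonneg (Finset.prod_nonneg fun _ _ => hν _) (h f)

theorem prodExp_sum {J : Type*} (s : Finset J) (ν : A → ℝ) (φ : J → (I → A) → ℝ) :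
    prodExp ν (fun f => ∑ j ∈ s, φ j f) = ∑ j ∈ s, prodExp ν (φ j) := by
  simp only [prodExp, Finset.mul_sum]
  exact Finset.sum_comm

theorem prodExp_add (ν : A → ℝ) (φ ψ : (I → A) → ℝ) :
    prodExp ν (fun f => φ f + ψ f) = prodExp ν φ + prodExp ν ψ := by
  simp only [prodExp, mul_add, Finset.sum_add_distrib]

theorem prodExp_const_mul (ν : A → ℝ) (c : ℝ) (φ : (I → A) → ℝ) :
    prodExp ν (fun f => c * φ f) = c * prodExp ν φ := by
  simp only [prodExp, Finset.mul_sum]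
  exact Finset.sum_congr rfl fun f _ => by ring

theorem prodExp_const {ν : A → ℝ} (hν : ∑ a, ν a = 1) (c : ℝ) :
    prodExp (I := I) ν (fun _ => c) = c := by
  have : ∑ f : I → A, ∏ i, ν (f i) = 1 := by
    rw [← Fintype.prod_sum]
    simp [hν]
  rw [prodExp, ← Finset.sum_mul, this, one_mul]

open Classical in
theorem prodExp_update {ν : A → ℝ} (hν : ∑ a, ν a = 1) (i : I) (a : A) (φ : (I → A) → ℝ) :
    ν a * prodExp ν (fun f => φ (Function.update f i a)) =
      prodExp ν (fun f => if f i = a then φ f else 0) := by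
  have key : ∀ ψ : (I → A) → ℝ, prodExp ν ψ =
      ∑ b, ∑ g : {j // j ≠ i} → A, ν b * (∏ j, ν (g j)) * ψ ((Equiv.funSplitAt i A).symm (b, g)) := by
    intro ψ
    rw [prodExp, ← Equiv.sum_comp (Equiv.funSplitAt i A).symm, Fintype.sum_prod_type]
    refine Finset.sum_congr rfl fun b _ => Finset.sum_congr rfl fun g _ => ?_
    congr 1
    rw [Fintype.prod_eq_mul_prod_subtype_ne _ i]
    congr 1
    · simp [Equiv.funSplitAt, Equiv.piSplitAt]
    · refine Finset.prod_congr rfl fun j _ => ?_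
      simp [Equiv.funSplitAt, Equiv.piSplitAt, j.2]
  have upd : ∀ b (g : {j // j ≠ i} → A),
      Function.update ((Equiv.funSplitAt i A).symm (b, g)) i a = (Equiv.funSplitAt i A).symm (a, g) := by
    intro b g
    funext j
    by_cases h : j = i
    · subst h; simp [Equiv.funSplitAt, Equiv.piSplitAt]
    · simp [Equiv.funSplitAt, Equiv.piSplitAt, h]
  have at_i : ∀ b (g : {j // j ≠ i} → A), (Equiv.funSplitAt i A).symm (b, g) i = b := by
    intro b g
    simp [Equiv.funSplitAt, Equiv.piSplitAt]
  rw [key, key]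
  simp only [upd, at_i]
  rw [Finset.sum_comm, Finset.sum_comm (s := (Finset.univ : Finset A)), Finset.mul_sum]
  refine Finset.sum_congr rfl fun g _ => ?_
  simp only [mul_ite, mul_zero, Finset.sum_ite_eq', Finset.mem_univ, if_true]
  simp only [mul_assoc]
  rw [← Finset.sum_mul, hν, one_mul]

open Classical in
/-- Overriding the coordinates in `Y` by fixed values amounts to conditioning on them. -/
theorem prodExp_piecewise {ν : A → ℝ} (hν : ∑ a, ν a = 1) (Y : Finset I) (v : I → A)
    (φ : (I → A) → ℝ) :
    (∏ i ∈ Y, ν (v i)) * prodExp ν (fun f => φ (Y.piecewise v f)) =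
      prodExp ν (fun f => if ∀ i ∈ Y, f i = v i then φ f else 0) := by
  induction Y using Finset.induction_on generalizing φ with
  | empty => simp
  | insert i Y hi ih =>
    rw [Finset.prod_insert hi]
    have h1 : ∀ f : I → A, (insert i Y).piecewise v f = Function.update (Y.piecewise v f) i (v i) :=
      fun f => Finset.piecewise_insert ..
    simp only [h1]
    have h2 := ih (fun f => φ (Function.update f i (v i)))
    rw [mul_assoc, h2]
    have h3 := prodExp_update hν i (v i) (fun f => if ∀ j ∈ Y, f j = v j then φ f else 0)
    have h4 : ∀ f : I → A, (∀ j ∈ Y, Function.update f i (v i) j = v j) ↔ ∀ j ∈ Y, f j = v j := by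
      intro f
      refine forall₂_congr fun j hj => ?_
      rw [Function.update_of_ne (by rintro rfl; exact hi hj)]
    simp only [h4] at h3
    rw [h3]
    refine congrArg _ (funext fun f => ?_)
    by_cases h : f i = v i <;> simp [h]

theorem prodExp_piecewise_le {ν : A → ℝ} (hν : ∑ a, ν a = 1) (hν0 : ∀ a, 0 ≤ ν a)
    (Y : Finset I) (v : I → A) {φ : (I → A) → ℝ} (hφ : ∀ f, 0 ≤ φ f) :
    (∏ i ∈ Y, ν (v i)) * prodExp ν (fun f => φ (Y.piecewise v f)) ≤ prodExp ν φ := by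
  classical
  rw [prodExp_piecewise hν]
  refine prodExp_mono hν0 fun f => ?_
  split_ifs
  · exact le_rfl
  · exact hφ f

open Classical in
theorem prodExp_forall_eq {ν : A → ℝ} (hν : ∑ a, ν a = 1) (Y : Finset I) (v : I → A) :
    prodExp ν (fun f => if ∀ i ∈ Y, f i = v i then 1 else 0) = ∏ i ∈ Y, ν (v i) := by
  rw [← prodExp_piecewise hν Y v (fun _ => 1), prodExp_const hν, mul_one]

open Classical in
/-- The expectation of a function of the coordinatewise image. -/
theorem prodExp_comp {B : Type*} [Fintype B] (ν : A → ℝ) (q : A → B) (φ : (I → B) → ℝ) :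
    prodExp ν (fun f => φ (fun i => q (f i))) =
      prodExp (fun b => ∑ a with q a = b, ν a) φ := by
  simp only [prodExp]
  rw [← Finset.sum_fiberwise (s := Finset.univ) (g := fun f : I → A => fun i => q (f i))]
  refine Finset.sum_congr rfl fun h _ => ?_
  rw [Finset.prod_univ_sum, Finset.sum_mul]
  refine Finset.sum_congr ?_ ?_
  · ext f
    simp [Fintype.mem_piFinset, funext_iff]
  · intro f hf
    simp only [Finset.mem_filter, Fintype.mem_piFinset, Finset.mem_univ, true_and] at hf
    rw [show (fun i => q (f i)) = h from funext hf]

end ProductExpectation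

section FragmentProcess

variable {V ι : Type*} [DecidableEq V]

open Classical in
/-- The sets `T' \ W` contained in `T`, for `T'` a current fragment. -/
noncomputable def fragCandidates (st : ι → Option (Finset V)) (W T : Finset V) :
    Finset (Finset V) :=
  T.powerset.filter fun A => ∃ i T', st i = some T' ∧ A = T' \ W

open Classical in
/-- A smallest set `T' \ W` contained in `T`, for `T'` a current fragment. -/
noncomputable def minFrag (st : ι → Option (Finset V)) (W T : Finset V) : Finset V :=
  if h : (fragCandidates st W T).Nonempty then
    (Finset.exists_min_image _ Finset.card h).choose
  else ∅

theorem fragCandidates_nonempty {st : ι → Option (Finset V)} (W : Finset V) {T : Finset V} {i : ι}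
    (h : st i = some T) : (fragCandidates st W T).Nonempty := by
  classical
  refine ⟨T \ W, ?_⟩
  simp only [fragCandidates, Finset.mem_filter, Finset.mem_powerset]
  exact ⟨Finset.sdiff_subset, i, T, h, rfl⟩

theorem minFrag_mem {st : ι → Option (Finset V)} (W : Finset V) {T : Finset V} {i : ι}
    (h : st i = some T) : minFrag st W T ∈ fragCandidates st W T := by
  have hne := fragCandidates_nonempty W h
  rw [minFrag, dif_pos hne]
  exact (Finset.exists_min_image _ Finset.card hne).choose_spec.1

theorem minFrag_card_le {st : ι → Option (Finset V)} {W T A : Finset V} {i : ι}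
    (h : st i = some T) (hA : A ∈ fragCandidates st W T) :
    (minFrag st W T).card ≤ A.card := by
  have hne := fragCandidates_nonempty W h
  rw [minFrag, dif_pos hne]
  exact (Finset.exists_min_image _ Finset.card hne).choose_spec.2 A hA

theorem minFrag_subset {st : ι → Option (Finset V)} (W : Finset V) {T : Finset V} {i : ι}
    (h : st i = some T) : minFrag st W T ⊆ T := by
  classical
  have := minFrag_mem W h
  simp only [fragCandidates, Finset.mem_filter, Finset.mem_powerset] at this
  exact this.1

theorem exists_minFrag_eq {st : ι → Option (Finset V)} (W : Finset V) {T : Finset V} {i : ι}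
    (h : st i = some T) : ∃ i' T', st i' = some T' ∧ minFrag st W T = T' \ W := by
  classical
  have := minFrag_mem W h
  simp only [fragCandidates, Finset.mem_filter, Finset.mem_powerset] at this
  exact this.2

/-- The fragments surviving the first `ℓ` rounds, where round `ℓ` exposes `W ℓ` and discards the
fragments with more than `ks ℓ` elements. -/
noncomputable def fragState (S : ι → Finset V) (ks : ℕ → ℕ) (W : ℕ → Finset V) :
    ℕ → ι → Option (Finset V)
  | 0, i => some (S i)
  | ℓ + 1, i => (fragState S ks W ℓ i).bind fun T =>
      if (minFrag (fragState S ks W ℓ) (W ℓ) T).card ≤ ks ℓ then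
        some (minFrag (fragState S ks W ℓ) (W ℓ) T) else none

variable {S : ι → Finset V} {ks : ℕ → ℕ} {W : ℕ → Finset V}

theorem fragState_succ_eq_some {ℓ : ℕ} {i : ι} {T : Finset V}
    (h : fragState S ks W (ℓ + 1) i = some T) :
    ∃ T₀, fragState S ks W ℓ i = some T₀ ∧ T = minFrag (fragState S ks W ℓ) (W ℓ) T₀ ∧
      T.card ≤ ks ℓ := by
  rw [fragState, Option.bind_eq_some_iff] at h
  obtain ⟨T₀, h₀, h₁⟩ := h
  split_ifs at h₁ with hc
  simp only [Option.some.injEq] at h₁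
  exact ⟨T₀, h₀, h₁.symm, h₁ ▸ hc⟩

theorem fragState_succ_eq_none {ℓ : ℕ} {i : ι} (h : fragState S ks W (ℓ + 1) i = none) :
    fragState S ks W ℓ i = none ∨ ∃ T₀, fragState S ks W ℓ i = some T₀ ∧
      ks ℓ < (minFrag (fragState S ks W ℓ) (W ℓ) T₀).card := by
  rcases h₀ : fragState S ks W ℓ i with _ | T₀
  · exact Or.inl rfl
  · refine Or.inr ⟨T₀, rfl, ?_⟩
    rw [fragState, h₀, Option.bind_some] at h
    split_ifs at h with hc
    omega

theorem fragState_congr {W' : ℕ → Finset V} {ℓ : ℕ} (h : ∀ m < ℓ, W m = W' m) :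
    fragState S ks W ℓ = fragState S ks W' ℓ := by
  induction ℓ with
  | zero => rfl
  | succ ℓ ih =>
    funext i
    simp only [fragState]
    rw [ih fun m hm => h m (by omega), h ℓ (by omega)]

theorem fragState_subset {ℓ : ℕ} {i : ι} {T : Finset V} (h : fragState S ks W ℓ i = some T) :
    T ⊆ S i := by
  induction ℓ generalizing T with
  | zero => simp only [fragState, Option.some.injEq] at h; exact h ▸ subset_rfl
  | succ ℓ ih =>
    obtain ⟨T₀, h₀, rfl, -⟩ := fragState_succ_eq_some h
    exact (minFrag_subset _ h₀).trans (ih h₀)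

theorem fragState_disjoint {ℓ : ℕ} {i : ι} {T : Finset V} (h : fragState S ks W ℓ i = some T)
    {m : ℕ} (hm : m < ℓ) : Disjoint T (W m) := by
  induction ℓ generalizing T with
  | zero => omega
  | succ ℓ ih =>
    obtain ⟨T₀, h₀, rfl, -⟩ := fragState_succ_eq_some h
    rcases Nat.lt_succ_iff_lt_or_eq.1 hm with hm | rfl
    · exact (ih h₀ hm).mono_left (minFrag_subset _ h₀)
    · obtain ⟨i', T', -, h'⟩ := exists_minFrag_eq (W m) h₀
      rw [h']
      exact Finset.sdiff_disjoint

theorem exists_subset_of_fragState {ℓ : ℕ} {i : ι} {T : Finset V}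
    (h : fragState S ks W ℓ i = some T) :
    ∃ i', S i' ⊆ T ∪ (Finset.range ℓ).biUnion W := by
  induction ℓ generalizing i T with
  | zero =>
    simp only [fragState, Option.some.injEq] at h
    exact ⟨i, h ▸ Finset.subset_union_left⟩
  | succ ℓ ih =>
    obtain ⟨T₀, h₀, rfl, -⟩ := fragState_succ_eq_some h
    obtain ⟨i', T', h₁, h'⟩ := exists_minFrag_eq (W ℓ) h₀
    obtain ⟨i'', hi⟩ := ih h₁
    refine ⟨i'', hi.trans ?_⟩
    rw [h', Finset.range_add_one, Finset.biUnion_insert]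
    intro x hx
    simp only [Finset.mem_union, Finset.mem_sdiff] at hx ⊢
    tauto

theorem fragState_card_le {kp : ℕ → ℕ} (h0 : ∀ i, (S i).card ≤ kp 0)
    (hs : ∀ ℓ, kp (ℓ + 1) = ks ℓ) {ℓ : ℕ} {i : ι} {T : Finset V}
    (h : fragState S ks W ℓ i = some T) : T.card ≤ kp ℓ := by
  cases ℓ with
  | zero => simp only [fragState, Option.some.injEq] at h; exact h ▸ h0 i
  | succ ℓ =>
    obtain ⟨T₀, -, -, hc⟩ := fragState_succ_eq_some h
    exact (hs ℓ).symm ▸ hc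

open Classical in
/-- A current fragment covered by `W`, if there is one. -/
noncomputable def canonFrag (st : ι → Option (Finset V)) (W : Finset V) : Finset V :=
  if h : ∃ T i, st i = some T ∧ T ⊆ W then h.choose else ∅

theorem canonFrag_card_le {st : ι → Option (Finset V)} {W : Finset V} {k : ℕ}
    (h : ∀ i T, st i = some T → T.card ≤ k) : (canonFrag st W).card ≤ k := by
  unfold canonFrag
  split_ifs with hc
  · obtain ⟨i, hi, -⟩ := hc.choose_spec
    exact h i _ hi
  · simp

/-- A minimal fragment is recovered from the exposed set enlarged by it. -/
theorem minFrag_subset_canonFrag {st : ι → Option (Finset V)} (W : Finset V) {T : Finset V} {i : ι}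
    (h : st i = some T) : minFrag st W T ⊆ canonFrag st (W ∪ minFrag st W T) := by
  classical
  obtain ⟨i', T', h', hT'⟩ := exists_minFrag_eq W h
  have hex : ∃ T'' j, st j = some T'' ∧ T'' ⊆ W ∪ minFrag st W T := by
    refine ⟨T', i', h', ?_⟩
    rw [hT']
    intro x hx
    simp only [Finset.mem_union, Finset.mem_sdiff]
    tauto
  rw [canonFrag, dif_pos hex]
  obtain ⟨j, hj, hsub⟩ := hex.choose_spec
  set T'' := hex.choose
  have hsd : T'' \ W ⊆ minFrag st W T := by
    intro x hx
    rw [Finset.mem_sdiff] at hx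
    rcases Finset.mem_union.1 (hsub hx.1) with h1 | h1
    · exact absurd h1 hx.2
    · exact h1
  have hcand : T'' \ W ∈ fragCandidates st W T := by
    simp only [fragCandidates, Finset.mem_filter, Finset.mem_powerset]
    exact ⟨hsd.trans (minFrag_subset W h), j, T'', hj, rfl⟩
  rw [← Finset.eq_of_subset_of_card_le hsd (minFrag_card_le h hcand)]
  exact Finset.sdiff_subset

end FragmentProcess

section Planting

variable {X V : Type*} [DecidableEq X] [DecidableEq V] [Fintype V]

/-- The copies all of whose elements are present in `g`. -/
def presentCopies (E : V → Finset X) (g : X → Bool) : Finset V :=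
  Finset.univ.filter fun k => ∀ x ∈ E k, g x = true

/-- The present copies with label `ℓ`. -/
def labelledCopies {R : ℕ} (E : V → Finset X) (lab : V → Fin (R + 1)) (g : X → Bool) (ℓ : ℕ) :
    Finset V :=
  (presentCopies E g).filter fun k => (lab k : ℕ) = ℓ

/-- Switch on all elements of the copies in `U`. -/
def plantEdges (E : V → Finset X) (U : Finset V) (g : X → Bool) : X → Bool :=
  (U.biUnion E).piecewise (fun _ => true) g

/-- The copies outside `U` created by planting `U`. -/
def newCopies (E : V → Finset X) (U : Finset V) (g : X → Bool) : Finset V :=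
  (presentCopies E (plantEdges E U g) \ presentCopies E g) \ U

/-- Give label `ℓ` to `U` and the last label to `N`. -/
def plantLabels {R : ℕ} (U N : Finset V) (ℓ : Fin (R + 1)) (lab : V → Fin (R + 1)) :
    V → Fin (R + 1) :=
  (U ∪ N).piecewise (fun k => if k ∈ U then ℓ else Fin.last R) lab

/-- The number of copies meeting `j`, other than `j`, which are present once `A` is planted. -/
def closeCopies (E : V → Finset X) (g : X → Bool) (A : Finset V) (j : V) : Finset V :=
  Finset.univ.filter fun k => k ≠ j ∧ (∀ x ∈ E k, g x = true ∨ x ∈ A.biUnion E) ∧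
    ¬ Disjoint (E k) (E j)

/-- No copy in `A` is close to more than `K` others. -/
def IsTypical (E : V → Finset X) (K : ℕ) (g : X → Bool) (A : Finset V) : Prop :=
  ∀ j ∈ A, (closeCopies E g A j).card ≤ K

theorem plantEdges_eq_true {E : V → Finset X} {U : Finset V} {g : X → Bool} {x : X} :
    plantEdges E U g x = true ↔ g x = true ∨ x ∈ U.biUnion E := by
  by_cases h : x ∈ U.biUnion E
  · simp [plantEdges, h]
  · simp only [plantEdges, Finset.piecewise_eq_of_notMem _ _ _ h, h, or_false]

theorem newCopies_card_le {E : V → Finset X} {K : ℕ} {g : X → Bool} {U A : Finset V}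
    (hA : IsTypical E K g A) (hU : U ⊆ A) : (newCopies E U g).card ≤ K * U.card := by
  have hsub : newCopies E U g ⊆ U.biUnion (closeCopies E g A) := by
    intro k hk
    simp only [newCopies, presentCopies, Finset.mem_sdiff, Finset.mem_filter, Finset.mem_univ,
      true_and, plantEdges_eq_true, not_forall] at hk
    obtain ⟨⟨h1, x, hx, hgx⟩, hkU⟩ := hk
    have hxU := (h1 x hx).resolve_left hgx
    obtain ⟨j, hj, hxj⟩ := Finset.mem_biUnion.1 hxU
    refine Finset.mem_biUnion.2 ⟨j, hj, ?_⟩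
    simp only [closeCopies, Finset.mem_filter, Finset.mem_univ, true_and]
    refine ⟨fun h => hkU (h ▸ hj), fun y hy => (h1 y hy).imp_right fun h =>
      Finset.biUnion_subset_biUnion_of_subset_left _ hU h, ?_⟩
    exact Finset.not_disjoint_iff.2 ⟨x, hx, hxj⟩
  calc (newCopies E U g).card ≤ (U.biUnion (closeCopies E g A)).card := Finset.card_le_card hsub
    _ ≤ U.card * K := Finset.card_biUnion_le_card_mul _ _ _ fun j hj => hA j (hU hj)
    _ = K * U.card := mul_comm _ _

theorem labelledCopies_plant {R : ℕ} {E : V → Finset X} {lab : V → Fin (R + 1)} {g : X → Bool}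
    {ℓ : Fin (R + 1)} (hℓ : (ℓ : ℕ) < R) {U : Finset V} {m : ℕ} (hm : m ≤ ℓ)
    (hd : Disjoint U (labelledCopies E lab g m)) :
    labelledCopies E (plantLabels U (newCopies E U g) ℓ lab) (plantEdges E U g) m =
      labelledCopies E lab g m ∪ if m = ℓ then U else ∅ := by
  ext k
  have hmono : k ∈ presentCopies E g → k ∈ presentCopies E (plantEdges E U g) := by
    simp only [presentCopies, Finset.mem_filter, Finset.mem_univ, true_and, plantEdges_eq_true]
    exact fun h x hx => Or.inl (h x hx)
  by_cases hU : k ∈ U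
  · have hp : k ∈ presentCopies E (plantEdges E U g) := by
      simp only [presentCopies, Finset.mem_filter, Finset.mem_univ, true_and, plantEdges_eq_true]
      exact fun x hx => Or.inr (Finset.mem_biUnion.2 ⟨k, hU, hx⟩)
    have hlab : plantLabels U (newCopies E U g) ℓ lab k = ℓ := by
      simp [plantLabels, hU]
    have hn := Finset.disjoint_left.1 hd hU
    simp only [labelledCopies, Finset.mem_filter, hp, hlab, true_and, Finset.mem_union] at hn ⊢
    by_cases h : m = ℓ
    · simp [h, hU]
    · simp only [h, if_false, Finset.notMem_empty, or_false, hn, iff_false]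
      exact fun h' => h h'.symm
  · have hif : k ∉ (if m = (ℓ : ℕ) then U else ∅) := by split_ifs <;> simp [hU]
    rw [Finset.mem_union, or_iff_left hif]
    by_cases hN : k ∈ newCopies E U g
    · have hlab : plantLabels U (newCopies E U g) ℓ lab k = Fin.last R := by
        simp [plantLabels, hU, hN]
      have hng : k ∉ presentCopies E g := by
        simp only [newCopies, Finset.mem_sdiff] at hN
        exact hN.1.2
      simp only [labelledCopies, Finset.mem_filter, hlab, hng, false_and, iff_false, Fin.val_last]
      omega
    · have hlab : plantLabels U (newCopies E U g) ℓ lab k = lab k := by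
        simp [plantLabels, hU, hN]
      simp only [newCopies, Finset.mem_sdiff] at hN
      simp only [labelledCopies, Finset.mem_filter, hlab]
      tauto

end Planting

section FragmentBound

variable {X V ι : Type*} [Fintype X] [DecidableEq X] [DecidableEq V] [Fintype V] [Fintype ι]

/-- Weights of the two values of a biased coin. -/
def coin (p : ℝ) (b : Bool) : ℝ := if b then p else 1 - p

theorem coin_nonneg {p : ℝ} (h0 : 0 ≤ p) (h1 : p ≤ 1) (b : Bool) : 0 ≤ coin p b := by
  cases b <;> simp [coin, h0, h1]

theorem sum_coin (p : ℝ) : ∑ b, coin p b = 1 := by simp [coin]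

open Classical in
theorem plant_labels_le {R : ℕ} {ν : Fin (R + 1) → ℝ} (hν : ∑ a, ν a = 1) (hν0 : ∀ a, 0 ≤ ν a)
    (hlast : 1 / 2 ≤ ν (Fin.last R)) {ℓ : Fin (R + 1)} (hℓ : 0 < ν ℓ) {U N : Finset V}
    (hd : Disjoint U N) {K : ℕ} (hN : N.card ≤ K * U.card) {φ : (V → Fin (R + 1)) → ℝ}
    (hφ : ∀ f, 0 ≤ φ f) :
    prodExp ν (fun f => φ (plantLabels U N ℓ f)) ≤
      ((ν ℓ)⁻¹ * 2 ^ K) ^ U.card * prodExp ν φ := by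
  have h := prodExp_piecewise_le hν hν0 (U ∪ N) (fun k => if k ∈ U then ℓ else Fin.last R) hφ
  rw [Finset.prod_union hd] at h
  have h1 : ∏ k ∈ U, ν (if k ∈ U then ℓ else Fin.last R) = ν ℓ ^ U.card := by
    rw [Finset.prod_congr rfl fun k hk => by rw [if_pos hk], Finset.prod_const]
  have h2 : ∏ k ∈ N, ν (if k ∈ U then ℓ else Fin.last R) = ν (Fin.last R) ^ N.card := by
    rw [Finset.prod_congr rfl fun k hk => by rw [if_neg (Finset.disjoint_right.1 hd hk)],
      Finset.prod_const]
  rw [h1, h2] at h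
  change _ * prodExp ν (fun f => φ (plantLabels U N ℓ f)) ≤ _ at h
  set B := prodExp ν (fun f => φ (plantLabels U N ℓ f))
  have hB : 0 ≤ B := prodExp_nonneg hν0 fun _ => hφ _
  have h3 : (2⁻¹ : ℝ) ^ (K * U.card) ≤ ν (Fin.last R) ^ N.card := by
    calc (2⁻¹ : ℝ) ^ (K * U.card) ≤ 2⁻¹ ^ N.card :=
          pow_le_pow_of_le_one (by norm_num) (by norm_num) hN
      _ ≤ _ := pow_le_pow_left₀ (by norm_num) (by linarith) _
  have h4 : ν ℓ ^ U.card * (2⁻¹ : ℝ) ^ (K * U.card) * B ≤ prodExp ν φ :=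
    (mul_le_mul_of_nonneg_right (mul_le_mul_of_nonneg_left h3 (by positivity)) hB).trans h
  have h5 : ((ν ℓ)⁻¹ * 2 ^ K) ^ U.card * (ν ℓ ^ U.card * (2⁻¹ : ℝ) ^ (K * U.card)) = 1 := by
    rw [pow_mul, ← mul_pow, ← mul_pow]
    have : (ν ℓ)⁻¹ * 2 ^ K * (ν ℓ * (2⁻¹ : ℝ) ^ K) = 1 := by
      rw [inv_pow]; field_simp
    rw [this, one_pow]
  calc B = ((ν ℓ)⁻¹ * 2 ^ K) ^ U.card * (ν ℓ ^ U.card * (2⁻¹ : ℝ) ^ (K * U.card) * B) := by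
        rw [← mul_assoc, h5, one_mul]
    _ ≤ _ := mul_le_mul_of_nonneg_left h4 (by positivity)

theorem plant_edges_le {p : ℝ} (hp : 0 < p) (hp1 : p ≤ 1) {E : V → Finset X} {t : ℕ}
    (hE : ∀ k, (E k).card ≤ t) (U : Finset V) {φ : (X → Bool) → ℝ} (hφ : ∀ f, 0 ≤ φ f) :
    prodExp (coin p) (fun g => φ (plantEdges E U g)) ≤
      ((p ^ t)⁻¹) ^ U.card * prodExp (coin p) φ := by
  have h := prodExp_piecewise_le (sum_coin p) (coin_nonneg hp.le hp1) (U.biUnion E)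
    (fun _ => true) hφ
  change _ * prodExp (coin p) (fun g => φ (plantEdges E U g)) ≤ _ at h
  set B := prodExp (coin p) (fun g => φ (plantEdges E U g))
  have hB : 0 ≤ B := prodExp_nonneg (coin_nonneg hp.le hp1) fun _ => hφ _
  have hc : (U.biUnion E).card ≤ t * U.card := by
    rw [mul_comm]; exact Finset.card_biUnion_le_card_mul _ _ _ fun k _ => hE k
  simp only [coin, if_true, Finset.prod_const] at h
  have h3 : p ^ (t * U.card) ≤ p ^ (U.biUnion E).card := pow_le_pow_of_le_one hp.le hp1 hc
  have h4 : p ^ (t * U.card) * B ≤ prodExp (coin p) φ :=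
    (mul_le_mul_of_nonneg_right h3 hB).trans h
  rw [inv_pow, ← pow_mul, ← div_eq_inv_mul, le_div_iff₀ (by positivity), mul_comm]
  exact h4

theorem prodExp_prodExp_sum {I A J B T : Type*} [Fintype I] [DecidableEq I] [Fintype A] [Fintype J]
    [DecidableEq J] [Fintype B] (s : Finset T) (ν : A → ℝ) (ρ : B → ℝ)
    (φ : T → (I → A) → (J → B) → ℝ) :
    prodExp ν (fun g => prodExp ρ fun f => ∑ j ∈ s, φ j g f) =
      ∑ j ∈ s, prodExp ν fun g => prodExp ρ fun f => φ j g f := by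
  simp only [prodExp_sum]

open Classical in
theorem sum_fragment_event_le {R : ℕ} {ν : Fin (R + 1) → ℝ} (hν : ∑ a, ν a = 1)
    (hν0 : ∀ a, 0 ≤ ν a) (hlast : 1 / 2 ≤ ν (Fin.last R)) {ℓ : Fin (R + 1)} (hℓ : 0 < ν ℓ)
    {p : ℝ} (hp : 0 < p) (hp1 : p ≤ 1) {E : V → Finset X} {t : ℕ} (hE : ∀ k, (E k).card ≤ t)
    {K : ℕ} {w : ι → ℝ} (hw : ∀ i, 0 ≤ w i) {S : ι → Finset V} {κ : ℝ} (hκ : 0 ≤ κ)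
    (hS : ∀ A : Finset V, ∑ i, (if A ⊆ S i then w i else 0) ≤ κ ^ A.card)
    (can : (V → Fin (R + 1)) → (X → Bool) → Finset V) {k u : ℕ}
    (hcan : ∀ f g, (can f g).card ≤ k)
    (ev : (V → Fin (R + 1)) → (X → Bool) → ι → Finset V → Prop)
    (hev : ∀ f g i U, ev f g i U → U ⊆ S i ∧ (newCopies E U g).card ≤ K * U.card ∧
      U ⊆ can (plantLabels U (newCopies E U g) ℓ f) (plantEdges E U g)) :
    prodExp (coin p) (fun g => prodExp ν fun f => ∑ i,
      ∑ U ∈ Finset.univ.filter (fun U : Finset V => U.card = u), if ev f g i U then w i else 0) ≤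
      k.choose u * (κ * ((ν ℓ)⁻¹ * 2 ^ K * (p ^ t)⁻¹)) ^ u := by
  have hc0 := coin_nonneg hp.le hp1
  set ψ : Finset V → (V → Fin (R + 1)) → (X → Bool) → ℝ :=
    fun U f g => if U ⊆ can f g then 1 else 0
  have hψ : ∀ U f g, 0 ≤ ψ U f g := fun U f g => by simp only [ψ]; split_ifs <;> norm_num
  set D := ((ν ℓ)⁻¹ * 2 ^ K * (p ^ t)⁻¹) with hD
  have hD0 : 0 ≤ D := by positivity
  have hU : ∀ U : Finset V, U.card = u →
      prodExp (coin p) (fun g => prodExp ν fun f => ∑ i, if ev f g i U then w i else 0) ≤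
        (κ * D) ^ u * prodExp (coin p) (fun g => prodExp ν fun f => ψ U f g) := by
    intro U hUc
    have h1 : ∀ f g, (∑ i, if ev f g i U then w i else 0) ≤
        κ ^ u * (if (newCopies E U g).card ≤ K * U.card then
          ψ U (plantLabels U (newCopies E U g) ℓ f) (plantEdges E U g) else 0) := by
      intro f g
      by_cases hN : (newCopies E U g).card ≤ K * U.card ∧
          U ⊆ can (plantLabels U (newCopies E U g) ℓ f) (plantEdges E U g)
      · rw [if_pos hN.1]
        simp only [ψ, if_pos hN.2, mul_one]
        rw [← hUc]
        refine le_trans (Finset.sum_le_sum fun i _ => ?_) (hS U)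
        by_cases he : ev f g i U
        · rw [if_pos he, if_pos (hev f g i U he).1]
        · rw [if_neg he]; split_ifs <;> simp [hw]
      · have : ∀ i, ¬ ev f g i U := fun i he => hN (hev f g i U he).2
        simp only [this, if_false, Finset.sum_const_zero]
        refine mul_nonneg (pow_nonneg hκ _) ?_
        split_ifs
        · exact hψ _ _ _
        · exact le_rfl
    have h2 : ∀ g, prodExp ν (fun f => ∑ i, if ev f g i U then w i else 0) ≤
        (κ * ((ν ℓ)⁻¹ * 2 ^ K)) ^ u * prodExp ν (fun f => ψ U f (plantEdges E U g)) := by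
      intro g
      refine (prodExp_mono hν0 fun f => h1 f g).trans ?_
      rw [prodExp_const_mul, mul_pow, mul_assoc]
      refine mul_le_mul_of_nonneg_left ?_ (pow_nonneg hκ _)
      by_cases hN : (newCopies E U g).card ≤ K * U.card
      · simp only [hN, if_true]
        rw [← hUc]
        exact plant_labels_le hν hν0 hlast hℓ Finset.disjoint_sdiff hN
          (φ := fun f => ψ U f (plantEdges E U g)) fun f => hψ _ _ _
      · simp only [hN, if_false]
        rw [prodExp_const hν]
        exact mul_nonneg (by positivity) (prodExp_nonneg hν0 fun f => hψ _ _ _)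
    refine (prodExp_mono hc0 h2).trans ?_
    rw [prodExp_const_mul]
    have h3 := plant_edges_le hp hp1 hE U (φ := fun g => prodExp ν fun f => ψ U f g)
      fun g => prodExp_nonneg hν0 fun f => hψ _ _ _
    rw [hUc] at h3
    refine (mul_le_mul_of_nonneg_left h3 (by positivity)).trans_eq ?_
    rw [← mul_assoc, ← mul_pow, hD]
    ring_nf
  have hsw : ∀ g f, (∑ i, ∑ U ∈ Finset.univ.filter (fun U : Finset V => U.card = u),
      if ev f g i U then w i else 0) = ∑ U ∈ Finset.univ.filter (fun U : Finset V => U.card = u),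
      ∑ i, if ev f g i U then w i else 0 := fun g f => Finset.sum_comm
  simp only [hsw]
  rw [prodExp_prodExp_sum]
  refine (Finset.sum_le_sum fun U hU' => hU U (Finset.mem_filter.1 hU').2).trans ?_
  rw [← Finset.mul_sum, mul_comm]
  refine mul_le_mul_of_nonneg_right ?_ (by positivity)
  rw [← prodExp_prodExp_sum]
  calc _ ≤ prodExp (coin p) (fun _ : X → Bool =>
        prodExp ν fun _ : V → Fin (R + 1) => (k.choose u : ℝ)) := by
        refine prodExp_mono hc0 fun g => ?_
        refine prodExp_mono hν0 fun f => ?_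
        simp only [ψ]
        rw [Finset.sum_boole, Finset.filter_filter]
        have : Finset.univ.filter (fun U : Finset V => U.card = u ∧ U ⊆ can f g) =
            (can f g).powersetCard u := by
          ext U; simp [Finset.mem_powersetCard, and_comm]
        rw [this, Finset.card_powersetCard]
        exact_mod_cast Nat.choose_le_choose u (hcan f g)
    _ = _ := by rw [prodExp_const hν, prodExp_const (sum_coin p)]

open Classical in
/-- The fragmentation bound: a spread measure on families of copies, most of which are typical,
forces some member to be entirely present. -/
theorem fragmentation_bound {R : ℕ} {ν : Fin (R + 1) → ℝ} (hν : ∑ a, ν a = 1)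
    (hν0 : ∀ a, 0 < ν a) (hlast : 1 / 2 ≤ ν (Fin.last R))
    {p : ℝ} (hp : 0 < p) (hp1 : p ≤ 1) {E : V → Finset X} {t : ℕ} (hE : ∀ k, (E k).card ≤ t)
    {K : ℕ} {w : ι → ℝ} (hw : ∀ i, 0 ≤ w i) (hw1 : ∑ i, w i = 1) {S : ι → Finset V} {κ : ℝ}
    (hκ : 0 ≤ κ) (hS : ∀ A : Finset V, ∑ i, (if A ⊆ S i then w i else 0) ≤ κ ^ A.card)
    {kp : ℕ → ℕ} (h0 : ∀ i, (S i).card ≤ kp 0) (hR : kp R = 0) :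
    prodExp (coin p) (fun g => if ∃ i, S i ⊆ presentCopies E g then (0 : ℝ) else 1) ≤
      prodExp (coin p) (fun g => ∑ i, if IsTypical E K g (S i) then 0 else w i) +
      ∑ ℓ : Fin R, ∑ u ∈ Finset.Ioc (kp (ℓ + 1)) (kp ℓ), (kp ℓ).choose u *
        (κ * ((ν ℓ.castSucc)⁻¹ * 2 ^ K * (p ^ t)⁻¹)) ^ u := by
  have hc0 := coin_nonneg hp.le hp1
  have hν0' := fun a => (hν0 a).le
  set ks : ℕ → ℕ := fun ℓ => kp (ℓ + 1)
  let st : (V → Fin (R + 1)) → (X → Bool) → ℕ → ι → Option (Finset V) :=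
    fun f g => fragState S ks (labelledCopies E f g)
  obtain ⟨ev, hev⟩ : ∃ ev : ℕ → (V → Fin (R + 1)) → (X → Bool) → ι → Finset V → Prop,
      ∀ ℓ f g i U, ev ℓ f g i U ↔ IsTypical E K g (S i) ∧ ∃ T, st f g ℓ i = some T ∧
        minFrag (st f g ℓ) (labelledCopies E f g ℓ) T = U := ⟨_, fun _ _ _ _ _ => Iff.rfl⟩
  have hcard : ∀ f g ℓ i T, st f g ℓ i = some T → T.card ≤ kp ℓ :=
    fun f g ℓ i T h => fragState_card_le h0 (fun _ => rfl) h
  have hround : ∀ (ℓ : Fin R) (u : ℕ), prodExp (coin p) (fun g => prodExp ν fun f => ∑ i,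
      ∑ U ∈ Finset.univ.filter (fun U : Finset V => U.card = u),
        if ev ℓ f g i U then w i else 0) ≤
      (kp ℓ).choose u * (κ * ((ν ℓ.castSucc)⁻¹ * 2 ^ K * (p ^ t)⁻¹)) ^ u := by
    intro ℓ u
    have hcan : ∀ f g, (canonFrag (st f g ℓ) (labelledCopies E f g ℓ)).card ≤ kp ℓ :=
      fun f g => canonFrag_card_le (hcard f g ℓ)
    refine sum_fragment_event_le (ℓ := ℓ.castSucc) (k := kp ℓ) (u := u) (K := K) (t := t) (κ := κ)
      hν hν0' hlast (hν0 _) hp hp1 hE hw hκ hS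
      (fun f g => canonFrag (st f g ℓ) (labelledCopies E f g ℓ)) hcan
      (fun f g i U => ev ℓ f g i U) ?_
    intro f g i U he
    obtain ⟨htyp, T, hT, rfl⟩ := (hev _ _ _ _ _).1 he
    set U := minFrag (st f g ℓ) (labelledCopies E f g ℓ) T with hU
    have hUT : U ⊆ T := minFrag_subset _ hT
    have hUS : U ⊆ S i := hUT.trans (fragState_subset hT)
    refine ⟨hUS, newCopies_card_le htyp hUS, ?_⟩
    have hdis : ∀ m ≤ (ℓ : ℕ), Disjoint U (labelledCopies E f g m) := by
      intro m hm
      rcases hm.lt_or_eq with hm | rfl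
      · exact (fragState_disjoint hT hm).mono_left hUT
      · obtain ⟨i', T', -, h'⟩ := exists_minFrag_eq (labelledCopies E f g ℓ) hT
        rw [hU, h']
        exact Finset.sdiff_disjoint
    have hW : ∀ m ≤ (ℓ : ℕ), labelledCopies E (plantLabels U (newCopies E U g) ℓ.castSucc f)
        (plantEdges E U g) m = labelledCopies E f g m ∪ if m = ℓ then U else ∅ :=
      fun m hm => labelledCopies_plant (ℓ := ℓ.castSucc) (by simp) (by simpa using hm)
        (hdis m hm)
    have hst : st (plantLabels U (newCopies E U g) ℓ.castSucc f) (plantEdges E U g) ℓ =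
        st f g ℓ := by
      refine fragState_congr fun m hm => ?_
      rw [hW m hm.le, if_neg hm.ne, Finset.union_empty]
    rw [hst, hW ℓ le_rfl, if_pos rfl]
    exact minFrag_subset_canonFrag _ hT
  have hdead : ∀ f g i, IsTypical E K g (S i) → ∀ m ≤ R, st f g m i = none →
      ∃ ℓ : Fin R, ∃ u ∈ Finset.Ioc (kp (ℓ + 1)) (kp ℓ), ∃ U : Finset V, U.card = u ∧
        ev ℓ f g i U := by
    intro f g i htyp m
    induction m with
    | zero => intro _ h; simp [st, fragState] at h
    | succ m ih =>
      intro hm h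
      rcases fragState_succ_eq_none h with h | ⟨T, hT, hlt⟩
      · exact ih (by omega) h
      · refine ⟨⟨m, hm⟩, _, ?_, _, rfl, (hev _ _ _ _ _).2 ⟨htyp, T, hT, rfl⟩⟩
        exact Finset.mem_Ioc.2 ⟨hlt, (Finset.card_le_card (minFrag_subset _ hT)).trans
          (hcard f g m i T hT)⟩
  have hpt : ∀ g f, (if ∃ i, S i ⊆ presentCopies E g then (0 : ℝ) else 1) ≤
      (∑ i, if IsTypical E K g (S i) then 0 else w i) +
      ∑ ℓ : Fin R, ∑ u ∈ Finset.Ioc (kp (ℓ + 1)) (kp ℓ), ∑ i,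
        ∑ U ∈ Finset.univ.filter (fun U : Finset V => U.card = u),
          if ev ℓ f g i U then w i else 0 := by
    intro g f
    have hnn : ∀ (ℓ : ℕ) i (U : Finset V), 0 ≤ if ev ℓ f g i U then w i else 0 := by
      intro ℓ i U; split_ifs <;> simp [hw]
    split_ifs with hex
    · refine add_nonneg (Finset.sum_nonneg fun i _ => by split_ifs <;> simp [hw]) ?_
      exact Finset.sum_nonneg fun ℓ _ => Finset.sum_nonneg fun u _ =>
        Finset.sum_nonneg fun i _ => Finset.sum_nonneg fun U _ => hnn _ _ _
    · have hnone : ∀ i, st f g R i = none := by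
        intro i
        rcases h : st f g R i with _ | T
        · rfl
        · exfalso
          have hT : T = ∅ := by
            rw [← Finset.card_eq_zero]
            have := hcard f g R i T h
            omega
          obtain ⟨i', hi'⟩ := exists_subset_of_fragState h
          refine hex ⟨i', hi'.trans ?_⟩
          rw [hT, Finset.empty_union]
          exact Finset.biUnion_subset.2 fun m _ => Finset.filter_subset _ _
      rw [← hw1]
      have hsw : (∑ ℓ : Fin R, ∑ u ∈ Finset.Ioc (kp (ℓ + 1)) (kp ℓ), ∑ i,
          ∑ U ∈ Finset.univ.filter (fun U : Finset V => U.card = u),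
            if ev ℓ f g i U then w i else 0) = ∑ i, ∑ ℓ : Fin R,
          ∑ u ∈ Finset.Ioc (kp (ℓ + 1)) (kp ℓ),
          ∑ U ∈ Finset.univ.filter (fun U : Finset V => U.card = u),
            if ev ℓ f g i U then w i else 0 := by
        rw [Finset.sum_comm]
        exact Finset.sum_congr rfl fun ℓ _ => Finset.sum_comm
      rw [hsw, ← Finset.sum_add_distrib]
      refine Finset.sum_le_sum fun i _ => ?_
      have hnn' : ∀ ℓ : Fin R, 0 ≤ ∑ u ∈ Finset.Ioc (kp (ℓ + 1)) (kp ℓ),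
          ∑ U ∈ Finset.univ.filter (fun U : Finset V => U.card = u),
            if ev ℓ f g i U then w i else 0 := fun ℓ =>
        Finset.sum_nonneg fun u _ => Finset.sum_nonneg fun U _ => hnn _ _ _
      by_cases htyp : IsTypical E K g (S i)
      · rw [if_pos htyp, zero_add]
        obtain ⟨ℓ, u, hu, U, hUc, he⟩ := hdead f g i htyp R le_rfl (hnone i)
        calc w i = if ev ℓ f g i U then w i else 0 := by rw [if_pos he]
          _ ≤ ∑ U ∈ Finset.univ.filter (fun U : Finset V => U.card = u),
                if ev ℓ f g i U then w i else 0 :=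
            Finset.single_le_sum (f := fun U => if ev ℓ f g i U then w i else 0)
              (fun U _ => hnn _ _ _) (Finset.mem_filter.2 ⟨Finset.mem_univ _, hUc⟩)
          _ ≤ ∑ u ∈ Finset.Ioc (kp (ℓ + 1)) (kp ℓ),
                ∑ U ∈ Finset.univ.filter (fun U : Finset V => U.card = u),
                  if ev ℓ f g i U then w i else 0 :=
            Finset.single_le_sum (f := fun u =>
              ∑ U ∈ Finset.univ.filter (fun U : Finset V => U.card = u),
                if ev ℓ f g i U then w i else 0)
              (fun u _ => Finset.sum_nonneg fun U _ => hnn _ _ _) hu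
          _ ≤ _ := Finset.single_le_sum (f := fun ℓ : Fin R =>
              ∑ u ∈ Finset.Ioc (kp (ℓ + 1)) (kp ℓ),
                ∑ U ∈ Finset.univ.filter (fun U : Finset V => U.card = u),
                  if ev ℓ f g i U then w i else 0)
              (fun ℓ _ => hnn' ℓ) (Finset.mem_univ ℓ)
      · rw [if_neg htyp]
        exact le_add_of_nonneg_right (Finset.sum_nonneg fun ℓ _ => hnn' ℓ)
  calc _ = prodExp (coin p) (fun g => prodExp ν fun _ : V → Fin (R + 1) =>
        if ∃ i, S i ⊆ presentCopies E g then (0 : ℝ) else 1) := by simp only [prodExp_const hν]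
    _ ≤ prodExp (coin p) (fun g => prodExp ν fun f =>
        (∑ i, if IsTypical E K g (S i) then 0 else w i) +
        ∑ ℓ : Fin R, ∑ u ∈ Finset.Ioc (kp (ℓ + 1)) (kp ℓ), ∑ i,
          ∑ U ∈ Finset.univ.filter (fun U : Finset V => U.card = u),
            if ev ℓ f g i U then w i else 0) :=
      prodExp_mono hc0 fun g => prodExp_mono hν0' fun f => hpt g f
    _ = prodExp (coin p) (fun g => ∑ i, if IsTypical E K g (S i) then 0 else w i) +
        ∑ ℓ : Fin R, ∑ u ∈ Finset.Ioc (kp (ℓ + 1)) (kp ℓ),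
          prodExp (coin p) (fun g => prodExp ν fun f => ∑ i,
            ∑ U ∈ Finset.univ.filter (fun U : Finset V => U.card = u),
              if ev ℓ f g i U then w i else 0) := by
      simp only [prodExp_add, prodExp_const hν, prodExp_sum]
    _ ≤ _ := by
      refine add_le_add le_rfl (Finset.sum_le_sum fun ℓ _ => Finset.sum_le_sum fun u _ => hround ℓ u)

end FragmentBound

section Typicality

variable {X V ι : Type*} [Fintype X] [DecidableEq X] [DecidableEq V] [Fintype V] [Fintype ι]

theorem sum_trace_le {E : V → Finset X} {Z : Finset X} {T : Finset V} {P : Finset X → Prop}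
    (hT : ∀ k ∈ T, P (E k ∩ Z)) {F : Finset X → ℝ} (hF : ∀ B, 0 ≤ F B) {c : ℝ} (hc : 0 ≤ c)
    (h : ∀ B, P B → ((Finset.univ.filter fun k => B ⊆ E k).card : ℝ) * F B ≤ c) :
    ∑ k ∈ T, F (E k ∩ Z) ≤ 2 ^ Z.card * c := by
  rw [← Finset.sum_fiberwise_of_maps_to (s := T) (t := Z.powerset) (g := fun k => E k ∩ Z)
    fun k _ => Finset.mem_powerset.2 Finset.inter_subset_right]
  calc _ ≤ ∑ _B ∈ Z.powerset, c := by
        refine Finset.sum_le_sum fun B _ => ?_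
        rcases (T.filter fun k => E k ∩ Z = B).eq_empty_or_nonempty with he | ⟨k, hk⟩
        · rw [he]; simpa using hc
        · rw [Finset.mem_filter] at hk
          rw [Finset.sum_congr rfl fun k hk => by rw [(Finset.mem_filter.1 hk).2],
            Finset.sum_const, nsmul_eq_mul]
          refine le_trans (mul_le_mul_of_nonneg_right ?_ (hF B)) (h B (hk.2 ▸ hT k hk.1))
          refine Nat.cast_le.2 (Finset.card_le_card fun k hk => ?_)
          rw [Finset.mem_filter] at hk ⊢
          exact ⟨Finset.mem_univ _, hk.2 ▸ Finset.inter_subset_left⟩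
    _ = _ := by rw [Finset.sum_const, Finset.card_powerset, nsmul_eq_mul]; push_cast; ring

open Classical in
/-- Under a spread measure, a set is covered by the chosen copies about as often as it is
contained in a random set of density `p₀`. -/
theorem spread_cover_le {E : V → Finset X} {t : ℕ} {w : ι → ℝ} (hw : ∀ i, 0 ≤ w i)
    {S : ι → Finset V} {C₁ p₀ : ℝ} (hC₁ : 1 ≤ C₁) (hp₀ : 0 < p₀)
    (hS : ∀ A : Finset V, ∑ i, (if A ⊆ S i then w i else 0) ≤ (C₁ * p₀ ^ t) ^ A.card)
    (hcod : ∀ B : Finset X, B.Nonempty →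
      ((Finset.univ.filter fun k => B ⊆ E k).card : ℝ) * p₀ ^ t ≤ C₁ * p₀ ^ B.card)
    (M : ℕ) (Z : Finset X) (hZ : Z.card ≤ M) (A : Finset V) (hd : Disjoint Z (A.biUnion E)) :
    ∑ i, (if A ⊆ S i ∧ Z ⊆ (S i).biUnion E then w i else 0) ≤
      (C₁ * p₀ ^ t) ^ A.card * (2 ^ M * C₁ ^ 2 * p₀) ^ Z.card := by
  induction hn : Z.card using Nat.strong_induction_on generalizing Z A with
  | _ n ih =>
    rcases Z.eq_empty_or_nonempty with rfl | ⟨y, hy⟩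
    · simp only [Finset.card_empty] at hn
      subst hn
      simpa using hS A
    · set a : ℝ := 2 ^ M * C₁ ^ 2
      have ha : 1 ≤ a := one_le_mul_of_one_le_of_one_le (one_le_pow₀ (by norm_num))
        (one_le_pow₀ hC₁)
      have hn0 : 0 < n := hn ▸ Finset.card_pos.2 ⟨y, hy⟩
      have h1 : ∀ i, (if A ⊆ S i ∧ Z ⊆ (S i).biUnion E then w i else 0) ≤
          ∑ k ∈ Finset.univ.filter (fun k => y ∈ E k),
            if insert k A ⊆ S i ∧ Z \ E k ⊆ (S i).biUnion E then w i else 0 := by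
        intro i
        have hnn : ∀ k, 0 ≤ if insert k A ⊆ S i ∧ Z \ E k ⊆ (S i).biUnion E then w i else 0 := by
          intro k; split_ifs <;> simp [hw]
        split_ifs with h
        · obtain ⟨k, hk, hyk⟩ := Finset.mem_biUnion.1 (h.2 hy)
          have hc : insert k A ⊆ S i ∧ Z \ E k ⊆ (S i).biUnion E :=
            ⟨Finset.insert_subset hk h.1, Finset.sdiff_subset.trans h.2⟩
          calc w i = if insert k A ⊆ S i ∧ Z \ E k ⊆ (S i).biUnion E then w i else 0 := by
                rw [if_pos hc]
            _ ≤ _ := Finset.single_le_sum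
              (f := fun k => if insert k A ⊆ S i ∧ Z \ E k ⊆ (S i).biUnion E then w i else 0)
              (fun k _ => hnn k) (Finset.mem_filter.2 ⟨Finset.mem_univ _, hyk⟩)
        · exact Finset.sum_nonneg fun k _ => hnn k
      have h2 : ∀ k ∈ Finset.univ.filter (fun k => y ∈ E k),
          ∑ i, (if insert k A ⊆ S i ∧ Z \ E k ⊆ (S i).biUnion E then w i else 0) ≤
            (C₁ * p₀ ^ t) ^ A.card * ((C₁ * p₀ ^ t) * (a * p₀) ^ (Z.card - (E k ∩ Z).card)) := by
        intro k hk
        rw [Finset.mem_filter] at hk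
        have hkA : k ∉ A := fun hkA => Finset.disjoint_left.1 hd hy
          (Finset.mem_biUnion.2 ⟨k, hkA, hk.2⟩)
        have hcard : (Z \ E k).card = Z.card - (E k ∩ Z).card := Finset.card_sdiff
        have hpos : 0 < (E k ∩ Z).card :=
          Finset.card_pos.2 ⟨y, Finset.mem_inter.2 ⟨hk.2, hy⟩⟩
        have := ih (Z \ E k).card (by omega) (Z \ E k) (by omega) (insert k A) (by
          rw [Finset.biUnion_insert, Finset.disjoint_union_right]
          exact ⟨Finset.sdiff_disjoint, hd.mono_left Finset.sdiff_subset⟩) rfl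
        rw [Finset.card_insert_of_notMem hkA, pow_succ, hcard, mul_assoc] at this
        exact this
      refine (Finset.sum_le_sum fun i _ => h1 i).trans ?_
      rw [Finset.sum_comm]
      refine (Finset.sum_le_sum h2).trans ?_
      rw [← Finset.mul_sum, ← Finset.mul_sum]
      refine mul_le_mul_of_nonneg_left ?_ (by positivity)
      have h3 := sum_trace_le (E := E) (Z := Z) (T := Finset.univ.filter fun k => y ∈ E k)
        (P := fun B => B.Nonempty ∧ B.card ≤ n) (F := fun B => (a * p₀) ^ (Z.card - B.card))
        (c := C₁ * p₀ ^ n * a ^ (n - 1) / p₀ ^ t)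
        (fun k hk => ⟨⟨y, Finset.mem_inter.2 ⟨(Finset.mem_filter.1 hk).2, hy⟩⟩,
          hn ▸ Finset.card_le_card Finset.inter_subset_right⟩)
        (fun B => by positivity) (by positivity) (by
          rintro B ⟨hB, hBn⟩
          rw [le_div_iff₀ (by positivity), mul_right_comm, hn]
          have hB0 := Finset.card_pos.2 hB
          calc _ ≤ C₁ * p₀ ^ B.card * (a * p₀) ^ (n - B.card) :=
                mul_le_mul_of_nonneg_right (hcod B hB) (by positivity)
            _ = C₁ * (p₀ ^ B.card * p₀ ^ (n - B.card)) * a ^ (n - B.card) := by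
              rw [mul_pow]; ring
            _ = C₁ * p₀ ^ n * a ^ (n - B.card) := by
              rw [← pow_add, Nat.add_sub_cancel' hBn]
            _ ≤ _ := mul_le_mul_of_nonneg_left (pow_le_pow_right₀ ha (by omega)) (by positivity))
      refine (mul_le_mul_of_nonneg_left h3 (by positivity)).trans ?_
      rw [hn]
      have h4 : (2 : ℝ) ^ n ≤ 2 ^ M := pow_le_pow_right₀ (by norm_num) (hn ▸ hZ)
      calc C₁ * p₀ ^ t * (2 ^ n * (C₁ * p₀ ^ n * a ^ (n - 1) / p₀ ^ t))
          = 2 ^ n * (C₁ ^ 2 * p₀ ^ n * a ^ (n - 1)) := by field_simp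
        _ ≤ 2 ^ M * (C₁ ^ 2 * p₀ ^ n * a ^ (n - 1)) :=
          mul_le_mul_of_nonneg_right h4 (by positivity)
        _ = p₀ ^ n * (a ^ (n - 1) * a) := by ring
        _ = (a * p₀) ^ n := by rw [← pow_succ, Nat.sub_add_cancel hn0, mul_pow]; ring

open Classical in
theorem spread_union_cover_le {E : V → Finset X} {t : ℕ} {w : ι → ℝ} (hw : ∀ i, 0 ≤ w i)
    {S : ι → Finset V} {C₁ p₀ p : ℝ} (hC₁ : 1 ≤ C₁) (hp₀ : 0 < p₀) (hp : p₀ ≤ p) (hp1 : p ≤ 1)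
    (hS : ∀ A : Finset V, ∑ i, (if A ⊆ S i then w i else 0) ≤ (C₁ * p₀ ^ t) ^ A.card)
    (hcod : ∀ B : Finset X, B.Nonempty →
      ((Finset.univ.filter fun k => B ⊆ E k).card : ℝ) * p₀ ^ t ≤ C₁ * p₀ ^ B.card)
    (M : ℕ) (Y : Finset X) (hY : Y.card ≤ M) (j : V) (hd : Disjoint Y (E j)) :
    prodExp (coin p) (fun g => ∑ i,
      if j ∈ S i ∧ ∀ x ∈ Y, g x = true ∨ x ∈ (S i).biUnion E then w i else 0) ≤
      C₁ * p₀ ^ t * (1 + 2 ^ M * C₁ ^ 2) ^ M * p ^ Y.card := by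
  set a : ℝ := 2 ^ M * C₁ ^ 2
  have hp0 : 0 ≤ p := hp₀.le.trans hp
  have ha : 0 ≤ a := by positivity
  have hc0 := coin_nonneg hp0 hp1
  have h1 : ∀ (g : X → Bool) i, (if j ∈ S i ∧ ∀ x ∈ Y, g x = true ∨ x ∈ (S i).biUnion E then w i else 0) ≤
      ∑ Z ∈ Y.powerset, (if {j} ⊆ S i ∧ Z ⊆ (S i).biUnion E then w i else 0) *
        if ∀ x ∈ Y \ Z, g x = true then 1 else 0 := by
    intro g i
    have hnn : ∀ Z, 0 ≤ (if {j} ⊆ S i ∧ Z ⊆ (S i).biUnion E then w i else 0) *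
        if ∀ x ∈ Y \ Z, g x = true then (1 : ℝ) else 0 := by
      intro Z
      refine mul_nonneg ?_ ?_ <;> split_ifs <;> simp [hw]
    split_ifs with h
    · have h2 := Finset.single_le_sum (f := fun Z =>
        (if {j} ⊆ S i ∧ Z ⊆ (S i).biUnion E then w i else 0) *
        if ∀ x ∈ Y \ Z, g x = true then (1 : ℝ) else 0) (fun Z _ => hnn Z)
        (Finset.mem_powerset.2 (Finset.inter_subset_left : Y ∩ (S i).biUnion E ⊆ Y))
      refine le_trans (le_of_eq ?_) h2
      have e1 : {j} ⊆ S i ∧ Y ∩ (S i).biUnion E ⊆ (S i).biUnion E :=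
        ⟨Finset.singleton_subset_iff.2 h.1, Finset.inter_subset_right⟩
      have e2 : ∀ x ∈ Y \ (Y ∩ (S i).biUnion E), g x = true := by
        intro x hx
        rw [Finset.mem_sdiff, Finset.mem_inter] at hx
        exact (h.2 x hx.1).resolve_right fun h' => hx.2 ⟨hx.1, h'⟩
      rw [if_pos e1, if_pos e2, mul_one]
    · exact Finset.sum_nonneg fun Z _ => hnn Z
  have h2 : ∀ Z ∈ Y.powerset, prodExp (coin p) (fun g => ∑ i,
      (if {j} ⊆ S i ∧ Z ⊆ (S i).biUnion E then w i else 0) *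
        if ∀ x ∈ Y \ Z, g x = true then (1 : ℝ) else 0) ≤
      C₁ * p₀ ^ t * (a ^ Z.card * p ^ Y.card) := by
    intro Z hZ
    rw [Finset.mem_powerset] at hZ
    simp only [← Finset.sum_mul]
    have hfe : prodExp (coin p) (fun g : X → Bool =>
        if ∀ x ∈ Y \ Z, g x = true then (1 : ℝ) else 0) = p ^ (Y \ Z).card := by
      have := prodExp_forall_eq (sum_coin p) (Y \ Z) fun _ => true
      simp only [coin, if_true, Finset.prod_const] at this
      convert this
    rw [prodExp_const_mul, hfe]
    have h3 := spread_cover_le hw hC₁ hp₀ hS hcod M Z ((Finset.card_le_card hZ).trans hY) {j}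
      (by simpa using hd.mono_left hZ)
    rw [Finset.card_singleton, pow_one] at h3
    refine (mul_le_mul_of_nonneg_right h3 (by positivity)).trans ?_
    have h4 : Y.card = Z.card + (Y \ Z).card := by
      rw [Finset.card_sdiff_of_subset hZ, Nat.add_sub_cancel' (Finset.card_le_card hZ)]
    rw [h4, pow_add, mul_pow, mul_assoc]
    refine mul_le_mul_of_nonneg_left ?_ (by positivity)
    rw [mul_assoc]
    refine mul_le_mul_of_nonneg_left ?_ (by positivity)
    exact mul_le_mul_of_nonneg_right (pow_le_pow_left₀ hp₀.le hp _) (by positivity)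
  have h3 : ∑ Z ∈ Y.powerset, a ^ Z.card ≤ (1 + a) ^ M := by
    have := Finset.sum_pow_mul_eq_add_pow a 1 Y
    simp only [one_pow, mul_one] at this
    rw [this, add_comm]
    exact pow_le_pow_right₀ (by linarith) hY
  calc _ ≤ prodExp (coin p) (fun g => ∑ Z ∈ Y.powerset, ∑ i,
        (if {j} ⊆ S i ∧ Z ⊆ (S i).biUnion E then w i else 0) *
        if ∀ x ∈ Y \ Z, g x = true then (1 : ℝ) else 0) := by
        refine prodExp_mono hc0 fun g => ?_
        rw [Finset.sum_comm]
        exact Finset.sum_le_sum fun i _ => h1 g i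
    _ ≤ ∑ Z ∈ Y.powerset, C₁ * p₀ ^ t * (a ^ Z.card * p ^ Y.card) := by
        rw [prodExp_sum]
        exact Finset.sum_le_sum h2
    _ = C₁ * p₀ ^ t * (∑ Z ∈ Y.powerset, a ^ Z.card) * p ^ Y.card := by
        rw [← Finset.mul_sum, ← Finset.sum_mul]; ring
    _ ≤ _ := by gcongr

open Classical in
/-- Many copies close to a chosen copy force a long chain of partially overlapping copies, which
the codegree conditions make unlikely. -/
theorem many_close_le {E : V → Finset X} {t : ℕ} (ht : 0 < t) (hE : ∀ k, (E k).card = t)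
    {w : ι → ℝ} (hw : ∀ i, 0 ≤ w i)
    {S : ι → Finset V} {C₁ p₀ p η : ℝ} (hC₁ : 1 ≤ C₁) (hp₀ : 0 < p₀) (hp : p₀ ≤ p) (hp1 : p ≤ 1)
    (hη : 0 ≤ η)
    (hS : ∀ A : Finset V, ∑ i, (if A ⊆ S i then w i else 0) ≤ (C₁ * p₀ ^ t) ^ A.card)
    (hcod : ∀ B : Finset X, B.Nonempty →
      ((Finset.univ.filter fun k => B ⊆ E k).card : ℝ) * p₀ ^ t ≤ C₁ * p₀ ^ B.card)
    (hgap : ∀ B : Finset X, B.Nonempty → B.card < t →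
      ((Finset.univ.filter fun k => B ⊆ E k).card : ℝ) * p₀ ^ t ≤ C₁ * η * p₀ ^ B.card)
    {M K : ℕ} (hK : 2 ^ M * C₁ ≤ K) (j : V) (h : ℕ) (Y : Finset X) (hjY : E j ⊆ Y)
    (hY : Y.card + t * h ≤ M) :
    prodExp (coin p) (fun g => ∑ i,
      if j ∈ S i ∧ (∀ x ∈ Y \ E j, g x = true ∨ x ∈ (S i).biUnion E) ∧
        K < (closeCopies E g (S i) j).card then w i else 0) ≤
      C₁ * p₀ ^ t * (1 + 2 ^ M * C₁ ^ 2) ^ M * p ^ (Y \ E j).card *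
        (2 ^ M * (C₁ * η * (p / p₀) ^ t)) ^ h := by
  have hp0 : 0 < p := hp₀.trans_le hp
  have hc0 := coin_nonneg hp0.le hp1
  induction h generalizing Y with
  | zero =>
    rw [pow_zero, mul_one]
    refine le_trans (prodExp_mono hc0 fun g => Finset.sum_le_sum fun i _ => ?_)
      (spread_union_cover_le hw hC₁ hp₀ hp hp1 hS hcod M (Y \ E j)
        ((Finset.card_le_card Finset.sdiff_subset).trans (by omega)) j Finset.sdiff_disjoint)
    by_cases hc : j ∈ S i ∧ (∀ x ∈ Y \ E j, g x = true ∨ x ∈ (S i).biUnion E)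
    · rw [if_pos hc]; split_ifs <;> simp [hw]
    · rw [if_neg hc, if_neg fun h => hc ⟨h.1, h.2.1⟩]
  | succ h ih =>
    set T := Finset.univ.filter fun k => ¬ Disjoint (E k) Y ∧ ¬ E k ⊆ Y with hT
    have hYM : Y.card ≤ M := by omega
    have hsmall : (Finset.univ.filter fun k => E k ⊆ Y).card ≤ K := by
      have := sum_trace_le (E := E) (Z := Y) (T := Finset.univ.filter fun k => E k ⊆ Y)
        (P := fun B => B.card = t) (F := fun _ => 1) (c := C₁)
        (fun k hk => by
          rw [Finset.inter_eq_left.2 (Finset.mem_filter.1 hk).2]; exact hE k)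
        (fun _ => zero_le_one) (by linarith) (fun B hB => by
          have hb := hcod B (Finset.card_pos.1 (hB ▸ ht))
          rw [hB] at hb
          rw [mul_one]
          exact le_of_mul_le_mul_right hb (by positivity))
      rw [Finset.sum_const, nsmul_one] at this
      have h2 : (2 : ℝ) ^ Y.card * C₁ ≤ 2 ^ M * C₁ :=
        mul_le_mul_of_nonneg_right (pow_le_pow_right₀ (by norm_num) hYM) (by linarith)
      exact_mod_cast this.trans (h2.trans hK)
    have hpt : ∀ g i, (if j ∈ S i ∧ (∀ x ∈ Y \ E j, g x = true ∨ x ∈ (S i).biUnion E) ∧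
        K < (closeCopies E g (S i) j).card then w i else 0) ≤
        ∑ k ∈ T, if j ∈ S i ∧ (∀ x ∈ (Y ∪ E k) \ E j, g x = true ∨ x ∈ (S i).biUnion E) ∧
        K < (closeCopies E g (S i) j).card then w i else 0 := by
      intro g i
      have hnn : ∀ k, 0 ≤ if j ∈ S i ∧
          (∀ x ∈ (Y ∪ E k) \ E j, g x = true ∨ x ∈ (S i).biUnion E) ∧
          K < (closeCopies E g (S i) j).card then w i else 0 := by
        intro k; split_ifs <;> simp [hw]
      split_ifs with hc
      · obtain ⟨hj, hx, hlt⟩ := hc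
        obtain ⟨k, hk, hkY⟩ : ∃ k ∈ closeCopies E g (S i) j, ¬ E k ⊆ Y := by
          by_contra! hcon
          have : closeCopies E g (S i) j ⊆ Finset.univ.filter fun k => E k ⊆ Y :=
            fun k hk => Finset.mem_filter.2 ⟨Finset.mem_univ _, hcon k hk⟩
          exact absurd (hlt.trans_le (Finset.card_le_card this)) (not_lt.2 hsmall)
        simp only [closeCopies, Finset.mem_filter, Finset.mem_univ, true_and] at hk
        have hkT : k ∈ T := Finset.mem_filter.2 ⟨Finset.mem_univ _,
          fun hd => hk.2.2 (hd.mono_right hjY), hkY⟩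
        refine le_trans (le_of_eq ?_) (Finset.single_le_sum (f := fun k => if j ∈ S i ∧
          (∀ x ∈ (Y ∪ E k) \ E j, g x = true ∨ x ∈ (S i).biUnion E) ∧
          K < (closeCopies E g (S i) j).card then w i else 0) (fun k _ => hnn k) hkT)
        rw [if_pos]
        refine ⟨hj, fun x hx' => ?_, hlt⟩
        rw [Finset.mem_sdiff, Finset.mem_union] at hx'
        rcases hx'.1 with h1 | h1
        · exact hx x (Finset.mem_sdiff.2 ⟨h1, hx'.2⟩)
        · exact hk.2.1 x h1
      · exact Finset.sum_nonneg fun k _ => hnn k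
    set D := C₁ * p₀ ^ t * (1 + 2 ^ M * C₁ ^ 2) ^ M
    set θ := 2 ^ M * (C₁ * η * (p / p₀) ^ t)
    have hθ : 0 ≤ θ := by positivity
    have hD : 0 ≤ D := by positivity
    have hk : ∀ k ∈ T, prodExp (coin p) (fun g => ∑ i,
        if j ∈ S i ∧ (∀ x ∈ (Y ∪ E k) \ E j, g x = true ∨ x ∈ (S i).biUnion E) ∧
        K < (closeCopies E g (S i) j).card then w i else 0) ≤
        D * p ^ (Y \ E j).card * θ ^ h * p ^ (t - (E k ∩ Y).card) := by
      intro k _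
      have hcard : (E k \ Y).card = t - (E k ∩ Y).card := by
        rw [Finset.card_sdiff, hE, Finset.inter_comm]
      have h1 := ih (Y ∪ E k) (hjY.trans Finset.subset_union_left) (by
        have := Finset.card_union_le Y (E k)
        rw [hE] at this
        rw [mul_add, mul_one] at hY
        omega)
      refine h1.trans_eq ?_
      have h2 : ((Y ∪ E k) \ E j).card = (Y \ E j).card + (t - (E k ∩ Y).card) := by
        rw [← hcard, ← Finset.card_union_of_disjoint]
        · congr 1
          ext x
          simp only [Finset.mem_sdiff, Finset.mem_union]
          have := @hjY x
          tauto
        · exact Finset.disjoint_sdiff.mono_left Finset.sdiff_subset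
      rw [h2, pow_add]
      ring
    have hsum := sum_trace_le (E := E) (Z := Y) (T := T)
      (P := fun B => B.Nonempty ∧ B.card < t) (F := fun B => p ^ (t - B.card))
      (c := C₁ * η * (p / p₀) ^ t)
      (fun k hk => by
        rw [hT, Finset.mem_filter] at hk
        refine ⟨Finset.not_disjoint_iff_nonempty_inter.1 hk.2.1, ?_⟩
        rw [← hE k]
        refine Finset.card_lt_card (Finset.ssubset_iff_subset_ne.2
          ⟨Finset.inter_subset_left, fun h => hk.2.2 (Finset.inter_eq_left.1 h)⟩))
      (fun B => by positivity) (by positivity) (by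
        rintro B ⟨hB, hBt⟩
        have h1 := hgap B hB hBt
        rw [← le_div_iff₀ (by positivity)] at h1
        refine (mul_le_mul_of_nonneg_right h1 (by positivity)).trans ?_
        have h2 : (p / p₀) ^ t = p ^ (t - B.card) * p ^ B.card / p₀ ^ t := by
          rw [← pow_add, Nat.sub_add_cancel hBt.le, div_pow]
        rw [h2]
        calc C₁ * η * p₀ ^ B.card / p₀ ^ t * p ^ (t - B.card)
            = C₁ * η * p ^ (t - B.card) / p₀ ^ t * p₀ ^ B.card := by ring
          _ ≤ C₁ * η * p ^ (t - B.card) / p₀ ^ t * p ^ B.card := by gcongr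
          _ = _ := by ring)
    calc _ ≤ prodExp (coin p) (fun g => ∑ k ∈ T, ∑ i,
          if j ∈ S i ∧ (∀ x ∈ (Y ∪ E k) \ E j, g x = true ∨ x ∈ (S i).biUnion E) ∧
          K < (closeCopies E g (S i) j).card then w i else 0) := by
          refine prodExp_mono hc0 fun g => ?_
          rw [Finset.sum_comm]
          exact Finset.sum_le_sum fun i _ => hpt g i
      _ ≤ ∑ k ∈ T, D * p ^ (Y \ E j).card * θ ^ h * p ^ (t - (E k ∩ Y).card) := by
          rw [prodExp_sum]
          exact Finset.sum_le_sum hk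
      _ ≤ D * p ^ (Y \ E j).card * θ ^ h * (2 ^ M * (C₁ * η * (p / p₀) ^ t)) := by
          rw [← Finset.mul_sum]
          refine mul_le_mul_of_nonneg_left (hsum.trans ?_) (by positivity)
          refine mul_le_mul_of_nonneg_right (pow_le_pow_right₀ (by norm_num) hYM) (by positivity)
      _ = _ := by rw [pow_succ]; ring

open Classical in
theorem prodExp_not_typical_le {E : V → Finset X} {t : ℕ} (ht : 0 < t)
    (hE : ∀ k, (E k).card = t) {w : ι → ℝ} (hw : ∀ i, 0 ≤ w i)
    {S : ι → Finset V} {C₁ p₀ p η : ℝ} (hC₁ : 1 ≤ C₁) (hp₀ : 0 < p₀) (hp : p₀ ≤ p) (hp1 : p ≤ 1)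
    (hη : 0 ≤ η)
    (hS : ∀ A : Finset V, ∑ i, (if A ⊆ S i then w i else 0) ≤ (C₁ * p₀ ^ t) ^ A.card)
    (hcod : ∀ B : Finset X, B.Nonempty →
      ((Finset.univ.filter fun k => B ⊆ E k).card : ℝ) * p₀ ^ t ≤ C₁ * p₀ ^ B.card)
    (hgap : ∀ B : Finset X, B.Nonempty → B.card < t →
      ((Finset.univ.filter fun k => B ⊆ E k).card : ℝ) * p₀ ^ t ≤ C₁ * η * p₀ ^ B.card)
    (h : ℕ) {M K : ℕ} (hM : t * (h + 1) ≤ M) (hK : 2 ^ M * C₁ ≤ K) :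
    prodExp (coin p) (fun g => ∑ i, if IsTypical E K g (S i) then 0 else w i) ≤
      Fintype.card V * (C₁ * p₀ ^ t * (1 + 2 ^ M * C₁ ^ 2) ^ M *
        (2 ^ M * (C₁ * η * (p / p₀) ^ t)) ^ h) := by
  have hc0 := coin_nonneg (hp₀.le.trans hp) hp1
  calc _ ≤ prodExp (coin p) (fun g => ∑ j, ∑ i,
        if j ∈ S i ∧ (∀ x ∈ E j \ E j, g x = true ∨ x ∈ (S i).biUnion E) ∧
        K < (closeCopies E g (S i) j).card then w i else 0) := by
        refine prodExp_mono hc0 fun g => ?_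
        rw [Finset.sum_comm]
        refine Finset.sum_le_sum fun i _ => ?_
        have hnn : ∀ j, 0 ≤ if j ∈ S i ∧
            (∀ x ∈ E j \ E j, g x = true ∨ x ∈ (S i).biUnion E) ∧
            K < (closeCopies E g (S i) j).card then w i else 0 := by
          intro j; split_ifs <;> simp [hw]
        split_ifs with htyp
        · exact Finset.sum_nonneg fun j _ => hnn j
        · simp only [IsTypical, not_forall, not_le] at htyp
          obtain ⟨j, hj, hlt⟩ := htyp
          refine le_trans (le_of_eq ?_) (Finset.single_le_sum (f := fun j => if j ∈ S i ∧
            (∀ x ∈ E j \ E j, g x = true ∨ x ∈ (S i).biUnion E) ∧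
            K < (closeCopies E g (S i) j).card then w i else 0) (fun j _ => hnn j)
            (Finset.mem_univ j))
          rw [if_pos ⟨hj, by simp, hlt⟩]
    _ ≤ ∑ _j : V, C₁ * p₀ ^ t * (1 + 2 ^ M * C₁ ^ 2) ^ M *
        (2 ^ M * (C₁ * η * (p / p₀) ^ t)) ^ h := by
        rw [prodExp_sum]
        refine Finset.sum_le_sum fun j _ => ?_
        have := many_close_le ht hE hw hC₁ hp₀ hp hp1 hη hS hcod hgap hK j h (E j) subset_rfl
          (by rw [hE]; linarith)
        simpa using this
    _ = _ := by rw [Finset.sum_const, Finset.card_univ, nsmul_eq_mul]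

end Typicality

section RandomCover

theorem sum_choose_mul_pow_upper_half_le (k : ℕ) {x : ℝ} (hx : 0 ≤ x) (hx1 : x ≤ 1 / 16) :
    ∑ u ∈ Finset.Ioc (k / 2) k, (k.choose u : ℝ) * x ^ u ≤ (1 / 2) ^ k := by
  have h1 : ∀ u ∈ Finset.Ioc (k / 2) k, (k.choose u : ℝ) * x ^ u ≤ k.choose u * (1 / 4) ^ k := by
    intro u hu
    rw [Finset.mem_Ioc] at hu
    refine mul_le_mul_of_nonneg_left ?_ (Nat.cast_nonneg _)
    calc x ^ u ≤ (1 / 16) ^ u := pow_le_pow_left₀ hx hx1 _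
      _ = (1 / 4) ^ (2 * u) := by rw [pow_mul]; norm_num
      _ ≤ (1 / 4) ^ k := pow_le_pow_of_le_one (by norm_num) (by norm_num) (by omega)
  refine (Finset.sum_le_sum h1).trans ?_
  rw [← Finset.sum_mul]
  have h2 : ∑ u ∈ Finset.Ioc (k / 2) k, (k.choose u : ℝ) ≤ 2 ^ k := by
    have : ∑ u ∈ Finset.Ioc (k / 2) k, k.choose u ≤ 2 ^ k := by
      rw [← Nat.sum_range_choose]
      refine Finset.sum_le_sum_of_subset fun u hu => ?_
      rw [Finset.mem_Ioc] at hu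
      exact Finset.mem_range.2 (by omega)
    exact_mod_cast this
  calc _ ≤ (2 : ℝ) ^ k * (1 / 4) ^ k := mul_le_mul_of_nonneg_right h2 (by positivity)
    _ = _ := by rw [← mul_pow]; norm_num

theorem sum_choose_mul_pow_le (k : ℕ) {x : ℝ} (hx : 0 ≤ x) (hx1 : k * x ≤ 1) :
    ∑ u ∈ Finset.Ioc 0 k, (k.choose u : ℝ) * x ^ u ≤ 2 * (k * x) := by
  have h1 : ∑ u ∈ Finset.Ioc 0 k, (k.choose u : ℝ) * x ^ u = (1 + x) ^ k - 1 := by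
    rw [add_comm, add_pow, Finset.sum_range_succ']
    simp only [one_pow, mul_one, pow_zero, Nat.choose_zero_right, Nat.cast_one, add_sub_cancel_right]
    rw [← Finset.sum_image (f := fun u => x ^ u * (k.choose u : ℝ)) (g := fun u => u + 1)
      (s := Finset.range k) (fun a _ b _ h => by simpa using h)]
    · refine Finset.sum_congr ?_ fun _ _ => mul_comm _ _
      ext u
      simp only [Finset.mem_Ioc, Finset.mem_image, Finset.mem_range]
      constructor
      · intro h; exact ⟨u - 1, by omega, by omega⟩
      · rintro ⟨v, hv, rfl⟩; omega
  rw [h1]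
  have h2 : (1 + x) ^ k ≤ Real.exp (k * x) := by
    rw [Real.exp_nat_mul]
    exact pow_le_pow_left₀ (by linarith) (by linarith [Real.add_one_le_exp x]) _
  have h0 : 0 ≤ k * x := by positivity
  have h3 := Real.abs_exp_sub_one_le (x := k * x) (by rwa [abs_of_nonneg h0])
  rw [abs_of_nonneg h0] at h3
  linarith [le_abs_self (Real.exp (k * x) - 1)]

theorem prodExp_coin_mono {X : Type*} [Fintype X] [DecidableEq X] {p₁ p : ℝ} (h0 : 0 < p₁)
    (h1 : p₁ ≤ p) (hp : p ≤ 1) {φ : (X → Bool) → ℝ}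
    (hφ : ∀ f g : X → Bool, (∀ x, f x = true → g x = true) → φ f ≤ φ g) :
    prodExp (coin p₁) φ ≤ prodExp (coin p) φ := by
  have hp0 : 0 < p := h0.trans_le h1
  set ν : Bool × Bool → ℝ := fun a => coin p a.1 * coin (p₁ / p) a.2
  have hν : ∀ a, 0 ≤ ν a := fun a => mul_nonneg (coin_nonneg hp0.le hp _)
    (coin_nonneg (by positivity) ((div_le_one hp0).2 h1) _)
  have e1 : coin p₁ = fun b => ∑ a with (a.1 && a.2) = b, ν a := by
    funext b
    rw [Finset.sum_filter, Fintype.sum_prod_type]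
    cases b <;> simp [ν, coin] <;> field_simp <;> ring
  have e2 : coin p = fun b => ∑ a with a.1 = b, ν a := by
    funext b
    rw [Finset.sum_filter, Fintype.sum_prod_type]
    cases b <;> simp [ν, coin] <;> field_simp <;> ring
  have c1 : prodExp (coin p₁) φ = prodExp ν fun f => φ fun x => (f x).1 && (f x).2 := by
    rw [prodExp_comp ν fun a => a.1 && a.2, e1]
    congr!
  have c2 : prodExp (coin p) φ = prodExp ν fun f => φ fun x => (f x).1 := by
    rw [prodExp_comp ν fun a => a.1, e2]
    congr!
  rw [c1, c2]
  refine prodExp_mono hν fun f => hφ _ _ fun x hx => ?_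
  simp only [Bool.and_eq_true] at hx
  exact hx.1

variable {X V ι : Type*} [Fintype X] [DecidableEq X] [DecidableEq V] [Fintype V] [Fintype ι]

open Classical in
/-- The fragmentation bound with halving fragment sizes. -/
theorem halving_fragmentation_bound
    {p : ℝ} (hp : 0 < p) (hp1 : p ≤ 1) {E : V → Finset X} {t : ℕ} (hE : ∀ k, (E k).card ≤ t)
    {K : ℕ} {w : ι → ℝ} (hw : ∀ i, 0 ≤ w i) (hw1 : ∑ i, w i = 1) {S : ι → Finset V} {κ : ℝ}
    (hκ : 0 ≤ κ) (hS : ∀ A : Finset V, ∑ i, (if A ⊆ S i then w i else 0) ≤ κ ^ A.card)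
    {N q L : ℕ} (hN : ∀ i, (S i).card ≤ N) (hq : 1 ≤ q) (hqN : q ≤ N)
    (hL : L = Nat.log 2 (N / q)) (hx : κ * (4 * (L + 1) * 2 ^ K * (p ^ t)⁻¹) ≤ 1 / 16)
    (hx1 : 2 * q * (κ * (4 * 2 ^ K * (p ^ t)⁻¹)) ≤ 1) :
    prodExp (coin p) (fun g => if ∃ i, S i ⊆ presentCopies E g then (0 : ℝ) else 1) ≤
      prodExp (coin p) (fun g => ∑ i, if IsTypical E K g (S i) then 0 else w i) +
      (L * (1 / 2) ^ q + 4 * q * (κ * (4 * 2 ^ K * (p ^ t)⁻¹))) := by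
  set kp : ℕ → ℕ := fun ℓ => if ℓ ≤ L then N / 2 ^ ℓ else 0 with hkp
  set ν : Fin (L + 2) → ℝ := Fin.snoc (α := fun _ => ℝ)
    (Fin.snoc (α := fun _ => ℝ) (fun _ : Fin L => 1 / (4 * (L + 1) : ℝ)) (1 / 4))
    (3 / 4 - L / (4 * (L + 1))) with hνdef
  have hLe : (L : ℝ) / (4 * (L + 1)) ≤ 1 / 4 := by
    rw [div_le_div_iff₀ (by positivity) (by norm_num)]; nlinarith
  have hν : ∑ a, ν a = 1 := by
    rw [Fin.sum_univ_castSucc, Fin.sum_univ_castSucc]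
    simp only [hνdef, Fin.snoc_castSucc, Fin.snoc_last, Finset.sum_const, Finset.card_univ,
      Fintype.card_fin, nsmul_eq_mul]
    ring
  have hν0 : ∀ a, 0 < ν a := by
    intro a
    refine Fin.lastCases ?_ (fun b => ?_) a
    · simp only [hνdef, Fin.snoc_last]; linarith
    · refine Fin.lastCases ?_ (fun c => ?_) b
      · simp only [hνdef, Fin.snoc_castSucc, Fin.snoc_last]; norm_num
      · simp only [hνdef, Fin.snoc_castSucc]; positivity
  have hlast : 1 / 2 ≤ ν (Fin.last (L + 1)) := by
    simp only [hνdef, Fin.snoc_last]; linarith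
  have hq0 : N / q ≠ 0 := by
    rw [Nat.div_ne_zero_iff]; omega
  have hlow : 2 ^ L ≤ N / q := hL ▸ Nat.pow_log_le_self 2 hq0
  have hup : N / q < 2 ^ (L + 1) := hL ▸ Nat.lt_pow_succ_log_self (by norm_num) _
  have hmul : q * 2 ^ L ≤ N := by
    rw [mul_comm]; exact (Nat.le_div_iff_mul_le (by omega)).1 hlow
  refine (fragmentation_bound (K := K) hν hν0 hlast hp hp1 hE hw hw1 hκ hS (kp := kp)
    (by simpa [hkp] using hN) (by simp [hkp])).trans ?_
  refine add_le_add le_rfl ?_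
  rw [Fin.sum_univ_castSucc]
  refine add_le_add ?_ ?_
  · calc _ ≤ ∑ _ℓ : Fin L, (1 / 2 : ℝ) ^ q := ?_
      _ = _ := by simp
    refine Finset.sum_le_sum fun ℓ _ => ?_
    have hℓ := ℓ.2
    have hνℓ : ν (ℓ.castSucc.castSucc) = 1 / (4 * (L + 1) : ℝ) := by
      simp only [hνdef, Fin.snoc_castSucc]
    have e1 : kp ((ℓ.castSucc : Fin (L + 1)) : ℕ) = N / 2 ^ (ℓ : ℕ) := by
      simp only [hkp, Fin.val_castSucc]
      rw [if_pos hℓ.le]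
    have e2 : kp (((ℓ.castSucc : Fin (L + 1)) : ℕ) + 1) = N / 2 ^ (ℓ : ℕ) / 2 := by
      simp only [hkp, Fin.val_castSucc]
      rw [if_pos (by omega), pow_succ, Nat.div_div_eq_div_mul]
    rw [e1, e2, hνℓ]
    have hqk : q ≤ N / 2 ^ (ℓ : ℕ) := by
      rw [Nat.le_div_iff_mul_le (by positivity)]
      exact (Nat.mul_le_mul_left _ (Nat.pow_le_pow_right (by norm_num) hℓ.le)).trans hmul
    refine (sum_choose_mul_pow_upper_half_le _ (by positivity) ?_).trans
      (pow_le_pow_of_le_one (by norm_num) (by norm_num) hqk)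
    rw [one_div, inv_inv]
    exact hx
  · have hνL : ν ((Fin.last L).castSucc) = 1 / 4 := by
      simp only [hνdef, Fin.snoc_castSucc, Fin.snoc_last]
    have e1 : kp ((Fin.last L : Fin (L + 1)) : ℕ) = N / 2 ^ L := by
      simp [hkp]
    have e2 : kp (((Fin.last L : Fin (L + 1)) : ℕ) + 1) = 0 := by
      simp [hkp]
    rw [e1, e2, hνL, one_div, inv_inv]
    set x := κ * (4 * 2 ^ K * (p ^ t)⁻¹)
    have hx0 : 0 ≤ x := by positivity
    have hk : N / 2 ^ L ≤ 2 * q := by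
      rw [Nat.div_lt_iff_lt_mul (by omega), pow_succ] at hup
      exact Nat.div_le_of_le_mul (by nlinarith)
    have hk' : ((N / 2 ^ L : ℕ) : ℝ) * x ≤ 2 * q * x :=
      mul_le_mul_of_nonneg_right (by exact_mod_cast hk) hx0
    exact (sum_choose_mul_pow_le _ hx0 (hk'.trans hx1)).trans (by linarith)


open Filter Topology in
theorem eventually_log_bounds (t : ℕ) (A : ℝ) (c₀ : ℕ) {ε : ℝ} (hε : 0 < ε) :
    ∃ n₀ : ℕ, ∀ n : ℕ, n₀ ≤ n → 1 ≤ Real.log n ∧ c₀ ≤ n ∧ A * Real.log n ^ (2 * t) / n ≤ ε / 3 ∧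
      ∃ q : ℕ, 1 ≤ q ∧ q ≤ n ∧ 4 * Real.log n * (1 / 2) ^ q ≤ ε / 3 ∧ 4 * q / Real.log n ≤ ε / 3 ∧
        2 * q ≤ Real.log n := by
  have hlog : Tendsto (fun n : ℕ => Real.log n) atTop atTop :=
    Real.tendsto_log_atTop.comp tendsto_natCast_atTop_atTop
  have hr : Tendsto (fun n : ℕ => ⌊Real.log n⌋₊.sqrt) atTop atTop := by
    refine tendsto_atTop_atTop.2 fun b => ?_
    obtain ⟨n₀, hn₀⟩ := eventually_atTop.1 (hlog.eventually_ge_atTop ((b * b : ℕ) : ℝ))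
    exact ⟨n₀, fun n hn => Nat.le_sqrt.2 (Nat.le_floor (hn₀ n hn))⟩
  have hq : Tendsto (fun n : ℕ => ⌊Real.log n⌋₊.sqrt + 1) atTop atTop :=
    tendsto_atTop_mono (fun n => Nat.le_succ _) hr
  have e1 := hlog.eventually_ge_atTop 1
  have e3 : ∀ᶠ n : ℕ in atTop, A * Real.log n ^ (2 * t) / n ≤ ε / 3 := by
    have h0 : Tendsto (fun x : ℝ => Real.log x ^ (2 * t) / x) atTop (𝓝 0) :=
      (Real.isLittleO_pow_log_id_atTop (n := 2 * t)).tendsto_div_nhds_zero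
    have h1 : Tendsto (fun n : ℕ => A * (Real.log n ^ (2 * t) / n)) atTop (𝓝 (A * 0)) :=
      (h0.comp tendsto_natCast_atTop_atTop).const_mul A
    rw [mul_zero] at h1
    filter_upwards [h1.eventually_le_const (show (0 : ℝ) < ε / 3 by positivity)] with n hn
    rwa [mul_div_assoc]
  have e4 : ∀ᶠ n : ℕ in atTop, 4 * ((⌊Real.log n⌋₊.sqrt + 1 : ℕ) : ℝ) ^ 2 *
      (1 / 2) ^ (⌊Real.log n⌋₊.sqrt + 1) ≤ ε / 3 := by
    have h0 := (tendsto_pow_const_mul_const_pow_of_abs_lt_one 2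
      (show |(1 / 2 : ℝ)| < 1 by norm_num [abs_of_pos])).const_mul 4
    rw [mul_zero] at h0
    filter_upwards [(h0.comp hq).eventually_le_const (show (0 : ℝ) < ε / 3 by positivity)] with n hn
    simpa [mul_assoc] using hn
  have e5 := hq.eventually_ge_atTop 8
  have e6 := (tendsto_natCast_atTop_atTop (R := ℝ).comp hq).eventually_ge_atTop (48 / ε)
  obtain ⟨n₀, h⟩ := eventually_atTop.1 (((e1.and (eventually_ge_atTop c₀)).and e3).and
    ((e4.and e5).and e6))
  refine ⟨n₀, fun n hn => ?_⟩
  obtain ⟨⟨⟨h1, h2⟩, h3⟩, ⟨h4, h5⟩, h6⟩ := h n hn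
  refine ⟨h1, h2, h3, ⌊Real.log n⌋₊.sqrt + 1, by omega, ?_⟩
  set y := Real.log n
  set q := ⌊y⌋₊.sqrt + 1 with hqdef
  have hy0 : 0 < y := by linarith
  have hyq : y ≤ (q : ℝ) ^ 2 := by
    have := Nat.lt_succ_sqrt ⌊y⌋₊
    have h7 : ⌊y⌋₊ + 1 ≤ q * q := this
    have h8 := Nat.lt_floor_add_one y
    have h9 : ((⌊y⌋₊ + 1 : ℕ) : ℝ) ≤ ((q * q : ℕ) : ℝ) := Nat.cast_le.2 h7
    push_cast at h9
    nlinarith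
  have hqy : ((q : ℝ) - 1) ^ 2 ≤ y := by
    have h7 := Nat.sqrt_le ⌊y⌋₊
    have h8 := Nat.floor_le hy0.le
    have h9 : ((⌊y⌋₊.sqrt * ⌊y⌋₊.sqrt : ℕ) : ℝ) ≤ (⌊y⌋₊ : ℝ) := Nat.cast_le.2 h7
    have h10 : (q : ℝ) - 1 = (⌊y⌋₊.sqrt : ℝ) := by rw [hqdef]; push_cast; ring
    rw [h10, sq]
    push_cast at h9
    linarith
  have hq8 : (8 : ℝ) ≤ q := by exact_mod_cast h5
  have hqy' : (q : ℝ) ^ 2 / 4 ≤ y := by nlinarith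
  refine ⟨?_, ?_, ?_, ?_⟩
  · have hn0 : (0 : ℝ) < n := by
      rcases Nat.eq_zero_or_pos n with rfl | hn0
      · simp [y] at hy0
      · exact_mod_cast hn0
    have := Real.log_le_sub_one_of_pos hn0
    have h7 : (q : ℝ) ≤ n := by nlinarith
    exact_mod_cast h7
  · refine le_trans ?_ h4
    gcongr
  · have h6' : 48 / ε ≤ (q : ℝ) := h6
    rw [div_le_iff₀ hε] at h6'
    rw [div_le_iff₀ hy0]
    nlinarith
  · nlinarith

open Classical in
/-- A spread measure on families of copies with small codegrees yields, with high probability,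
a family of the support all of whose copies are present. -/
theorem random_cover {t : ℕ} (ht : 0 < t) {C₁ : ℝ} (hC₁ : 1 ≤ C₁) :
    ∃ C : ℝ, 0 < C ∧ ∀ ε : ℝ, 0 < ε → ∃ n₀ : ℕ, ∀ n : ℕ, n₀ ≤ n →
      ∀ (X V ι : Type) [Fintype X] [DecidableEq X] [DecidableEq V] [Fintype V] [Fintype ι]
        (E : V → Finset X) (w : ι → ℝ) (S : ι → Finset V) (p₀ p : ℝ),
        (∀ k, (E k).card = t) → (∀ i, 0 ≤ w i) → ∑ i, w i = 1 → 0 < p₀ →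
        (∀ A : Finset V, ∑ i, (if A ⊆ S i then w i else 0) ≤ (C₁ * p₀ ^ t) ^ A.card) →
        (∀ i, ((S i).card : ℝ) ≤ C₁ * n) →
        (∀ B : Finset X, B.Nonempty →
          ((Finset.univ.filter fun k => B ⊆ E k).card : ℝ) * p₀ ^ t ≤ C₁ * p₀ ^ B.card) →
        (∀ B : Finset X, B.Nonempty → B.card < t →
          ((Finset.univ.filter fun k => B ⊆ E k).card : ℝ) * p₀ ^ t ≤
            C₁ * (n : ℝ) ^ (-(1 / t : ℝ)) * p₀ ^ B.card) →
        Fintype.card V * p₀ ^ t ≤ C₁ * n →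
        C * p₀ * Real.log n ^ (1 / t : ℝ) ≤ p → p ≤ 1 →
        1 - ε ≤ prodExp (coin p) fun g => if ∃ i, S i ⊆ presentCopies E g then 1 else 0 := by
  set M := t * (2 * t + 1) with hM
  set K := ⌈2 ^ M * C₁⌉₊
  have hK : 2 ^ M * C₁ ≤ K := Nat.le_ceil _
  set C : ℝ := 256 * C₁ * 2 ^ K with hC
  have h2K : (1 : ℝ) ≤ 2 ^ K := one_le_pow₀ (by norm_num)
  have hC1 : 1 ≤ C := by nlinarith
  have hC0 : 0 < C := by linarith
  set a : ℝ := 2 ^ M * C₁ ^ 2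
  set A : ℝ := C₁ ^ 2 * (1 + a) ^ M * (2 ^ M * C₁ * C ^ t) ^ (2 * t) with hA
  set c₀ := ⌈C₁⌉₊
  refine ⟨C, hC0, fun ε hε => ?_⟩
  obtain ⟨n₀, hn₀⟩ := eventually_log_bounds t A c₀ hε
  refine ⟨n₀, fun n hn X V ι _ _ _ _ _ E w S p₀ p hE hw hw1 hp₀ hS hSc hcod hgap hV hp hp1 => ?_⟩
  obtain ⟨hy1, hcn, hAε, q, hq1, hqn, hqε, hqε', hqy⟩ := hn₀ n hn
  set y := Real.log n with hy
  have hy0 : 0 < y := by linarith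
  have hn0 : 0 < n := by omega
  have hn0' : (0 : ℝ) < n := by exact_mod_cast hn0
  have ht0 : (t : ℝ) ≠ 0 := by exact_mod_cast ht.ne'
  set p₁ := C * p₀ * y ^ (1 / t : ℝ) with hp₁
  have hyt : 1 ≤ y ^ (1 / t : ℝ) := Real.one_le_rpow hy1 (by positivity)
  have hp₁0 : 0 < p₁ := by positivity
  have hp₀₁ : p₀ ≤ p₁ := by
    calc p₀ = 1 * p₀ * 1 := by ring
      _ ≤ C * p₀ * y ^ (1 / t : ℝ) := by gcongr
  have hp₁1 : p₁ ≤ 1 := hp.trans hp1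
  have hyp : (y ^ (1 / t : ℝ)) ^ t = y := by
    rw [← Real.rpow_natCast, ← Real.rpow_mul hy0.le, one_div, inv_mul_cancel₀ ht0, Real.rpow_one]
  have hpt : p₁ ^ t = C ^ t * p₀ ^ t * y := by rw [hp₁, mul_pow, mul_pow, hyp]
  have hCt : C ≤ C ^ t := le_self_pow₀ hC1 ht.ne'
  have hκ : C₁ * p₀ ^ t * (p₁ ^ t)⁻¹ ≤ C₁ / (C * y) := by
    rw [hpt, ← div_eq_mul_inv, div_le_div_iff₀ (by positivity) (by positivity)]
    calc C₁ * p₀ ^ t * (C * y) ≤ C₁ * p₀ ^ t * (C ^ t * y) := by gcongr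
      _ = _ := by ring
  have hκ2 : C₁ * p₀ ^ t * (p₁ ^ t)⁻¹ * 2 ^ K ≤ 1 / (256 * y) := by
    calc _ ≤ C₁ / (C * y) * 2 ^ K := by gcongr
      _ = _ := by rw [hC]; field_simp
  have hκ0 : 0 ≤ C₁ * p₀ ^ t * (p₁ ^ t)⁻¹ * 2 ^ K := by positivity
  set N := c₀ * n
  have hc₁ : C₁ ≤ c₀ := Nat.le_ceil _
  have hc₀ : 1 ≤ c₀ := by
    have : (1 : ℝ) ≤ c₀ := hC₁.trans hc₁
    exact_mod_cast this
  have hN : ∀ i, (S i).card ≤ N := by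
    intro i
    have : ((S i).card : ℝ) ≤ (N : ℕ) := (hSc i).trans (by push_cast [N]; gcongr)
    exact_mod_cast this
  have hqN : q ≤ N := hqn.trans (Nat.le_mul_of_pos_left _ hc₀)
  have hL : (Nat.log 2 (N / q) : ℝ) + 1 ≤ 4 * y := by
    have h1 : 2 ^ Nat.log 2 (N / q) ≤ n * n :=
      (Nat.pow_log_le_self 2 (by rw [Nat.div_ne_zero_iff]; omega)).trans
        ((Nat.div_le_self _ _).trans (Nat.mul_le_mul_right _ hcn))
    have h2 : (2 : ℝ) ^ Nat.log 2 (N / q) ≤ n * n := by exact_mod_cast h1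
    have h3 := Real.log_le_log (by positivity) h2
    rw [Real.log_pow, Real.log_mul hn0'.ne' hn0'.ne', ← hy] at h3
    have h4 := Real.log_two_gt_d9
    have h5 : (0 : ℝ) ≤ Nat.log 2 (N / q) := Nat.cast_nonneg _
    nlinarith
  have hbound := halving_fragmentation_bound (K := K) hp₁0 hp₁1 (fun k => (hE k).le) hw hw1
    (by positivity) hS hN hq1 hqN rfl (by
      calc _ = 4 * ((Nat.log 2 (N / q) : ℝ) + 1) * (C₁ * p₀ ^ t * (p₁ ^ t)⁻¹ * 2 ^ K) := by ring
        _ ≤ 4 * (4 * y) * (1 / (256 * y)) := by gcongr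
        _ = 1 / 16 := by field_simp; norm_num) (by
      calc _ = 4 * (2 * q) * (C₁ * p₀ ^ t * (p₁ ^ t)⁻¹ * 2 ^ K) := by ring
        _ ≤ 4 * y * (1 / (256 * y)) := by gcongr
        _ ≤ 1 := by field_simp; norm_num)
  have htyp := prodExp_not_typical_le ht hE hw hC₁ hp₀ hp₀₁ hp₁1 (by positivity) hS hcod hgap
    (2 * t) (M := M) (K := K) hM.ge hK
  have hθ : (2 ^ M * (C₁ * (n : ℝ) ^ (-(1 / t : ℝ)) * (p₁ / p₀) ^ t)) ^ (2 * t) =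
      (2 ^ M * C₁ * C ^ t) ^ (2 * t) * y ^ (2 * t) / (n : ℝ) ^ 2 := by
    have h1 : (p₁ / p₀) ^ t = C ^ t * y := by
      rw [div_pow, hpt]; field_simp
    have h2 : ((n : ℝ) ^ (-(1 / t : ℝ))) ^ (2 * t) = ((n : ℝ) ^ 2)⁻¹ := by
      rw [← Real.rpow_natCast, ← Real.rpow_mul hn0'.le]
      have : -(1 / t : ℝ) * ((2 * t : ℕ) : ℝ) = -((2 : ℕ) : ℝ) := by
        push_cast; field_simp
      rw [this, Real.rpow_neg hn0'.le, Real.rpow_natCast]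
    calc _ = (2 ^ M * C₁ * C ^ t) ^ (2 * t) * y ^ (2 * t) *
          ((n : ℝ) ^ (-(1 / t : ℝ))) ^ (2 * t) := by rw [h1, ← mul_pow, ← mul_pow]; ring
      _ = _ := by rw [h2, div_eq_mul_inv]
  have htyp' : Fintype.card V * (C₁ * p₀ ^ t * (1 + a) ^ M *
        (2 ^ M * (C₁ * (n : ℝ) ^ (-(1 / t : ℝ)) * (p₁ / p₀) ^ t)) ^ (2 * t)) ≤
      A * y ^ (2 * t) / n := by
    rw [hθ]
    calc _ = (Fintype.card V * p₀ ^ t) * (C₁ * (1 + a) ^ M *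
          ((2 ^ M * C₁ * C ^ t) ^ (2 * t) * y ^ (2 * t) / (n : ℝ) ^ 2)) := by ring
      _ ≤ (C₁ * n) * (C₁ * (1 + a) ^ M *
          ((2 ^ M * C₁ * C ^ t) ^ (2 * t) * y ^ (2 * t) / (n : ℝ) ^ 2)) := by gcongr
      _ = _ := by rw [hA]; field_simp
  have hr1 : (Nat.log 2 (N / q) : ℝ) * (1 / 2) ^ q ≤ ε / 3 := by
    refine le_trans ?_ hqε
    gcongr
    linarith
  have hr2 : 4 * q * (C₁ * p₀ ^ t * (4 * 2 ^ K * (p₁ ^ t)⁻¹)) ≤ ε / 3 := by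
    refine le_trans ?_ hqε'
    calc _ = 4 * q * (4 * (C₁ * p₀ ^ t * (p₁ ^ t)⁻¹ * 2 ^ K)) := by ring
      _ ≤ 4 * q * (4 * (1 / (256 * y))) := by gcongr
      _ = 4 * q / y * (1 / 64) := by field_simp; norm_num
      _ ≤ 4 * q / y := mul_le_of_le_one_right (by positivity) (by norm_num)
  have hfail : prodExp (coin p₁)
      (fun g => if ∃ i, S i ⊆ presentCopies E g then (0 : ℝ) else 1) ≤ ε := by
    linarith
  have hsum : prodExp (coin p₁) (fun g => if ∃ i, S i ⊆ presentCopies E g then (1 : ℝ) else 0) +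
      prodExp (coin p₁) (fun g => if ∃ i, S i ⊆ presentCopies E g then (0 : ℝ) else 1) = 1 := by
    rw [← prodExp_add]
    refine Eq.trans (congrArg _ (funext fun g => ?_)) (prodExp_const (I := X) (sum_coin p₁) 1)
    split_ifs <;> norm_num
  have hmono := prodExp_coin_mono (X := X) hp₁0 hp hp1
    (φ := fun g => if ∃ i, S i ⊆ presentCopies E g then (1 : ℝ) else 0) (by
      intro f g hfg
      split_ifs with h1 h2 h2
      · exact le_rfl
      · obtain ⟨i, hi⟩ := h1
        refine absurd ⟨i, fun k hk => ?_⟩ h2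
        have := hi hk
        simp only [presentCopies, Finset.mem_filter, Finset.mem_univ, true_and] at this ⊢
        exact fun x hx => hfg x (this x hx)
      · exact zero_le_one
      · exact le_rfl)
  linarith

end RandomCover

section Hypergeometric

theorem choose_mul_pow_le {N k : ℕ} (hk : k ≤ N) {j : ℕ} (hj : j ≤ N) :
    N.choose j * k ^ j * (N - k) ^ (N - j) ≤ N.choose k * k ^ k * (N - k) ^ (N - k) := by
  have hstep (i : ℕ) : N.choose (i + 1) * (i + 1) = N.choose i * (N - i) :=
    Nat.choose_succ_right_eq N i
  rcases le_total j k with h | h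
  · induction h using Nat.decreasingInduction with
    | self => exact le_rfl
    | of_succ i hi ih =>
      refine le_trans ?_ (ih (by omega))
      obtain ⟨m, hm⟩ : ∃ m, N - i = m + 1 := ⟨N - i - 1, by omega⟩
      have hm' : N - (i + 1) = m := by omega
      rw [hm, hm', pow_succ, pow_succ]
      refine Nat.le_of_mul_le_mul_right ?_ (Nat.succ_pos i)
      have h1 : (N - k) * (i + 1) ≤ (m + 1) * k := by
        have e1 : N - k ≤ m + 1 := by omega
        have e2 : i + 1 ≤ k := by omega
        exact Nat.mul_le_mul e1 e2
      calc N.choose i * k ^ i * ((N - k) ^ m * (N - k)) * (i + 1)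
          = N.choose i * k ^ i * (N - k) ^ m * ((N - k) * (i + 1)) := by ring
        _ ≤ N.choose i * k ^ i * (N - k) ^ m * ((m + 1) * k) := Nat.mul_le_mul_left _ h1
        _ = (N.choose i * (N - i)) * (k ^ i * k) * (N - k) ^ m := by rw [hm]; ring
        _ = N.choose (i + 1) * (k ^ i * k) * (N - k) ^ m * (i + 1) := by rw [← hstep]; ring
  · induction j, h using Nat.le_induction with
    | base => exact le_rfl
    | succ i hi ih =>
      refine le_trans ?_ (ih (by omega))
      obtain ⟨m, hm⟩ : ∃ m, N - i = m + 1 := ⟨N - i - 1, by omega⟩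
      have hm' : N - (i + 1) = m := by omega
      rw [hm, hm', pow_succ, pow_succ]
      refine Nat.le_of_mul_le_mul_right ?_ (Nat.succ_pos i)
      have h1 : (m + 1) * k ≤ (N - k) * (i + 1) := by
        have e1 : m + 1 ≤ N - k := by omega
        have e2 : k ≤ i + 1 := by omega
        exact Nat.mul_le_mul e1 e2
      calc N.choose (i + 1) * (k ^ i * k) * (N - k) ^ m * (i + 1)
          = (N.choose (i + 1) * (i + 1)) * (k ^ i * k) * (N - k) ^ m := by ring
        _ = N.choose i * k ^ i * (N - k) ^ m * ((m + 1) * k) := by rw [hstep, hm]; ring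
        _ ≤ N.choose i * k ^ i * (N - k) ^ m * ((N - k) * (i + 1)) := Nat.mul_le_mul_left _ h1
        _ = N.choose i * k ^ i * ((N - k) ^ m * (N - k)) * (i + 1) := by ring

theorem pow_le_succ_mul_choose {N k : ℕ} (hk : k ≤ N) :
    N ^ N ≤ (N + 1) * (N.choose k * k ^ k * (N - k) ^ (N - k)) := by
  have h := add_pow k (N - k) N
  rw [Nat.add_sub_cancel' hk] at h
  rw [h]
  refine (Finset.sum_le_card_nsmul _ _ (N.choose k * k ^ k * (N - k) ^ (N - k))
    fun j hj => ?_).trans (by simp)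
  have := choose_mul_pow_le hk (Nat.lt_succ_iff.1 (Finset.mem_range.1 hj))
  calc _ = N.choose j * k ^ j * (N - k) ^ (N - j) := by simp; ring
    _ ≤ _ := this

theorem card_lower_tail_le {V : Type*} [DecidableEq V] (B D : Finset V) (hD : D ⊆ B) {k : ℕ}
    (hk : k ≤ B.card) {η : ℝ} (h0 : 0 ≤ η) (h1 : η ≤ 1) :
    (((B.powersetCard k).filter fun Q =>
        ((Q ∩ D).card : ℝ) ≤ D.card * k / B.card - η * B.card).card : ℝ) ≤
      (B.card + 1) * Real.exp (-(η ^ 2 * B.card / 4)) * (B.powersetCard k).card := by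
  set N := B.card with hN
  set 𝒯 := (B.powersetCard k).filter fun Q => ((Q ∩ D).card : ℝ) ≤ D.card * k / N - η * N with h𝒯
  rcases Nat.eq_zero_or_pos N with hN0 | hNpos
  · have hle : (𝒯.card : ℝ) ≤ (B.powersetCard k).card := by exact_mod_cast Finset.card_filter_le _ _
    simpa [hN0] using hle
  have hNr : (0 : ℝ) < N := by exact_mod_cast hNpos
  set q : ℝ := k / N with hq
  have hq0 : 0 ≤ q := by positivity
  have hq1 : q ≤ 1 := (div_le_one hNr).2 (by exact_mod_cast hk)
  set lam : ℝ := η / 2 with hlam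
  have hl0 : 0 ≤ lam := by positivity
  have hgen : ∑ Q ∈ B.powerset, q ^ Q.card * (1 - q) ^ (B \ Q).card * Real.exp (-lam * (Q ∩ D).card)
      = (1 - q * (1 - Real.exp (-lam))) ^ D.card := by
    have h := Finset.prod_add (fun v => q * if v ∈ D then Real.exp (-lam) else 1)
      (fun _ => 1 - q) B
    have hl : ∏ v ∈ B, ((q * if v ∈ D then Real.exp (-lam) else 1) + (1 - q)) =
        (1 - q * (1 - Real.exp (-lam))) ^ D.card := by
      rw [← Finset.prod_subset hD (fun v _ hv => by simp [hv]), ← Finset.prod_const]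
      refine Finset.prod_congr rfl fun v hv => ?_
      rw [if_pos hv]; ring
    rw [← hl, h]
    refine Finset.sum_congr rfl fun Q hQ => ?_
    rw [Finset.prod_mul_distrib, Finset.prod_const, Finset.prod_const, Finset.prod_ite_mem,
      Finset.prod_const, ← Real.exp_nat_mul]
    ring_nf
  have hexp : Real.exp (-lam) ≤ 1 - lam + lam ^ 2 := by
    have h := Real.abs_exp_sub_one_sub_id_le (x := -lam) (by rw [abs_neg, abs_of_nonneg hl0]; linarith)
    have := (abs_le.1 h).2
    linarith [neg_sq lam]
  have hrhs : (1 - q * (1 - Real.exp (-lam))) ^ D.card ≤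
      Real.exp (-lam * (D.card * q) + N * lam ^ 2) := by
    have hb0 : 0 ≤ 1 - q * (1 - Real.exp (-lam)) := by nlinarith [Real.exp_pos (-lam)]
    have hDN : (D.card : ℝ) ≤ N := by exact_mod_cast Finset.card_le_card hD
    calc (1 - q * (1 - Real.exp (-lam))) ^ D.card
        ≤ (Real.exp (-(q * (lam - lam ^ 2)))) ^ D.card := by
          refine pow_le_pow_left₀ hb0 ?_ _
          refine le_trans ?_ (Real.add_one_le_exp _)
          nlinarith
      _ = Real.exp (-lam * (D.card * q) + D.card * q * lam ^ 2) := by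
          rw [← Real.exp_nat_mul]; congr 1; ring
      _ ≤ _ := by
          refine Real.exp_le_exp.2 (add_le_add le_rfl ?_)
          refine mul_le_mul_of_nonneg_right ?_ (sq_nonneg _)
          calc (D.card : ℝ) * q ≤ N * 1 := mul_le_mul hDN hq1 hq0 hNr.le
            _ = N := mul_one _
  have hlow : (𝒯.card : ℝ) * (q ^ k * (1 - q) ^ (N - k) *
      Real.exp (-lam * (D.card * q - η * N))) ≤
      Real.exp (-lam * (D.card * q) + N * lam ^ 2) := by
    refine le_trans ?_ (hgen.le.trans hrhs)
    rw [← nsmul_eq_mul, ← Finset.sum_const]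
    refine (Finset.sum_le_sum fun Q hQ => ?_).trans
      (Finset.sum_le_sum_of_subset_of_nonneg (s := 𝒯) (fun Q hQ => ?_) fun Q _ _ => ?_)
    · obtain ⟨hQ1, hQ2⟩ := Finset.mem_filter.1 hQ
      obtain ⟨hQB, hQk⟩ := Finset.mem_powersetCard.1 hQ1
      rw [Finset.card_sdiff_of_subset hQB, hQk]
      refine mul_le_mul_of_nonneg_left (Real.exp_le_exp.2 ?_) (mul_nonneg (by positivity)
        (pow_nonneg (by linarith) _))
      rw [mul_div_assoc] at hQ2
      nlinarith
    · exact Finset.mem_powerset.2 (Finset.mem_powersetCard.1 (Finset.mem_filter.1 hQ).1).1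
    · exact mul_nonneg (mul_nonneg (by positivity) (pow_nonneg (by linarith) _)) (Real.exp_pos _).le
  have hmode : 1 ≤ (N + 1) * (N.choose k : ℝ) * (q ^ k * (1 - q) ^ (N - k)) := by
    have h := pow_le_succ_mul_choose hk
    have h' : ((N : ℝ)) ^ N ≤ (N + 1) * (N.choose k * k ^ k * (N - k : ℝ) ^ (N - k)) := by
      rw [← Nat.cast_sub hk]; exact_mod_cast h
    have e : (N : ℝ) ^ N = N ^ k * N ^ (N - k) := by rw [← pow_add, Nat.add_sub_cancel' hk]
    have e2 : 1 - q = (N - k) / N := by rw [hq]; field_simp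
    rw [e2, hq, div_pow, div_pow, div_mul_div_comm, ← e, mul_div_assoc', le_div_iff₀ (by positivity)]
    calc _ = (N : ℝ) ^ N := one_mul _
      _ ≤ _ := h'
      _ = _ := by ring
  have hpos : 0 ≤ q ^ k * (1 - q) ^ (N - k) := mul_nonneg (by positivity) (pow_nonneg (by linarith) _)
  rw [Finset.card_powersetCard, ← hN]
  have hlow' : (𝒯.card : ℝ) * (q ^ k * (1 - q) ^ (N - k)) ≤ Real.exp (-(η ^ 2 * N / 4)) := by
    have e : Real.exp (-(η ^ 2 * N / 4)) * Real.exp (-lam * (D.card * q - η * N)) =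
        Real.exp (-lam * (D.card * q) + N * lam ^ 2) := by
      rw [← Real.exp_add]; congr 1; rw [hlam]; ring
    rw [← e, ← mul_assoc] at hlow
    exact le_of_mul_le_mul_right hlow (Real.exp_pos _)
  calc (𝒯.card : ℝ) ≤ 𝒯.card * ((N + 1) * (N.choose k : ℝ) * (q ^ k * (1 - q) ^ (N - k))) :=
        le_mul_of_one_le_right (Nat.cast_nonneg _) hmode
    _ = (𝒯.card * (q ^ k * (1 - q) ^ (N - k))) * ((N + 1) * (N.choose k : ℝ)) := by ring
    _ ≤ Real.exp (-(η ^ 2 * N / 4)) * ((N + 1) * (N.choose k : ℝ)) :=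
        mul_le_mul_of_nonneg_right hlow' (by positivity)
    _ = _ := by ring

/-- The number of `k`-sets containing `X` and avoiding `Y`. -/
theorem card_powersetCard_between {V : Type*} [DecidableEq V] {B X Y : Finset V} (hX : X ⊆ B)
    (hY : Y ⊆ B) (hXY : Disjoint X Y) {a b : ℕ} (hB : B.card = a + b) :
    ((B.powersetCard a).filter fun Q => X ⊆ Q ∧ Y ⊆ B \ Q).card *
        (a + b).descFactorial (X.card + Y.card) =
      a.descFactorial X.card * b.descFactorial Y.card * (B.powersetCard a).card := by
  rcases lt_or_ge a X.card with hx | hx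
  · rw [Nat.descFactorial_eq_zero_iff_lt.2 hx, zero_mul, zero_mul, Finset.card_eq_zero.2, zero_mul]
    refine Finset.filter_eq_empty_iff.2 fun Q hQ h => ?_
    have h1 := Finset.card_le_card h.1
    rw [(Finset.mem_powersetCard.1 hQ).2] at h1
    omega
  rcases lt_or_ge b Y.card with hy | hy
  · rw [Nat.descFactorial_eq_zero_iff_lt.2 hy, mul_zero, zero_mul, Finset.card_eq_zero.2, zero_mul]
    refine Finset.filter_eq_empty_iff.2 fun Q hQ h => ?_
    have h1 := Finset.card_le_card h.2
    rw [Finset.card_sdiff_of_subset (Finset.mem_powersetCard.1 hQ).1,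
      (Finset.mem_powersetCard.1 hQ).2] at h1
    omega
  have hcard : ((B.powersetCard a).filter fun Q => X ⊆ Q ∧ Y ⊆ B \ Q).card =
      ((a - X.card) + (b - Y.card)).choose (a - X.card) := by
    have hR : (B \ (X ∪ Y)).card = (a - X.card) + (b - Y.card) := by
      rw [Finset.card_sdiff_of_subset (Finset.union_subset hX hY),
        Finset.card_union_of_disjoint hXY, hB]
      omega
    rw [← hR, ← Finset.card_powersetCard]
    refine Finset.card_nbij' (fun Q => Q \ X) (fun Q => Q ∪ X) ?_ ?_ ?_ ?_
    · intro Q hQ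
      simp only [Finset.coe_filter, Set.mem_ofPred_eq, Finset.mem_powersetCard] at hQ
      obtain ⟨⟨hQB, hQa⟩, hXQ, hYQ⟩ := hQ
      refine Finset.mem_coe.2 (Finset.mem_powersetCard.2 ⟨fun v hv => ?_, ?_⟩)
      · obtain ⟨hv1, hv2⟩ := Finset.mem_sdiff.1 hv
        refine Finset.mem_sdiff.2 ⟨hQB hv1, fun h => ?_⟩
        rcases Finset.mem_union.1 h with h | h
        · exact hv2 h
        · exact (Finset.mem_sdiff.1 (hYQ h)).2 hv1
      · rw [Finset.card_sdiff_of_subset hXQ, hQa]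
    · intro Q hQ
      obtain ⟨hQB, hQa⟩ := Finset.mem_powersetCard.1 (Finset.mem_coe.1 hQ)
      have hd : Disjoint Q (X ∪ Y) := Finset.disjoint_of_subset_left hQB Finset.sdiff_disjoint
      have hdX := (Finset.disjoint_union_right.1 hd).1
      have hdY := (Finset.disjoint_union_right.1 hd).2
      simp only [Finset.coe_filter, Set.mem_ofPred_eq, Finset.mem_powersetCard]
      refine ⟨⟨Finset.union_subset (hQB.trans Finset.sdiff_subset) hX, ?_⟩,
        Finset.subset_union_right, fun v hv => Finset.mem_sdiff.2 ⟨hY hv, fun h => ?_⟩⟩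
      · rw [Finset.card_union_of_disjoint hdX, hQa]; omega
      · rcases Finset.mem_union.1 h with h | h
        · exact Finset.disjoint_left.1 hdY h hv
        · exact Finset.disjoint_left.1 hXY h hv
    · intro Q hQ
      simp only [Finset.coe_filter, Set.mem_ofPred_eq] at hQ
      exact Finset.sdiff_union_of_subset hQ.2.1
    · intro Q hQ
      obtain ⟨hQB, hQa⟩ := Finset.mem_powersetCard.1 (Finset.mem_coe.1 hQ)
      have hd : Disjoint Q (X ∪ Y) := Finset.disjoint_of_subset_left hQB Finset.sdiff_disjoint
      exact Finset.union_sdiff_cancel_right (Finset.disjoint_union_right.1 hd).1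
  rw [hcard, Finset.card_powersetCard, hB]
  have e1 := Nat.factorial_mul_descFactorial hx
  have e2 := Nat.factorial_mul_descFactorial hy
  have e3 := Nat.factorial_mul_descFactorial (n := a + b) (k := X.card + Y.card) (by omega)
  have e4 := Nat.add_choose_mul_factorial_mul_factorial a b
  have e5 := Nat.add_choose_mul_factorial_mul_factorial (a - X.card) (b - Y.card)
  rw [← Nat.choose_symm_add] at e4 e5
  rw [show a + b - (X.card + Y.card) = (a - X.card) + (b - Y.card) by omega] at e3
  refine Nat.eq_of_mul_eq_mul_right (Nat.mul_pos (Nat.factorial_pos (a - X.card))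
    (Nat.factorial_pos (b - Y.card))) ?_
  calc _ = (((a - X.card) + (b - Y.card)).choose (a - X.card) * (a - X.card).factorial *
        (b - Y.card).factorial) * (a + b).descFactorial (X.card + Y.card) := by ring
    _ = (a + b).choose a * a.factorial * b.factorial := by rw [e5, e3, e4]
    _ = _ := by rw [← e1, ← e2]; ring

end Hypergeometric

section SpreadRecursion

variable {I : Type} [Fintype I] [DecidableEq I] {P : I → Type} [∀ c, DecidableEq (P c)]
  {K : Type} [DecidableEq K]

/-- `S` consists of `N` members with pairwise disjoint point sets inside the box `B`. -/
def IsTiling (pts : K → ∀ c, Finset (P c)) (N : ℕ) (B : ∀ c, Finset (P c))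
    (S : Finset K) : Prop :=
  (∀ k ∈ S, ∀ c, pts k c ⊆ B c) ∧
    (∀ k ∈ S, ∀ k' ∈ S, k ≠ k' → ∀ c, Disjoint (pts k c) (pts k' c)) ∧ S.card = N

/-- The number of points of class `c` used by the members of `A`. -/
def load (pts : K → ∀ c, Finset (P c)) (A : Finset K) (c : I) : ℕ := ∑ k ∈ A, (pts k c).card

/-- The spread bound for a box with `m c * n` points of class `c`. -/
noncomputable def spreadBound (pts : K → ∀ c, Finset (P c)) (m : I → ℕ) (n : ℕ) (C : ℝ)
    (A : Finset K) : ℝ :=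
  (C * n) ^ A.card * ∏ c, (((m c * n).descFactorial (load pts A c) : ℕ) : ℝ)⁻¹

/-- There is a spread probability measure on the tilings of `B`. -/
def HasSpreadTiling (pts : K → ∀ c, Finset (P c)) (m : I → ℕ) (R n : ℕ)
    (B : ∀ c, Finset (P c)) (C : ℝ) : Prop :=
  ∃ (ι : Type) (_ : Fintype ι) (w : ι → ℝ) (S : ι → Finset K), (∀ i, 0 ≤ w i) ∧ ∑ i, w i = 1 ∧
    (∀ i, IsTiling pts (R * n) B (S i)) ∧
    ∀ A, ∑ i, (if A ⊆ S i then w i else 0) ≤ spreadBound pts m n C A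

/-- The ways to choose `m c * n` points of each class of `B`. -/
def boxSplits (m : I → ℕ) (n : ℕ) (B : ∀ c, Finset (P c)) : Finset (∀ c, Finset (P c)) :=
  Fintype.piFinset fun c => (B c).powersetCard (m c * n)

variable {pts : K → ∀ c, Finset (P c)} {m : I → ℕ} {R : ℕ}

theorem IsTiling.union {N₁ N₂ : ℕ} {B Q : ∀ c, Finset (P c)} {S₁ S₂ : Finset K}
    (hpts : ∀ k, ∃ c, (pts k c).Nonempty) (hQ : ∀ c, Q c ⊆ B c)
    (h₁ : IsTiling pts N₁ Q S₁) (h₂ : IsTiling pts N₂ (fun c => B c \ Q c) S₂) :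
    IsTiling pts (N₁ + N₂) B (S₁ ∪ S₂) := by
  have hd : ∀ k ∈ S₁, ∀ k' ∈ S₂, ∀ c, Disjoint (pts k c) (pts k' c) := fun k hk k' hk' c =>
    Finset.disjoint_of_subset_left (h₁.1 k hk c)
      (Finset.disjoint_of_subset_right (h₂.1 k' hk' c) Finset.disjoint_sdiff)
  refine ⟨fun k hk => ?_, fun k hk k' hk' hne c => ?_, ?_⟩
  · rcases Finset.mem_union.1 hk with hk | hk
    · exact fun c => (h₁.1 k hk c).trans (hQ c)
    · exact fun c => (h₂.1 k hk c).trans Finset.sdiff_subset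
  · rcases Finset.mem_union.1 hk with hk | hk <;> rcases Finset.mem_union.1 hk' with hk' | hk'
    · exact h₁.2.1 k hk k' hk' hne c
    · exact hd k hk k' hk' c
    · exact (hd k' hk' k hk c).symm
    · exact h₂.2.1 k hk k' hk' hne c
  · rw [Finset.card_union_of_disjoint, h₁.2.2, h₂.2.2]
    refine Finset.disjoint_left.2 fun k hk hk' => ?_
    obtain ⟨c, hc⟩ := hpts k
    exact hc.ne_empty (disjoint_self.1 (hd k hk k hk' c))

theorem load_eq_card {N : ℕ} {B : ∀ c, Finset (P c)} {S A : Finset K}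
    (h : IsTiling pts N B S) (hA : A ⊆ S) (c : I) :
    load pts A c = (A.biUnion fun k => pts k c).card := by
  rw [Finset.card_biUnion]
  · rfl
  · exact fun k hk k' hk' hne => h.2.1 k (hA hk) k' (hA hk') hne c

theorem spreadBound_nonneg {n : ℕ} {C : ℝ} (hC : 0 ≤ C) (A : Finset K) :
    0 ≤ spreadBound pts m n C A :=
  mul_nonneg (by positivity) (Finset.prod_nonneg fun c _ => by positivity)

theorem load_sdiff {A A₁ : Finset K} (h : A₁ ⊆ A) (c : I) :
    load pts A₁ c + load pts (A \ A₁) c = load pts A c := by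
  rw [load, load, add_comm]
  exact Finset.sum_sdiff h

/-- Averaged over all splits, the bounds of the two halves recombine. -/
theorem card_splits_mul_spreadBound_le {n₁ n₂ N : ℕ} {B : ∀ c, Finset (P c)}
    (hB : ∀ c, (B c).card = m c * (n₁ + n₂)) {C : ℝ} (hC : 0 ≤ C) {S A A₁ : Finset K}
    (hS : IsTiling pts N B S) (hA : A ⊆ S) (hA₁ : A₁ ⊆ A) :
    (((boxSplits m n₁ B).filter fun Q => ∀ c, (A₁.biUnion fun k => pts k c) ⊆ Q c ∧
        ((A \ A₁).biUnion fun k => pts k c) ⊆ B c \ Q c).card : ℝ) *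
        (spreadBound pts m n₁ C A₁ * spreadBound pts m n₂ C (A \ A₁)) ≤
      (boxSplits m n₁ B).card * ((C * n₁) ^ A₁.card * (C * n₂) ^ (A.card - A₁.card) *
        ∏ c, (((m c * (n₁ + n₂)).descFactorial (load pts A c) : ℕ) : ℝ)⁻¹) := by
  have hcount : ((boxSplits m n₁ B).filter fun Q => ∀ c, (A₁.biUnion fun k => pts k c) ⊆ Q c ∧
        ((A \ A₁).biUnion fun k => pts k c) ⊆ B c \ Q c) =
      Fintype.piFinset fun c => ((B c).powersetCard (m c * n₁)).filter fun q =>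
        (A₁.biUnion fun k => pts k c) ⊆ q ∧ ((A \ A₁).biUnion fun k => pts k c) ⊆ B c \ q := by
    ext Q
    simp only [boxSplits, Finset.mem_filter, Fintype.mem_piFinset, ← forall_and]
  rw [hcount, Fintype.card_piFinset, boxSplits, Fintype.card_piFinset, spreadBound, spreadBound,
    Finset.card_sdiff_of_subset hA₁]
  push_cast
  have hc : ∀ c, ((((B c).powersetCard (m c * n₁)).filter fun q =>
        (A₁.biUnion fun k => pts k c) ⊆ q ∧
          ((A \ A₁).biUnion fun k => pts k c) ⊆ B c \ q).card : ℝ) *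
        ((((m c * n₁).descFactorial (load pts A₁ c) : ℕ) : ℝ)⁻¹ *
          (((m c * n₂).descFactorial (load pts (A \ A₁) c) : ℕ) : ℝ)⁻¹) ≤
      ((B c).powersetCard (m c * n₁)).card *
        (((m c * (n₁ + n₂)).descFactorial (load pts A c) : ℕ) : ℝ)⁻¹ := by
    intro c
    have hsub : ∀ A' ⊆ A, (A'.biUnion fun k => pts k c) ⊆ B c := fun A' hA' =>
      Finset.biUnion_subset.2 fun k hk => hS.1 k (hA (hA' hk)) c
    have hdisj : Disjoint (A₁.biUnion fun k => pts k c) ((A \ A₁).biUnion fun k => pts k c) := by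
      rw [Finset.disjoint_biUnion_left]
      intro k hk
      rw [Finset.disjoint_biUnion_right]
      intro k' hk'
      obtain ⟨hk1, hk2⟩ := Finset.mem_sdiff.1 hk'
      exact hS.2.1 k (hA (hA₁ hk)) k' (hA hk1) (fun h => hk2 (h ▸ hk)) c
    have key := card_powersetCard_between (hsub A₁ hA₁) (hsub _ Finset.sdiff_subset) hdisj
      ((hB c).trans (mul_add _ _ _))
    rw [← load_eq_card hS (hA₁.trans hA), ← load_eq_card hS (Finset.sdiff_subset.trans hA),
      load_sdiff hA₁, ← mul_add] at key
    have key' := congrArg (Nat.cast (R := ℝ)) key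
    push_cast at key'
    rcases Nat.eq_zero_or_pos ((m c * n₁).descFactorial (load pts A₁ c)) with h | h1
    · rw [h, Nat.cast_zero, inv_zero, zero_mul, mul_zero]; positivity
    rcases Nat.eq_zero_or_pos ((m c * n₂).descFactorial (load pts (A \ A₁) c)) with h | h2
    · rw [h, Nat.cast_zero, inv_zero, mul_zero, mul_zero]; positivity
    have h3 : 0 < (m c * (n₁ + n₂)).descFactorial (load pts A c) := by
      replace h1 := h1.ne'
      replace h2 := h2.ne'
      rw [Nat.pos_iff_ne_zero]
      rw [Ne, Nat.descFactorial_eq_zero_iff_lt] at h1 h2 ⊢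
      rw [← load_sdiff hA₁, mul_add]
      omega
    have h1' : (0 : ℝ) < ((m c * n₁).descFactorial (load pts A₁ c) : ℕ) := by exact_mod_cast h1
    have h2' : (0 : ℝ) < ((m c * n₂).descFactorial (load pts (A \ A₁) c) : ℕ) := by
      exact_mod_cast h2
    have h3' : (0 : ℝ) < ((m c * (n₁ + n₂)).descFactorial (load pts A c) : ℕ) := by
      exact_mod_cast h3
    rw [← mul_inv, ← div_eq_mul_inv, ← div_eq_mul_inv, div_le_div_iff₀ (by positivity) h3', key']
    exact le_of_eq (mul_comm _ _)
  have hprod := Finset.prod_le_prod (s := Finset.univ) (fun c _ => by positivity) fun c _ => hc c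
  rw [Finset.prod_mul_distrib, Finset.prod_mul_distrib, Finset.prod_mul_distrib] at hprod
  have hpow : 0 ≤ (C * n₁) ^ A₁.card * (C * n₂) ^ (A.card - A₁.card) := by positivity
  have := mul_le_mul_of_nonneg_left hprod hpow
  refine le_trans (le_of_eq ?_) (this.trans (le_of_eq ?_)) <;> ring

theorem HasSpreadTiling.of_halves {n₁ n₂ : ℕ} {B : ∀ c, Finset (P c)}
    (hpts : ∀ k, ∃ c, (pts k c).Nonempty)
    (hB : ∀ c, (B c).card = m c * (n₁ + n₂)) {C ε : ℝ} (hC : 0 ≤ C) (hε0 : 0 ≤ ε) (hε : ε < 1)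
    {G : Finset (∀ c, Finset (P c))} (hG : G ⊆ boxSplits m n₁ B)
    (hcard : (1 - ε) * (boxSplits m n₁ B).card ≤ G.card)
    (h₁ : ∀ Q ∈ G, HasSpreadTiling pts m R n₁ Q C)
    (h₂ : ∀ Q ∈ G, HasSpreadTiling pts m R n₂ (fun c => B c \ Q c) C) :
    HasSpreadTiling pts m R (n₁ + n₂) B (C / (1 - ε)) := by
  have hpos : 0 < (boxSplits m n₁ B).card := by
    rw [boxSplits, Fintype.card_piFinset]
    refine Finset.prod_pos fun c _ => ?_
    rw [Finset.card_powersetCard, hB]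
    exact Nat.choose_pos (Nat.mul_le_mul_left _ (Nat.le_add_right _ _))
  have hpos' : (0 : ℝ) < (boxSplits m n₁ B).card := by exact_mod_cast hpos
  have hε1 : 0 < 1 - ε := by linarith
  have hGpos : (0 : ℝ) < G.card := lt_of_lt_of_le (by positivity) hcard
  have h₁' : ∀ Q : G, HasSpreadTiling pts m R n₁ Q.1 C := fun Q => h₁ Q.1 Q.2
  have h₂' : ∀ Q : G, HasSpreadTiling pts m R n₂ (fun c => B c \ Q.1 c) C :=
    fun Q => h₂ Q.1 Q.2
  choose ι₁ f₁ w₁ S₁ hw₁ hs₁ ht₁ hb₁ using h₁'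
  choose ι₂ f₂ w₂ S₂ hw₂ hs₂ ht₂ hb₂ using h₂'
  have htile : ∀ i : Σ Q : G, ι₁ Q × ι₂ Q, IsTiling pts (R * (n₁ + n₂)) B
      (S₁ i.1 i.2.1 ∪ S₂ i.1 i.2.2) := by
    intro i
    rw [mul_add]
    refine IsTiling.union hpts (fun c => ?_) (ht₁ i.1 i.2.1) (ht₂ i.1 i.2.2)
    exact (Finset.mem_powersetCard.1 (Fintype.mem_piFinset.1 (hG i.1.2) c)).1
  refine ⟨Σ Q : G, ι₁ Q × ι₂ Q, inferInstance,
    fun i => (G.card : ℝ)⁻¹ * (w₁ i.1 i.2.1 * w₂ i.1 i.2.2),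
    fun i => S₁ i.1 i.2.1 ∪ S₂ i.1 i.2.2, ?_, ?_, htile, ?_⟩
  · exact fun i => mul_nonneg (by positivity) (mul_nonneg (hw₁ _ _) (hw₂ _ _))
  · simp only [Fintype.sum_sigma, Fintype.sum_prod_type, ← Finset.mul_sum, hs₂]
    simp [hs₁, hGpos.ne']
  · intro A
    by_cases hA : ∃ i : Σ Q : G, ι₁ Q × ι₂ Q, A ⊆ S₁ i.1 i.2.1 ∪ S₂ i.1 i.2.2
    swap
    · rw [Finset.sum_eq_zero fun i _ => if_neg fun h => hA ⟨i, h⟩]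
      exact spreadBound_nonneg (div_nonneg hC hε1.le) A
    obtain ⟨i₀, hi₀⟩ := hA
    have hS := htile i₀
    set good : Finset K → (∀ c, Finset (P c)) → Prop := fun A₁ Q =>
      ∀ c, (A₁.biUnion fun k => pts k c) ⊆ Q c ∧ ((A \ A₁).biUnion fun k => pts k c) ⊆ B c \ Q c
      with hgood
    have hQ : ∀ Q : G, ∑ i, ∑ j, (if A ⊆ S₁ Q i ∪ S₂ Q j then w₁ Q i * w₂ Q j else 0) ≤
        ∑ A₁ ∈ A.powerset, if good A₁ Q.1 then
          spreadBound pts m n₁ C A₁ * spreadBound pts m n₂ C (A \ A₁) else 0 := by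
      intro Q
      calc ∑ i, ∑ j, (if A ⊆ S₁ Q i ∪ S₂ Q j then w₁ Q i * w₂ Q j else 0)
          ≤ ∑ i, ∑ j, ∑ A₁ ∈ A.powerset,
              (if A₁ ⊆ S₁ Q i then w₁ Q i else 0) * (if A \ A₁ ⊆ S₂ Q j then w₂ Q j else 0) := by
            refine Finset.sum_le_sum fun i _ => Finset.sum_le_sum fun j _ => ?_
            have hnn : ∀ A₁ ∈ A.powerset, 0 ≤ (if A₁ ⊆ S₁ Q i then w₁ Q i else 0) *
                (if A \ A₁ ⊆ S₂ Q j then w₂ Q j else 0) := by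
              intro A₁ _
              refine mul_nonneg ?_ ?_ <;> split_ifs <;> first | exact hw₁ _ _ | exact hw₂ _ _ | exact le_rfl
            split_ifs with h
            · refine le_trans (le_of_eq ?_) (Finset.single_le_sum hnn
                (Finset.mem_powerset.2 (Finset.inter_subset_left (s₂ := S₁ Q i))))
              rw [if_pos Finset.inter_subset_right, if_pos]
              intro k hk
              obtain ⟨hk1, hk2⟩ := Finset.mem_sdiff.1 hk
              exact (Finset.mem_union.1 (h hk1)).resolve_left fun h' =>
                hk2 (Finset.mem_inter.2 ⟨hk1, h'⟩)
            · exact Finset.sum_nonneg hnn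
        _ = ∑ A₁ ∈ A.powerset, (∑ i, if A₁ ⊆ S₁ Q i then w₁ Q i else 0) *
              ∑ j, (if A \ A₁ ⊆ S₂ Q j then w₂ Q j else 0) := by
            simp_rw [Finset.sum_mul_sum]
            rw [Finset.sum_comm (s := A.powerset)]
            exact Finset.sum_congr rfl fun i _ => Finset.sum_comm
        _ ≤ _ := by
            refine Finset.sum_le_sum fun A₁ hA₁ => ?_
            have hn1 : 0 ≤ ∑ i, (if A₁ ⊆ S₁ Q i then w₁ Q i else 0) :=
              Finset.sum_nonneg fun i _ => by split_ifs; exacts [hw₁ _ _, le_rfl]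
            have hn2 : 0 ≤ ∑ j, (if A \ A₁ ⊆ S₂ Q j then w₂ Q j else 0) :=
              Finset.sum_nonneg fun i _ => by split_ifs; exacts [hw₂ _ _, le_rfl]
            split_ifs with h
            · exact mul_le_mul (hb₁ Q A₁) (hb₂ Q _) hn2 (spreadBound_nonneg hC _)
            · refine le_of_eq ?_
              by_contra hne
              refine h fun c => ⟨?_, ?_⟩
              · obtain ⟨i, _, hi⟩ := Finset.exists_ne_zero_of_sum_ne_zero (left_ne_zero_of_mul hne)
                have hi' : A₁ ⊆ S₁ Q i := by by_contra h'; exact hi (if_neg h')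
                exact Finset.biUnion_subset.2 fun k hk => (ht₁ Q i).1 k (hi' hk) c
              · obtain ⟨j, _, hj⟩ := Finset.exists_ne_zero_of_sum_ne_zero (right_ne_zero_of_mul hne)
                have hj' : A \ A₁ ⊆ S₂ Q j := by by_contra h'; exact hj (if_neg h')
                exact Finset.biUnion_subset.2 fun k hk => (ht₂ Q j).1 k (hj' hk) c
    set D : ℝ := ∏ c, (((m c * (n₁ + n₂)).descFactorial (load pts A c) : ℕ) : ℝ)⁻¹ with hD
    have hD0 : 0 ≤ D := Finset.prod_nonneg fun c _ => by positivity
    have hsum : ∑ Q : G, ∑ i, ∑ j, (if A ⊆ S₁ Q i ∪ S₂ Q j then w₁ Q i * w₂ Q j else 0) ≤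
        (boxSplits m n₁ B).card * ((C * (n₁ + n₂)) ^ A.card * D) := by
      calc _ ≤ ∑ Q : G, ∑ A₁ ∈ A.powerset, (if good A₁ Q.1 then
              spreadBound pts m n₁ C A₁ * spreadBound pts m n₂ C (A \ A₁) else 0) :=
            Finset.sum_le_sum fun Q _ => hQ Q
        _ = ∑ Q ∈ G, ∑ A₁ ∈ A.powerset, (if good A₁ Q then
              spreadBound pts m n₁ C A₁ * spreadBound pts m n₂ C (A \ A₁) else 0) :=
            Finset.sum_coe_sort G fun Q => ∑ A₁ ∈ A.powerset, (if good A₁ Q then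
              spreadBound pts m n₁ C A₁ * spreadBound pts m n₂ C (A \ A₁) else 0)
        _ ≤ ∑ Q ∈ boxSplits m n₁ B, ∑ A₁ ∈ A.powerset, (if good A₁ Q then
              spreadBound pts m n₁ C A₁ * spreadBound pts m n₂ C (A \ A₁) else 0) := by
            refine Finset.sum_le_sum_of_subset_of_nonneg hG fun Q _ _ =>
              Finset.sum_nonneg fun A₁ _ => ?_
            split_ifs
            exacts [mul_nonneg (spreadBound_nonneg hC _) (spreadBound_nonneg hC _), le_rfl]
        _ = ∑ A₁ ∈ A.powerset, (((boxSplits m n₁ B).filter (good A₁)).card : ℝ) *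
              (spreadBound pts m n₁ C A₁ * spreadBound pts m n₂ C (A \ A₁)) := by
            rw [Finset.sum_comm]
            refine Finset.sum_congr rfl fun A₁ _ => ?_
            rw [← Finset.sum_filter, Finset.sum_const, nsmul_eq_mul]
        _ ≤ ∑ A₁ ∈ A.powerset, (boxSplits m n₁ B).card *
              ((C * n₁) ^ A₁.card * (C * n₂) ^ (A.card - A₁.card) * D) :=
            Finset.sum_le_sum fun A₁ hA₁ =>
              card_splits_mul_spreadBound_le hB hC hS hi₀ (Finset.mem_powerset.1 hA₁)
        _ = _ := by
            rw [← Finset.mul_sum, ← Finset.sum_mul, Finset.sum_pow_mul_eq_add_pow, mul_add]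
    simp only [Fintype.sum_sigma, Fintype.sum_prod_type]
    have hfac : ∀ Q : G, ∀ i j, (if A ⊆ S₁ Q i ∪ S₂ Q j then (G.card : ℝ)⁻¹ * (w₁ Q i * w₂ Q j)
        else 0) = (G.card : ℝ)⁻¹ * if A ⊆ S₁ Q i ∪ S₂ Q j then w₁ Q i * w₂ Q j else 0 := by
      intro Q i j; rw [mul_ite, mul_zero]
    simp only [hfac, ← Finset.mul_sum]
    rcases A.eq_empty_or_nonempty with rfl | hne
    · simp [spreadBound, load, ← Finset.mul_sum, hs₁, hs₂, hGpos.ne']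
    rw [spreadBound, Nat.cast_add, ← hD]
    have hGinv : (G.card : ℝ)⁻¹ * (boxSplits m n₁ B).card ≤ (1 - ε)⁻¹ := by
      rw [inv_mul_le_iff₀ hGpos, ← div_eq_mul_inv, le_div_iff₀ hε1, mul_comm]
      exact hcard
    have hpow1 : (1 - ε)⁻¹ ≤ (1 - ε)⁻¹ ^ A.card :=
      le_self_pow₀ ((one_le_inv₀ hε1).2 (by linarith)) (Finset.card_ne_zero.2 hne)
    calc _ ≤ (G.card : ℝ)⁻¹ * ((boxSplits m n₁ B).card * ((C * (n₁ + n₂)) ^ A.card * D)) :=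
          mul_le_mul_of_nonneg_left hsum (by positivity)
      _ = (G.card : ℝ)⁻¹ * (boxSplits m n₁ B).card * ((C * (n₁ + n₂)) ^ A.card * D) := by ring
      _ ≤ (1 - ε)⁻¹ ^ A.card * ((C * (n₁ + n₂)) ^ A.card * D) :=
          mul_le_mul_of_nonneg_right (hGinv.trans hpow1) (by positivity)
      _ = _ := by rw [← mul_assoc, ← mul_pow, div_eq_mul_inv]; congr 2; ring

end SpreadRecursion

theorem pow_le_exp_mul_descFactorial (x : ℕ) : ∀ N : ℕ, x ≤ N →
    (N : ℝ) ^ x ≤ Real.exp 1 ^ x * (N.descFactorial x : ℕ) := by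
  induction x with
  | zero => intro N _; simp
  | succ x ih =>
    intro N hN
    obtain ⟨N, rfl⟩ : ∃ N', N = N' + 1 := ⟨N - 1, by omega⟩
    have hx : x ≤ N := by omega
    have hkey : ((N + 1 : ℕ) : ℝ) ^ x ≤ Real.exp 1 * (N : ℝ) ^ x := by
      rcases Nat.eq_zero_or_pos N with rfl | hpos
      · obtain rfl : x = 0 := by omega
        simp
      have hN' : (0 : ℝ) < N := by exact_mod_cast hpos
      have h1 : ((N + 1 : ℕ) : ℝ) = (1 / N + 1) * N := by push_cast; field_simp; ring
      rw [h1, mul_pow]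
      refine mul_le_mul_of_nonneg_right ?_ (by positivity)
      calc ((1 : ℝ) / N + 1) ^ x ≤ Real.exp (1 / N) ^ x :=
            pow_le_pow_left₀ (by positivity) (Real.add_one_le_exp _) _
        _ = Real.exp (x / N) := by rw [← Real.exp_nat_mul]; congr 1; ring
        _ ≤ Real.exp 1 := Real.exp_le_exp.2 ((div_le_one hN').2 (by exact_mod_cast hx))
    rw [Nat.succ_descFactorial_succ, pow_succ, pow_succ]
    push_cast at hkey ⊢
    have := ih N hx
    calc ((N : ℝ) + 1) ^ x * (N + 1) ≤ (Real.exp 1 * (N : ℝ) ^ x) * (N + 1) :=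
          mul_le_mul_of_nonneg_right hkey (by positivity)
      _ ≤ (Real.exp 1 * (Real.exp 1 ^ x * (N.descFactorial x : ℕ))) * (N + 1) := by gcongr
      _ = _ := by ring

section SpreadRecursion

variable {I : Type} [Fintype I] [DecidableEq I] {P : I → Type} [∀ c, DecidableEq (P c)]
  {K : Type} [DecidableEq K]
  {pts : K → ∀ c, Finset (P c)} {m : I → ℕ} {R : ℕ}

theorem sum_load (d : ℕ) (hd : ∀ k, ∑ c, (pts k c).card = d) (A : Finset K) :
    ∑ c, load pts A c = d * A.card := by
  simp only [load]
  rw [Finset.sum_comm, Finset.sum_congr rfl fun k _ => hd k, Finset.sum_const, smul_eq_mul,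
    mul_comm]

theorem HasSpreadTiling.mono {n : ℕ} {B : ∀ c, Finset (P c)} {C C' : ℝ} (hC : 0 ≤ C)
    (h : C ≤ C') (hB : HasSpreadTiling pts m R n B C) :
    HasSpreadTiling pts m R n B C' := by
  obtain ⟨ι, f, w, S, h1, h2, h3, h4⟩ := hB
  refine ⟨ι, f, w, S, h1, h2, h3, fun A => (h4 A).trans ?_⟩
  exact mul_le_mul_of_nonneg_right
    (pow_le_pow_left₀ (by positivity) (mul_le_mul_of_nonneg_right h (by positivity)) _)
    (Finset.prod_nonneg fun c _ => by positivity)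

theorem IsTiling.hasSpreadTiling {n M d : ℕ} {B : ∀ c, Finset (P c)} {S : Finset K} (hn : 1 ≤ n)
    (hB : ∀ c, (B c).card = m c * n) (hM : ∀ c, m c * n ≤ M)
    (hd : ∀ k, ∑ c, (pts k c).card = d) (hS : IsTiling pts (R * n) B S) :
    HasSpreadTiling pts m R n B ((M : ℝ) ^ d) := by
  refine ⟨Unit, inferInstance, fun _ => 1, fun _ => S, by simp, by simp, fun _ => hS, fun A => ?_⟩
  rw [Fintype.sum_unique]
  split_ifs with hA
  swap
  · exact spreadBound_nonneg (by positivity) A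
  have hload : ∀ c, load pts A c ≤ m c * n := fun c => by
    rw [load_eq_card hS hA, ← hB c]
    exact Finset.card_le_card (Finset.biUnion_subset.2 fun k hk => hS.1 k (hA hk) c)
  have hD : ∀ c, (((m c * n).descFactorial (load pts A c) : ℕ) : ℝ) ≤ (M : ℝ) ^ load pts A c := by
    intro c
    exact_mod_cast (Nat.descFactorial_le_pow _ _).trans (Nat.pow_le_pow_left (hM c) _)
  have hDpos : ∀ c, (0 : ℝ) < (((m c * n).descFactorial (load pts A c) : ℕ) : ℝ) := by
    intro c
    rw [Nat.cast_pos, Nat.pos_iff_ne_zero, Ne, Nat.descFactorial_eq_zero_iff_lt, not_lt]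
    exact hload c
  rw [spreadBound, Finset.prod_inv_distrib, ← div_eq_mul_inv,
    one_le_div (Finset.prod_pos fun c _ => hDpos c)]
  calc ∏ c, (((m c * n).descFactorial (load pts A c) : ℕ) : ℝ)
      ≤ ∏ c, (M : ℝ) ^ load pts A c := Finset.prod_le_prod (fun c _ => (hDpos c).le) fun c _ => hD c
    _ = ((M : ℝ) ^ d) ^ A.card := by
        rw [Finset.prod_pow_eq_pow_sum, sum_load d hd, pow_mul]
    _ ≤ ((M : ℝ) ^ d * n) ^ A.card :=
        pow_le_pow_left₀ (by positivity) (le_mul_of_one_le_right (by positivity)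
          (by exact_mod_cast hn)) _

/-- Spread tilings from iterated halving: a property `Good` passes from a box to both of its
halves for most splits, and forces a tiling in boxes of bounded size. -/
theorem hasSpreadTiling_of_levels {m₀ M d : ℕ} (hm₀ : 1 ≤ m₀)
    (hpts : ∀ k, ∃ c, (pts k c).Nonempty) (hd : ∀ k, ∑ c, (pts k c).card = d)
    (hM : ∀ c, m c * (2 * m₀) ≤ M) (Good : ℕ → ℕ → (∀ c, Finset (P c)) → Prop)
    (hbase : ∀ n B, m₀ ≤ n → n ≤ 2 * m₀ → (∀ c, (B c).card = m c * n) → Good 0 n B →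
      ∃ S, IsTiling pts (R * n) B S)
    (hstep : ∀ k n B, m₀ * 2 ^ (k + 1) ≤ n → n ≤ m₀ * 2 ^ (k + 2) →
      (∀ c, (B c).card = m c * n) → Good (k + 1) n B →
      ∃ G ⊆ boxSplits m (n / 2) B,
        (1 - (9 / 10 : ℝ) ^ k / 20) * (boxSplits m (n / 2) B).card ≤ G.card ∧
        ∀ Q ∈ G, Good k (n / 2) Q ∧ Good k (n - n / 2) fun c => B c \ Q c) (k : ℕ) :
    ∀ n B, m₀ * 2 ^ k ≤ n → n ≤ m₀ * 2 ^ (k + 1) → (∀ c, (B c).card = m c * n) → Good k n B →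
      HasSpreadTiling pts m R n B ((M : ℝ) ^ d * (2 - (9 / 10 : ℝ) ^ k)) := by
  induction k with
  | zero =>
    intro n B h1 h2 hB hG
    rw [pow_zero, mul_one] at h1
    rw [zero_add, pow_one, mul_comm] at h2
    obtain ⟨S, hS⟩ := hbase n B h1 h2 hB hG
    have := hS.hasSpreadTiling (hm₀.trans h1) hB
      (fun c => (Nat.mul_le_mul_left _ h2).trans (hM c)) hd
    refine this.mono (by positivity) (le_of_eq ?_)
    norm_num
  | succ k ih =>
    intro n B h1 h2 hB hG
    obtain ⟨G, hGs, hGc, hGG⟩ := hstep k n B h1 h2 hB hG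
    have e1 : m₀ * 2 ^ (k + 1) = 2 * (m₀ * 2 ^ k) := by ring
    have e2 : m₀ * 2 ^ (k + 1 + 1) = 2 * (m₀ * 2 ^ (k + 1)) := by ring
    have hn : n / 2 + (n - n / 2) = n := by omega
    have hB' : ∀ c, (B c).card = m c * (n / 2 + (n - n / 2)) := by rwa [hn]
    set ε : ℝ := (9 / 10 : ℝ) ^ k / 20 with hε
    have hp0 : (0 : ℝ) < (9 / 10 : ℝ) ^ k := by positivity
    have hp1 : (9 / 10 : ℝ) ^ k ≤ 1 := pow_le_one₀ (by norm_num) (by norm_num)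
    have hQB : ∀ Q ∈ G, ∀ c, Q c ⊆ B c ∧ (Q c).card = m c * (n / 2) := fun Q hQ c =>
      Finset.mem_powersetCard.1 (Fintype.mem_piFinset.1 (hGs hQ) c)
    have hMd : (0 : ℝ) ≤ (M : ℝ) ^ d := by positivity
    have hCk : 0 ≤ (M : ℝ) ^ d * (2 - (9 / 10 : ℝ) ^ k) := mul_nonneg hMd (by linarith)
    have key := HasSpreadTiling.of_halves (R := R) hpts hB' (ε := ε) hCk
      (by positivity) (by linarith) hGs hGc
      (fun Q hQ => ih (n / 2) Q (by omega) (by omega) (fun c => (hQB Q hQ c).2) (hGG Q hQ).1)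
      (fun Q hQ => ih (n - n / 2) _ (by omega) (by omega) (fun c => by
        rw [Finset.card_sdiff_of_subset (hQB Q hQ c).1, (hQB Q hQ c).2, hB c, Nat.mul_sub])
        (hGG Q hQ).2)
    rw [hn] at key
    refine key.mono (div_nonneg hCk (by linarith)) ?_
    rw [mul_div_assoc]
    refine mul_le_mul_of_nonneg_left ?_ hMd
    rw [div_le_iff₀ (by linarith), pow_succ]
    nlinarith [mul_pos hp0 hp0]

theorem spreadBound_le {n d : ℕ} (hn : 1 ≤ n) (hm : ∀ c, 1 ≤ m c)
    (hd : ∀ k, ∑ c, (pts k c).card = d) {C : ℝ} (hC : 0 ≤ C) (A : Finset K) :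
    spreadBound pts m n C A ≤ (C * n * (Real.exp 1 / n) ^ d) ^ A.card := by
  have hn' : (0 : ℝ) < n := by exact_mod_cast hn
  rw [mul_pow (C * n), spreadBound]
  refine mul_le_mul_of_nonneg_left ?_ (by positivity)
  rw [← pow_mul, ← sum_load d hd, ← Finset.prod_pow_eq_pow_sum]
  refine Finset.prod_le_prod (fun c _ => by positivity) fun c _ => ?_
  rcases lt_or_ge (m c * n) (load pts A c) with h | h
  · rw [Nat.descFactorial_eq_zero_iff_lt.2 h, Nat.cast_zero, inv_zero]
    positivity
  have h1 := pow_le_exp_mul_descFactorial _ _ h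
  have hpos : (0 : ℝ) < (((m c * n).descFactorial (load pts A c) : ℕ) : ℝ) := by
    rw [Nat.cast_pos, Nat.pos_iff_ne_zero, Ne, Nat.descFactorial_eq_zero_iff_lt, not_lt]
    exact h
  rw [inv_le_comm₀ hpos (by positivity), ← inv_pow, inv_div, div_pow,
    div_le_iff₀ (by positivity)]
  refine le_trans (pow_le_pow_left₀ hn'.le ?_ _) (h1.trans (le_of_eq (mul_comm _ _)))
  exact_mod_cast Nat.le_mul_of_pos_left n (hm c)

end SpreadRecursion

section SplitConcentration

variable {I : Type} [Fintype I] [DecidableEq I] {P : I → Type} [∀ c, DecidableEq (P c)]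
  {m : I → ℕ}

open Classical in
theorem card_boxSplits_filter_le {n : ℕ} {B : ∀ c, Finset (P c)} (c : I)
    (p : Finset (P c) → Prop) {x : ℝ}
    (h : ((((B c).powersetCard (m c * n)).filter p).card : ℝ) ≤
      x * ((B c).powersetCard (m c * n)).card) :
    (((boxSplits m n B).filter fun Q => p (Q c)).card : ℝ) ≤ x * (boxSplits m n B).card := by
  set f : ∀ c, Finset (Finset (P c)) := fun c => (B c).powersetCard (m c * n) with hf
  have e : (boxSplits m n B).filter (fun Q => p (Q c)) =
      Fintype.piFinset (Function.update f c ((f c).filter p)) := by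
    ext Q
    simp only [boxSplits, Finset.mem_filter, Fintype.mem_piFinset]
    constructor
    · rintro ⟨h1, h2⟩ c'
      by_cases hc : c' = c
      · subst hc
        rw [Function.update_self]
        exact Finset.mem_filter.2 ⟨h1 _, h2⟩
      · rw [Function.update_of_ne hc]
        exact h1 c'
    · intro h1
      have hc := h1 c
      rw [Function.update_self, Finset.mem_filter] at hc
      refine ⟨fun c' => ?_, hc.2⟩
      by_cases hc' : c' = c
      · subst hc'
        exact hc.1
      · have := h1 c'
        rwa [Function.update_of_ne hc'] at this
  have e1 : ∏ c', (Function.update f c ((f c).filter p) c').card =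
      ((f c).filter p).card * ∏ c' ∈ Finset.univ.erase c, (f c').card := by
    rw [← Finset.mul_prod_erase _ _ (Finset.mem_univ c), Function.update_self]
    congr 1
    exact Finset.prod_congr rfl fun c' hc' => by
      rw [Function.update_of_ne (Finset.ne_of_mem_erase hc')]
  rw [e, Fintype.card_piFinset, e1, boxSplits, Fintype.card_piFinset,
    ← Finset.mul_prod_erase _ _ (Finset.mem_univ c)]
  push_cast
  rw [← mul_assoc]
  refine mul_le_mul_of_nonneg_right ?_ (Finset.prod_nonneg fun _ _ => Nat.cast_nonneg _)
  convert h using 2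

open Classical in
theorem card_upper_tail_le {V : Type*} (B D : Finset V) (hD : D ⊆ B) {a b : ℕ}
    (hB : B.card = a + b) {η : ℝ} (h0 : 0 ≤ η) (h1 : η ≤ 1) :
    (((B.powersetCard a).filter fun Q =>
        (((B \ Q) ∩ D).card : ℝ) ≤ D.card * b / B.card - η * B.card).card : ℝ) ≤
      (B.card + 1) * Real.exp (-(η ^ 2 * B.card / 4)) * (B.powersetCard a).card := by
  have h := card_lower_tail_le B D hD (k := b) (by omega) h0 h1
  have e : (B.powersetCard b).card = (B.powersetCard a).card := by
    rw [Finset.card_powersetCard, Finset.card_powersetCard, hB, Nat.choose_symm_add]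
  rw [e] at h
  refine le_trans ?_ h
  refine Nat.cast_le.2 (Finset.card_le_card_of_injOn (fun Q => B \ Q) (fun Q hQ => ?_) ?_)
  · obtain ⟨hQ1, hQ2⟩ := Finset.mem_filter.1 (Finset.mem_coe.1 hQ)
    obtain ⟨hQB, hQa⟩ := Finset.mem_powersetCard.1 hQ1
    refine Finset.mem_coe.2 (Finset.mem_filter.2
      ⟨Finset.mem_powersetCard.2 ⟨Finset.sdiff_subset, ?_⟩, hQ2⟩)
    rw [Finset.card_sdiff_of_subset hQB]; omega
  · intro Q hQ Q' hQ' hQQ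
    have h1 := (Finset.mem_powersetCard.1 (Finset.mem_filter.1 (Finset.mem_coe.1 hQ)).1).1
    have h2 := (Finset.mem_powersetCard.1 (Finset.mem_filter.1 (Finset.mem_coe.1 hQ')).1).1
    rw [← Finset.sdiff_sdiff_eq_self h1, ← Finset.sdiff_sdiff_eq_self h2]
    exact congrArg (B \ ·) hQQ

open Classical in
/-- Most splits of a box halve all sets of a given family almost evenly. -/
theorem exists_even_splits {θ : Type*} (τ : Finset θ) (cl : θ → I) {s n₁ n₂ : ℕ}
    {B : ∀ c, Finset (P c)} (hB : ∀ c, (B c).card = m c * (n₁ + n₂)) (hs : ∀ a ∈ τ, m (cl a) = s)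
    (D : ∀ a : θ, Finset (P (cl a))) (hD : ∀ a, D a ⊆ B (cl a)) (hpos : 0 < s * (n₁ + n₂))
    {η x : ℝ} (h0 : 0 ≤ η) (h1 : η ≤ 1)
    (hx : 2 * τ.card * ((s * (n₁ + n₂) : ℕ) + 1) *
      Real.exp (-(η ^ 2 * (s * (n₁ + n₂) : ℕ) / 4)) ≤ x) :
    ∃ G ⊆ boxSplits m n₁ B, (1 - x) * (boxSplits m n₁ B).card ≤ G.card ∧
      ∀ Q ∈ G, ∀ a ∈ τ,
        ((D a).card * n₁ / (n₁ + n₂ : ℕ) - η * (s * (n₁ + n₂) : ℕ) ≤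
          ((Q (cl a) ∩ D a).card : ℝ)) ∧
        ((D a).card * n₂ / (n₁ + n₂ : ℕ) - η * (s * (n₁ + n₂) : ℕ) ≤
          (((B (cl a) \ Q (cl a)) ∩ D a).card : ℝ)) := by
  set N := s * (n₁ + n₂) with hN
  set bad₁ : θ → Finset (∀ c, Finset (P c)) := fun a => (boxSplits m n₁ B).filter fun Q =>
    ((Q (cl a) ∩ D a).card : ℝ) ≤ (D a).card * n₁ / (n₁ + n₂ : ℕ) - η * N with hb₁
  set bad₂ : θ → Finset (∀ c, Finset (P c)) := fun a => (boxSplits m n₁ B).filter fun Q =>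
    (((B (cl a) \ Q (cl a)) ∩ D a).card : ℝ) ≤ (D a).card * n₂ / (n₁ + n₂ : ℕ) - η * N with hb₂
  set e : ℝ := (N + 1) * Real.exp (-(η ^ 2 * N / 4)) with he
  have hratio : ∀ k : ℕ, ∀ d : ℝ, d * (s * k : ℕ) / N = d * k / (n₁ + n₂ : ℕ) := by
    intro k d
    have hs0 : (s : ℝ) ≠ 0 := by
      have := Nat.pos_of_mul_pos_right hpos
      positivity
    rw [hN]; push_cast
    rw [show d * (s * k) = s * (d * k) by ring, mul_div_mul_left _ _ hs0]
  have hcardB : ∀ a ∈ τ, (B (cl a)).card = N := fun a ha => by rw [hB, hs a ha]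
  have hbad₁ : ∀ a ∈ τ, ((bad₁ a).card : ℝ) ≤ e * (boxSplits m n₁ B).card := by
    intro a ha
    refine card_boxSplits_filter_le (cl a) (fun q => ((q ∩ D a).card : ℝ) ≤
      (D a).card * n₁ / (n₁ + n₂ : ℕ) - η * N) ?_
    have := card_lower_tail_le (B (cl a)) (D a) (hD a) (k := m (cl a) * n₁)
      (by rw [hB, mul_add]; omega) h0 h1
    rw [hcardB a ha, hs a ha, hratio] at this
    rw [hs a ha]
    convert this
  have hbad₂ : ∀ a ∈ τ, ((bad₂ a).card : ℝ) ≤ e * (boxSplits m n₁ B).card := by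
    intro a ha
    refine card_boxSplits_filter_le (cl a) (fun q => (((B (cl a) \ q) ∩ D a).card : ℝ) ≤
      (D a).card * n₂ / (n₁ + n₂ : ℕ) - η * N) ?_
    have := card_upper_tail_le (B (cl a)) (D a) (hD a) (a := m (cl a) * n₁) (b := m (cl a) * n₂)
      (by rw [hB, mul_add]) h0 h1
    rw [hcardB a ha, hs a ha, hratio] at this
    rw [hs a ha]
    convert this
  set bad := (τ.biUnion bad₁) ∪ τ.biUnion bad₂ with hbad
  have hbadsub : bad ⊆ boxSplits m n₁ B :=
    Finset.union_subset (Finset.biUnion_subset.2 fun a _ => Finset.filter_subset _ _)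
      (Finset.biUnion_subset.2 fun a _ => Finset.filter_subset _ _)
  have hbadcard : (bad.card : ℝ) ≤ x * (boxSplits m n₁ B).card := by
    have hsum : ∀ bd : θ → Finset (∀ c, Finset (P c)),
        (∀ a ∈ τ, ((bd a).card : ℝ) ≤ e * (boxSplits m n₁ B).card) →
        ((τ.biUnion bd).card : ℝ) ≤ τ.card * (e * (boxSplits m n₁ B).card) := by
      intro bd hbd
      calc ((τ.biUnion bd).card : ℝ) ≤ ∑ a ∈ τ, ((bd a).card : ℝ) := by
            exact_mod_cast Finset.card_biUnion_le
        _ ≤ _ := by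
            rw [← nsmul_eq_mul]
            exact Finset.sum_le_card_nsmul _ _ _ hbd
    calc (bad.card : ℝ) ≤ (τ.biUnion bad₁).card + (τ.biUnion bad₂).card := by
          exact_mod_cast Finset.card_union_le _ _
      _ ≤ τ.card * (e * (boxSplits m n₁ B).card) + τ.card * (e * (boxSplits m n₁ B).card) :=
          add_le_add (hsum _ hbad₁) (hsum _ hbad₂)
      _ = (2 * τ.card * (N + 1) * Real.exp (-(η ^ 2 * N / 4))) * (boxSplits m n₁ B).card := by
          rw [he]; ring
      _ ≤ _ := mul_le_mul_of_nonneg_right hx (by positivity)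
  refine ⟨boxSplits m n₁ B \ bad, Finset.sdiff_subset, ?_, fun Q hQ a ha => ?_⟩
  · rw [Finset.card_sdiff_of_subset hbadsub, Nat.cast_sub (Finset.card_le_card hbadsub)]
    linarith
  · obtain ⟨hQ1, hQ2⟩ := Finset.mem_sdiff.1 hQ
    rw [hbad, Finset.mem_union, not_or] at hQ2
    constructor <;> by_contra! hlt
    · exact hQ2.1 (Finset.mem_biUnion.2 ⟨a, ha, Finset.mem_filter.2 ⟨hQ1, hlt.le⟩⟩)
    · exact hQ2.2 (Finset.mem_biUnion.2 ⟨a, ha, Finset.mem_filter.2 ⟨hQ1, hlt.le⟩⟩)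

end SplitConcentration

theorem exists_split_threshold {A α : ℝ} (hA : 0 ≤ A) (hα : 0 < α) :
    ∃ M : ℕ, ∀ m₀ : ℕ, M ≤ m₀ → ∀ k n : ℕ, m₀ * 2 ^ (k + 1) ≤ n → n ≤ m₀ * 2 ^ (k + 2) →
      A * (n : ℝ) ^ 3 * Real.exp (-((α * (9 / 10) ^ k / 60) ^ 2 * n / 4)) ≤ (9 / 10) ^ k / 20 := by
  set κ : ℝ := α ^ 2 / 7200 with hκ
  have hκ0 : 0 < κ := by positivity
  obtain ⟨M, hM⟩ := exists_nat_ge (A * 153600 / κ ^ 5)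
  refine ⟨M + 1, fun m₀ hm₀ k n h1 h2 => ?_⟩
  have hm1 : (1 : ℝ) ≤ m₀ := by exact_mod_cast (by omega : 1 ≤ m₀)
  have hmM : A * 153600 / κ ^ 5 ≤ m₀ := hM.trans (by exact_mod_cast (by omega : M ≤ m₀))
  set x : ℝ := (81 / 50) ^ k with hx
  have hx0 : 0 < x := by positivity
  have h1' : (m₀ : ℝ) * 2 ^ (k + 1) ≤ n := by exact_mod_cast h1
  have h2' : (n : ℝ) ≤ m₀ * 2 ^ (k + 2) := by exact_mod_cast h2
  set y : ℝ := (α * (9 / 10) ^ k / 60) ^ 2 * n / 4 with hy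
  have hylow : κ * m₀ * x ≤ y := by
    have e : x = ((9 / 10 : ℝ) ^ k) ^ 2 * 2 ^ k := by
      rw [hx, ← pow_mul, mul_comm k 2, pow_mul, ← mul_pow]; norm_num
    calc κ * m₀ * x = (α * (9 / 10) ^ k / 60) ^ 2 * (m₀ * 2 ^ (k + 1)) / 4 := by
          rw [e, hκ, pow_succ]; ring
      _ ≤ y := by rw [hy]; gcongr
  have hy0 : 0 < κ * m₀ * x := by positivity
  have hexp : Real.exp (-y) ≤ 120 / (κ * m₀ * x) ^ 5 := by
    rw [Real.exp_neg, inv_le_comm₀ (Real.exp_pos _) (by positivity), inv_div]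
    refine le_trans ?_ (Real.pow_div_factorial_le_exp y (hy0.le.trans hylow) 5)
    have : ((Nat.factorial 5 : ℕ) : ℝ) = 120 := by norm_num [Nat.factorial]
    rw [this]
    gcongr
  have hn3 : (n : ℝ) ^ 3 ≤ 64 * m₀ ^ 3 * ((9 / 10) ^ k * x ^ 5) := by
    have e : (n : ℝ) ^ 3 ≤ (m₀ * 2 ^ (k + 2)) ^ 3 := pow_le_pow_left₀ (by positivity) h2' 3
    have e8 : ((2 : ℝ) ^ k) ^ 3 ≤ (9 / 10) ^ k * x ^ 5 := by
      rw [hx, ← pow_mul, ← pow_mul, mul_comm k 3, mul_comm k 5, pow_mul, pow_mul, ← mul_pow]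
      exact pow_le_pow_left₀ (by norm_num) (by norm_num) _
    calc _ ≤ _ := e
      _ = 64 * m₀ ^ 3 * (2 ^ k) ^ 3 := by rw [pow_add]; ring
      _ ≤ _ := by gcongr
  calc A * (n : ℝ) ^ 3 * Real.exp (-y)
      ≤ A * (64 * m₀ ^ 3 * ((9 / 10) ^ k * x ^ 5)) * (120 / (κ * m₀ * x) ^ 5) := by gcongr
    _ = (A * 153600 / κ ^ 5) / m₀ ^ 2 * ((9 / 10) ^ k / 20) := by field_simp; ring
    _ ≤ 1 * ((9 / 10) ^ k / 20) := by
        refine mul_le_mul_of_nonneg_right ?_ (by positivity)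
        rw [div_le_one (by positivity)]
        nlinarith
    _ = _ := one_mul _

section ColouredCopies

/-- The points available to a coloured copy: colours, and vertices of each part. -/
def ClassPts (r : ℕ) (Col W : Type) : Option (Fin r) → Type
  | none => Col
  | some _ => W

noncomputable instance (r : ℕ) (Col W : Type) (c : Option (Fin r)) :
    DecidableEq (ClassPts r Col W c) := Classical.decEq _

/-- A rainbow copy, in the system `H`, of the graph with edge set `E`. -/
structure ColouredCopy {s r : ℕ} (E : Finset (Sym2 (Fin s))) {Col W : Type}
    (H : Col → SimpleGraph (Fin r × W)) where
  vert : Fin s → Fin r × W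
  col : {e // e ∈ E} → Col
  vert_injective : Function.Injective vert
  col_injective : Function.Injective col
  mem_edgeSet : ∀ e, Sym2.map vert e.1 ∈ (H (col e)).edgeSet

variable {s r : ℕ} {E : Finset (Sym2 (Fin s))} {Col W : Type} {H : Col → SimpleGraph (Fin r × W)}

theorem ColouredCopy.ext' {k k' : ColouredCopy E H} (h1 : k.vert = k'.vert) (h2 : k.col = k'.col) :
    k = k' := by
  cases k; cases k'; simp only at h1 h2; subst h1; subst h2; rfl

noncomputable instance : DecidableEq (ColouredCopy E H) := Classical.decEq _

/-- The points of class `c` used by a coloured copy. -/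
noncomputable def copyPts (k : ColouredCopy E H) : ∀ c, Finset (ClassPts r Col W c)
  | none => @Finset.image _ Col (Classical.decEq _) k.col Finset.univ
  | some i => @Finset.image _ W (Classical.decEq _) (fun a => (k.vert a).2)
      (Finset.univ.filter fun a => (k.vert a).1 = i)

theorem mem_copyPts_none {k : ColouredCopy E H} {x : Col} :
    x ∈ (copyPts k none : Finset Col) ↔ ∃ e, k.col e = x :=
  (@Finset.mem_image _ Col (Classical.decEq _) _ _ _).trans (by simp only [Finset.mem_univ, true_and])

theorem mem_copyPts_some {k : ColouredCopy E H} {i : Fin r} {x : W} :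
    x ∈ (copyPts k (some i) : Finset W) ↔ ∃ a, k.vert a = (i, x) :=
  (@Finset.mem_image _ W (Classical.decEq _) _ _ _).trans (by
    simp only [Finset.mem_filter, Finset.mem_univ, true_and, Prod.ext_iff])

theorem sum_card_copyPts (k : ColouredCopy E H) :
    ∑ c, (copyPts k c).card = s + E.card := by
  classical
  rw [Fintype.sum_option, add_comm s]
  congr 1
  · exact (Finset.card_image_of_injective _ k.col_injective).trans (by simp)
  · have h1 : ∀ i : Fin r, (copyPts k (some i)).card =
        (Finset.univ.filter fun a => (k.vert a).1 = i).card := fun i => by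
      refine Eq.trans ?_ (Finset.card_image_of_injOn (f := fun a => (k.vert a).2) ?_)
      · congr!
      · intro a ha b hb hab
        refine k.vert_injective (Prod.ext ?_ hab)
        rw [(Finset.mem_filter.1 (Finset.mem_coe.1 ha)).2, (Finset.mem_filter.1 (Finset.mem_coe.1 hb)).2]
    rw [Finset.sum_congr rfl fun i _ => h1 i,
      ← Finset.card_eq_sum_card_fiberwise (fun a _ => Finset.mem_coe.2 (Finset.mem_univ (k.vert a).1))]
    simp

theorem exists_copyPts_nonempty (hs : 0 < s) (k : ColouredCopy E H) :
    ∃ c, (copyPts k c).Nonempty :=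
  ⟨some (k.vert ⟨0, hs⟩).1, (k.vert ⟨0, hs⟩).2, mem_copyPts_some.2 ⟨_, rfl⟩⟩

/-- Class sizes, as multiples of `n`: `t * r` for colours, `s` for each part. -/
def classMul (r s t : ℕ) : Option (Fin r) → ℕ
  | none => t * r
  | some _ => s

open Classical in
/-- Every pair of parts of the box `B` has minimum degree at least `d` in each colour of `B`. -/
def BoxMinDeg (H : Col → SimpleGraph (Fin r × W)) (d : ℝ) (B : ∀ c, Finset (ClassPts r Col W c)) :
    Prop :=
  ∀ c ∈ (B none : Finset Col), ∀ i j : Fin r, i ≠ j → ∀ v ∈ (B (some i) : Finset W),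
    d ≤ (((B (some j) : Finset W).filter fun w => (H c).Adj (i, v) (j, w)).card : ℝ)

/-- Balanced systems of minimum degree at least `d` on `n`-fold classes have transversal factors. -/
def DiracForces (r s t : ℕ) (F : SimpleGraph (Fin s)) (n : ℕ) (d : ℝ) : Prop :=
  ∀ Hs : Fin (t * r * n) → SimpleGraph (Fin r × Fin (s * n)),
    (∀ i, ∀ a b : Fin r × Fin (s * n), a.1 = b.1 → ¬ (Hs i).Adj a b) →
    (∀ i' : Fin (t * r * n), ∀ i j : Fin r, i ≠ j → ∀ v : Fin (s * n),
      d ≤ ((@Finset.filter _ (fun w => (Hs i').Adj (i, v) (j, w))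
        (fun _ => Classical.propDecidable _) Finset.univ).card : ℝ)) →
    HasTransversalFactorSG F Hs (r * n)

open Classical in
theorem exists_isTiling_of_diracForces {t n : ℕ} {F : SimpleGraph (Fin s)} {d : ℝ}
    (hs : 0 < s) (hF : DiracForces r s t F n d) {H : Col → SimpleGraph (Fin r × W)}
    (hpart : ∀ c, ∀ a b : Fin r × W, a.1 = b.1 → ¬ (H c).Adj a b)
    {B : ∀ c, Finset (ClassPts r Col W c)} (hB : ∀ c, (B c).card = classMul r s t c * n)
    (hdeg : BoxMinDeg H d B) :
    ∃ S : Finset (ColouredCopy F.edgeFinset H), IsTiling copyPts (r * n) B S := by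
  have eC : Fin (t * r * n) ≃ {x // x ∈ (B none : Finset Col)} :=
    (Finset.equivFinOfCardEq (s := (B none : Finset Col)) (hB none)).symm
  have eV : ∀ i : Fin r, Fin (s * n) ≃ {x // x ∈ (B (some i) : Finset W)} := fun i =>
    (Finset.equivFinOfCardEq (s := (B (some i) : Finset W)) (hB (some i))).symm
  set g : Fin r × Fin (s * n) → Fin r × W := fun x => (x.1, (eV x.1 x.2).1) with hg
  have hginj : Function.Injective g := by
    rintro ⟨i, x⟩ ⟨j, y⟩ h
    obtain ⟨h1, h2⟩ := Prod.ext_iff.1 h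
    simp only [hg] at h1 h2
    subst h1
    rw [(eV i).injective (Subtype.ext h2)]
  obtain ⟨φ, hφ1, hφ2, c, hc, hφ3⟩ := hF (fun c => (H (eC c).1).comap g)
    (fun c a b hab => hpart _ _ _ hab) (fun c i j hij v => by
      refine (hdeg _ (eC c).2 i j hij _ (eV i v).2).trans (Nat.cast_le.2 ?_)
      refine Finset.card_le_card_of_surjOn (fun w => ((eV j w).1 : W)) fun w hw => ?_
      obtain ⟨hw1, hw2⟩ := Finset.mem_filter.1 (Finset.mem_coe.1 hw)
      refine ⟨(eV j).symm ⟨w, hw1⟩, ?_, by simp⟩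
      simp only [Finset.coe_filter, Finset.mem_univ, true_and, Set.mem_ofPred_eq,
        SimpleGraph.comap_adj, hg, Equiv.apply_symm_apply]
      exact hw2)
  set k : Fin (r * n) → ColouredCopy F.edgeFinset H := fun j =>
    { vert := fun a => g (φ j a)
      col := fun e => (eC (c (j, e))).1
      vert_injective := hginj.comp (hφ1 j)
      col_injective := fun e e' h =>
        (Prod.ext_iff.1 (hc.1 (eC.injective (Subtype.ext h)))).2
      mem_edgeSet := fun e => by
        have := hφ3 j e
        revert this
        obtain ⟨e, he⟩ := e
        induction e using Sym2.ind with
        | _ a b => exact fun h => h } with hk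
  have hdisj : ∀ j j', j ≠ j' → ∀ c, Disjoint (copyPts (k j) c) (copyPts (k j') c) := by
    intro j j' hjj c'
    refine Finset.disjoint_left.2 fun x hx hx' => ?_
    rcases c' with _ | i
    · obtain ⟨e, he⟩ := mem_copyPts_none.1 hx
      obtain ⟨e', he'⟩ := mem_copyPts_none.1 hx'
      exact hjj (Prod.ext_iff.1 (hc.1 (eC.injective (Subtype.ext (he.trans he'.symm))))).1
    · obtain ⟨a, ha⟩ := mem_copyPts_some.1 hx
      obtain ⟨b, hb⟩ := mem_copyPts_some.1 hx'
      exact hφ2 j j' hjj a b (hginj (ha.trans hb.symm))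
  have hkinj : Function.Injective k := by
    intro j j' h
    by_contra hne
    obtain ⟨c', hc'⟩ := exists_copyPts_nonempty hs (k j)
    have := hdisj j j' hne c'
    rw [← h, disjoint_self] at this
    exact hc'.ne_empty this
  refine ⟨Finset.univ.image k, ?_, ?_, ?_⟩
  · intro k' hk' c'
    obtain ⟨j, _, rfl⟩ := Finset.mem_image.1 hk'
    intro x hx
    rcases c' with _ | i
    · obtain ⟨e, he⟩ := mem_copyPts_none.1 hx
      rw [← he]
      exact (eC (c (j, e))).2
    · obtain ⟨a, ha⟩ := mem_copyPts_some.1 hx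
      obtain ⟨h1, h2⟩ := Prod.ext_iff.1 ha
      simp only [hk, hg] at h1 h2
      subst h1
      rw [← h2]
      exact (eV _ _).2
  · intro k₁ h₁ k₂ h₂ hne c'
    obtain ⟨j, _, rfl⟩ := Finset.mem_image.1 h₁
    obtain ⟨j', _, rfl⟩ := Finset.mem_image.1 h₂
    exact hdisj j j' (fun h => hne (h ▸ rfl)) c'
  · rw [Finset.card_image_of_injective _ hkinj]
    simp

end ColouredCopies

section SpreadFromDirac

theorem exists_diracForces {r s t : ℕ} (hr : 2 ≤ r) (hs : 0 < s) (ht : 0 < t)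
    (F : SimpleGraph (Fin s)) {γ : ℝ} (hγ : 0 < γ) :
    ∃ n₀ : ℕ, ∀ n : ℕ, n₀ ≤ n →
      DiracForces r s t F n ((multipartiteTransversalDirac r s t F + γ) * (s * n : ℕ)) := by
  classical
  obtain ⟨δ, hδ, hlt⟩ := exists_lt_of_csInf_lt (s := {δ : ℝ | ∀ α : ℝ, 0 < α → ∃ n₀ : ℕ, ∀ n : ℕ,
    n₀ ≤ n → DiracForces r s t F n ((δ + α) * (s * n : ℕ))}) ⟨1, fun α hα => ⟨1, fun n hn Hs _ hd => by
      exfalso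
      have hsn : 0 < s * n := Nat.mul_pos hs hn
      have h := hd ⟨0, Nat.mul_pos (Nat.mul_pos ht (by omega)) hn⟩ ⟨0, by omega⟩ ⟨1, by omega⟩
        (by simp) ⟨0, hsn⟩
      have h2 := h.trans (Nat.cast_le.2 (Finset.card_le_univ _))
      rw [Fintype.card_fin] at h2
      have : (0 : ℝ) < (s * n : ℕ) := by exact_mod_cast hsn
      nlinarith⟩⟩
    (show multipartiteTransversalDirac r s t F < multipartiteTransversalDirac r s t F + γ / 2 by
      linarith)
  obtain ⟨n₀, hn₀⟩ := hδ (γ / 2) (by positivity)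
  refine ⟨n₀, fun n hn Hs hp hd => hn₀ n hn Hs hp fun i' i j hij v => le_trans ?_ (hd i' i j hij v)⟩
  exact mul_le_mul_of_nonneg_right (by linarith) (Nat.cast_nonneg _)

open Classical in
theorem exists_boxMinDeg_splits {r s t : ℕ} (hs : 0 < s) {Col W : Type}
    {H : Col → SimpleGraph (Fin r × W)} {B : ∀ c, Finset (ClassPts r Col W c)} {n₁ n₂ : ℕ}
    (hB : ∀ c, (B c).card = classMul r s t c * (n₁ + n₂)) (h₁ : n₁ + n₂ ≤ 3 * n₁)
    (h₂ : n₁ + n₂ ≤ 3 * n₂) (hn : 0 < n₁ + n₂) {η x d : ℝ} (hη0 : 0 ≤ η) (hη1 : η ≤ 1)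
    (hx : (4 * t * r ^ 4 * s ^ 2 : ℝ) * (n₁ + n₂ : ℕ) ^ 3 *
      Real.exp (-(η ^ 2 * (n₁ + n₂ : ℕ) / 4)) ≤ x)
    (hdeg : BoxMinDeg H ((d + 3 * η) * (s * (n₁ + n₂) : ℕ)) B) :
    ∃ G ⊆ boxSplits (classMul r s t) n₁ B,
      (1 - x) * (boxSplits (classMul r s t) n₁ B).card ≤ G.card ∧
      ∀ Q ∈ G, BoxMinDeg H (d * (s * n₁ : ℕ)) Q ∧
        BoxMinDeg H (d * (s * n₂ : ℕ)) fun c => B c \ Q c := by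
  set n := n₁ + n₂ with hnn
  have hn' : (1 : ℝ) ≤ n := by exact_mod_cast hn
  have hs' : (1 : ℝ) ≤ s := by exact_mod_cast hs
  obtain ⟨BC, hBC⟩ : ∃ BC : Finset Col, BC = B none := ⟨_, rfl⟩
  obtain ⟨BV, hBV⟩ : ∃ BV : Fin r → Finset W, ∀ i, BV i = B (some i) := ⟨_, fun _ => rfl⟩
  have hBCc : BC.card = t * r * n := by rw [hBC]; exact hB none
  have hBVc : ∀ i, (BV i).card = s * n := fun i => by rw [hBV]; exact hB (some i)
  set τ : Finset (Col × Fin r × Fin r × W) := BC ×ˢ Finset.univ ×ˢ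
    Finset.univ ×ˢ (Finset.univ.biUnion BV) with hτ
  have hτcard : (τ.card : ℝ) ≤ t * r * n * (r * (r * (r * (s * n)))) := by
    have h1 : (Finset.univ.biUnion BV).card ≤ r * (s * n) := by
      refine (Finset.card_biUnion_le_card_mul _ _ (s * n) fun i _ => (hBVc i).le).trans ?_
      simp
    have h2 : τ.card ≤ t * r * n * (r * (r * (r * (s * n)))) := by
      rw [hτ, Finset.card_product, Finset.card_product, Finset.card_product, Finset.card_univ,
        Fintype.card_fin]
      exact Nat.mul_le_mul hBCc.le (Nat.mul_le_mul_left _ (Nat.mul_le_mul_left _ h1))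
    exact_mod_cast h2
  have hx' : 2 * (τ.card : ℝ) * ((s * n : ℕ) + 1) * Real.exp (-(η ^ 2 * (s * n : ℕ) / 4)) ≤ x := by
    refine le_trans ?_ hx
    have e1 : Real.exp (-(η ^ 2 * (s * n : ℕ) / 4)) ≤ Real.exp (-(η ^ 2 * n / 4)) := by
      refine Real.exp_le_exp.2 (neg_le_neg (div_le_div_of_nonneg_right
        (mul_le_mul_of_nonneg_left ?_ (sq_nonneg _)) (by norm_num)))
      exact_mod_cast Nat.le_mul_of_pos_left n hs
    have e2 : ((s * n : ℕ) : ℝ) + 1 ≤ 2 * (s * n) := by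
      push_cast
      nlinarith
    calc _ ≤ 2 * (t * r * n * (r * (r * (r * (s * n)))) : ℝ) * (2 * (s * n)) *
          Real.exp (-(η ^ 2 * n / 4)) := by gcongr
      _ = _ := by ring
  obtain ⟨G, hG, hGc, hGG⟩ := exists_even_splits (m := classMul r s t) τ
    (fun a => some a.2.2.1) hB (s := s) (fun a _ => rfl)
    (fun a => (B (some a.2.2.1) : Finset W).filter fun w => (H a.1).Adj (a.2.1, a.2.2.2) (a.2.2.1, w))
    (fun a => Finset.filter_subset _ _) (Nat.mul_pos hs hn) hη0 hη1 hx'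
  have hQB : ∀ Q ∈ G, ∀ c, Q c ⊆ B c := fun Q hQ c =>
    (Finset.mem_powersetCard.1 (Fintype.mem_piFinset.1 (hG hQ) c)).1
  have harith : ∀ D : ℝ, (d + 3 * η) * (s * n : ℕ) ≤ D → ∀ n' : ℕ, n ≤ 3 * n' →
      d * (s * n' : ℕ) ≤ D * n' / n - η * (s * n : ℕ) := by
    intro D hD n' hn3
    have h3 : (n : ℝ) ≤ 3 * n' := by exact_mod_cast hn3
    have e : (d + 3 * η) * (s * n' : ℕ) ≤ D * n' / n := by
      rw [le_div_iff₀ (by linarith)]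
      calc _ = ((d + 3 * η) * (s * n : ℕ)) * n' := by push_cast; ring
        _ ≤ _ := mul_le_mul_of_nonneg_right hD (Nat.cast_nonneg _)
    have e2 : η * (s * n : ℕ) ≤ 3 * η * (s * n' : ℕ) := by
      push_cast
      have := mul_le_mul_of_nonneg_left h3 (mul_nonneg hη0 (by linarith : (0 : ℝ) ≤ s))
      linarith
    linarith
  have hmem : ∀ (c : Col), c ∈ BC → ∀ (i j : Fin r) (v : W), v ∈ BV i → (c, i, j, v) ∈ τ :=
    fun c hc i j v hv => by
      simp only [hτ, Finset.mem_product, Finset.mem_univ, true_and, Finset.mem_biUnion]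
      exact ⟨hc, i, hv⟩
  refine ⟨G, hG, hGc, fun Q hQ => ⟨fun c hc i j hij v hv => ?_, fun c hc i j hij v hv => ?_⟩⟩
  · have hcB := hQB Q hQ none hc
    have hvB := hQB Q hQ (some i) hv
    have h := (hGG Q hQ _ (hmem c (hBC ▸ hcB) i j v (hBV i ▸ hvB))).1
    refine ((harith _ (hdeg c hcB i j hij v hvB) n₁ h₁).trans h).trans (Nat.cast_le.2 ?_)
    refine Finset.card_le_card fun w hw => ?_
    obtain ⟨hw1, hw2⟩ := Finset.mem_inter.1 hw
    exact Finset.mem_filter.2 ⟨hw1, (Finset.mem_filter.1 hw2).2⟩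
  · have hcB := (Finset.mem_sdiff.1 hc).1
    have hvB := (Finset.mem_sdiff.1 hv).1
    have h := (hGG Q hQ _ (hmem c (hBC ▸ hcB) i j v (hBV i ▸ hvB))).2
    refine ((harith _ (hdeg c hcB i j hij v hvB) n₂ h₂).trans h).trans (Nat.cast_le.2 ?_)
    refine Finset.card_le_card fun w hw => ?_
    obtain ⟨hw1, hw2⟩ := Finset.mem_inter.1 hw
    exact Finset.mem_filter.2 ⟨hw1, (Finset.mem_filter.1 hw2).2⟩

open Classical in
theorem exists_spread_factors {r s t : ℕ} (hr : 2 ≤ r) (hs : 0 < s) (ht : 0 < t)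
    {F : SimpleGraph (Fin s)} (hF : F.edgeFinset.card = t) {α : ℝ} (hα : 0 < α) (hα1 : α ≤ 1) :
    ∃ C : ℝ, 0 < C ∧ ∃ n₀ : ℕ, ∀ n : ℕ, n₀ ≤ n → ∀ (Col W : Type)
      (H : Col → SimpleGraph (Fin r × W)) (B : ∀ c, Finset (ClassPts r Col W c)),
      (∀ c, ∀ a b : Fin r × W, a.1 = b.1 → ¬ (H c).Adj a b) →
      (∀ c, (B c).card = classMul r s t c * n) →
      BoxMinDeg H ((multipartiteTransversalDirac r s t F + α) * (s * n : ℕ)) B →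
      ∃ (ι : Type) (_ : Fintype ι) (w : ι → ℝ) (S : ι → Finset (ColouredCopy F.edgeFinset H)),
        (∀ i, 0 ≤ w i) ∧ ∑ i, w i = 1 ∧ (∀ i, IsTiling copyPts (r * n) B (S i)) ∧
        ∀ A, ∑ i, (if A ⊆ S i then w i else 0) ≤
          (C * n * (1 / (n : ℝ)) ^ (s + t)) ^ A.card := by
  set δ := multipartiteTransversalDirac r s t F with hδ
  obtain ⟨n₁, hn₁⟩ := exists_diracForces hr hs ht F (half_pos hα)
  obtain ⟨M, hM⟩ := exists_split_threshold (A := (4 * t * r ^ 4 * s ^ 2 : ℝ)) (by positivity) hα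
  set m₀ := n₁ + M + 1 with hm₀
  set N := (t * r + s) * (2 * m₀) with hN
  set β : ℕ → ℝ := fun k => α * (1 - (9 / 10 : ℝ) ^ k / 2) with hβ
  have hlev (Col W : Type) (H : Col → SimpleGraph (Fin r × W))
      (hpart : ∀ c, ∀ a b : Fin r × W, a.1 = b.1 → ¬ (H c).Adj a b) :=
    hasSpreadTiling_of_levels (pts := copyPts (E := F.edgeFinset) (H := H))
      (m := classMul r s t) (R := r) (m₀ := m₀) (M := N) (d := s + t) (by omega)
      (exists_copyPts_nonempty hs) (fun k => by rw [sum_card_copyPts, hF])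
      (fun c => Nat.mul_le_mul_right _ (by cases c <;> simp [classMul]))
      (fun k n B => BoxMinDeg H ((δ + β k) * (s * n : ℕ)) B)
      (fun n B h1 h2 hB hd => exists_isTiling_of_diracForces hs (hn₁ n (by omega)) hpart hB (by
        convert hd using 3
        simp only [hβ, pow_zero]; ring))
      (fun k n B h1 h2 hB hd => by
        have hn2 : n / 2 + (n - n / 2) = n := by omega
        have hn1 : 2 ≤ n := by
          refine le_trans ?_ h1
          calc 2 = 1 * 2 ^ 1 := by norm_num
            _ ≤ m₀ * 2 ^ (k + 1) := Nat.mul_le_mul (by omega)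
              (Nat.pow_le_pow_right (by norm_num) (by omega))
        have hp0 : (0 : ℝ) < (9 / 10 : ℝ) ^ k := by positivity
        have hp1 : (9 / 10 : ℝ) ^ k ≤ 1 := pow_le_one₀ (by norm_num) (by norm_num)
        refine exists_boxMinDeg_splits hs (by rwa [hn2]) (by omega) (by omega) (by omega)
          (η := α * (9 / 10) ^ k / 60) (by positivity) (by nlinarith) ?_ ?_
        · rw [hn2]
          exact hM m₀ (by omega) k n h1 h2
        · rw [hn2]
          have e : δ + β k + 3 * (α * (9 / 10) ^ k / 60) = δ + β (k + 1) := by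
            simp only [hβ, pow_succ]; ring
          rw [e]
          exact hd)
  refine ⟨(N : ℝ) ^ (s + t) * 2 * Real.exp 1 ^ (s + t), by positivity, m₀,
    fun n hn Col W H B hpart hB hd => ?_⟩
  have hm0 : 0 < m₀ := by omega
  set k := Nat.log 2 (n / m₀) with hk
  have hdiv : n / m₀ ≠ 0 := by
    have := Nat.div_pos hn hm0
    omega
  have hk1 : m₀ * 2 ^ k ≤ n := by
    rw [mul_comm]
    exact (Nat.le_div_iff_mul_le hm0).1 (Nat.pow_log_le_self 2 hdiv)
  have hk2 : n ≤ m₀ * 2 ^ (k + 1) := by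
    rw [mul_comm]
    exact ((Nat.div_lt_iff_lt_mul hm0).1 (Nat.lt_pow_succ_log_self (by norm_num) _)).le
  have hp0 : (0 : ℝ) < (9 / 10 : ℝ) ^ k := by positivity
  have hp1 : (9 / 10 : ℝ) ^ k ≤ 1 := pow_le_one₀ (by norm_num) (by norm_num)
  obtain ⟨ι, f, w, S, hw, hw1, hS, hb⟩ := hlev Col W H hpart k n B hk1 hk2 hB
    (fun c hc i j hij v hv => le_trans (mul_le_mul_of_nonneg_right (by
      simp only [hβ]; nlinarith) (Nat.cast_nonneg _)) (hd c hc i j hij v hv))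
  refine ⟨ι, f, w, S, hw, hw1, hS, fun A => ?_⟩
  have hC0 : 0 ≤ (N : ℝ) ^ (s + t) * (2 - (9 / 10 : ℝ) ^ k) :=
    mul_nonneg (by positivity) (by linarith)
  refine le_trans ?_ ((hb A).trans ((spreadBound_le (hm0.trans_le hn) (fun c => ?_)
    (fun k => by rw [sum_card_copyPts, hF]) hC0 A).trans ?_))
  · exact le_of_eq (Finset.sum_congr rfl fun i _ => by congr)
  · cases c
    · exact Nat.mul_pos ht (by omega)
    · exact hs
  · refine pow_le_pow_left₀ (by positivity) ?_ _
    have e1 : (Real.exp 1 / n) ^ (s + t) = Real.exp 1 ^ (s + t) * ((n : ℝ) ^ (s + t))⁻¹ := by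
      rw [div_pow, div_eq_mul_inv]
    have e2 : (1 / (n : ℝ)) ^ (s + t) = ((n : ℝ) ^ (s + t))⁻¹ := by rw [one_div, inv_pow]
    rw [e1, e2]
    calc (N : ℝ) ^ (s + t) * (2 - (9 / 10 : ℝ) ^ k) * n * (Real.exp 1 ^ (s + t) * ((n : ℝ) ^ (s + t))⁻¹)
        ≤ (N : ℝ) ^ (s + t) * 2 * n * (Real.exp 1 ^ (s + t) * ((n : ℝ) ^ (s + t))⁻¹) := by
          gcongr; linarith
      _ = _ := by ring

end SpreadFromDirac

section CopyEdges

theorem prod_coin_eq {β : Type*} (p : ℝ) (E : Finset β) (f : {e // e ∈ E} → Bool) :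
    ∏ e, coin p (f e) =
      p ^ ((Finset.univ.filter fun e => f e = true).map (Function.Embedding.subtype _)).card *
        (1 - p) ^ (E.card -
          ((Finset.univ.filter fun e => f e = true).map (Function.Embedding.subtype _)).card) := by
  simp only [coin, Finset.prod_ite, Finset.prod_const, Finset.card_map]
  congr 2
  have := Finset.card_filter_add_card_filter_not (s := (Finset.univ : Finset {e // e ∈ E}))
    (fun e => f e = true)
  rw [Finset.card_univ, Fintype.card_coe] at this
  omega

theorem sum_powerset_eq_prodExp {M : ℕ} {β : Type*} [DecidableEq β] (E : Fin M → Finset β)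
    (p : ℝ) (φ : (Fin M → Finset β) → ℝ) :
    ∑ σ ∈ Fintype.piFinset fun i => (E i).powerset,
        (∏ i, p ^ (σ i).card * (1 - p) ^ ((E i).card - (σ i).card)) * φ σ =
      prodExp (coin p) fun g : (Σ i, {e // e ∈ E i}) → Bool =>
        φ fun i => (Finset.univ.filter fun e => g ⟨i, e⟩ = true).map
          (Function.Embedding.subtype _) := by
  rw [prodExp]
  symm
  refine Finset.sum_bij (fun g _ i => (Finset.univ.filter fun e => g ⟨i, e⟩ = true).map
    (Function.Embedding.subtype _)) ?_ ?_ ?_ ?_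
  · intro g _
    refine Fintype.mem_piFinset.2 fun i => Finset.mem_powerset.2 fun x hx => ?_
    obtain ⟨e, _, rfl⟩ := Finset.mem_map.1 hx
    exact e.2
  · intro g _ g' _ h
    funext ⟨i, e⟩
    have hi := Finset.map_injective _ (congrFun h i)
    have := Finset.ext_iff.1 hi e
    simp only [Finset.mem_filter, Finset.mem_univ, true_and] at this
    exact Bool.eq_iff_iff.2 this
  · intro σ hσ
    refine ⟨fun x => decide (x.2.1 ∈ σ x.1), Finset.mem_univ _, funext fun i => ?_⟩
    have hi := Finset.mem_powerset.1 (Fintype.mem_piFinset.1 hσ i)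
    ext x
    simp only [Finset.mem_map, Finset.mem_filter, Finset.mem_univ, true_and, decide_eq_true_eq,
      Function.Embedding.subtype_apply]
    exact ⟨fun ⟨e, he, hx⟩ => hx ▸ he, fun hx => ⟨⟨x, hi hx⟩, hx, rfl⟩⟩
  · intro g _
    congr 1
    rw [Fintype.prod_sigma]
    exact Finset.prod_congr rfl fun i _ => prod_coin_eq p (E i) fun e => g ⟨i, e⟩

variable {s r : ℕ} {E : Finset (Sym2 (Fin s))} {Col W : Type} {H : Col → SimpleGraph (Fin r × W)}

theorem ColouredCopy.toProd_injective :
    Function.Injective fun k : ColouredCopy E H => (k.vert, k.col) := fun _ _ h =>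
  ColouredCopy.ext' (Prod.ext_iff.1 h).1 (Prod.ext_iff.1 h).2

open Classical in
noncomputable instance [Fintype Col] [Fintype W] : Fintype (ColouredCopy E H) :=
  Fintype.ofInjective _ ColouredCopy.toProd_injective

/-- The coloured edge of the copy `k` playing the role of `e`. -/
def copyEdge {Ed : Col → Finset (Sym2 (Fin r × W))}
    (hEd : ∀ c e, e ∈ Ed c ↔ e ∈ (H c).edgeSet) (k : ColouredCopy E H) (e : {e // e ∈ E}) :
    Σ c, {e // e ∈ Ed c} :=
  ⟨k.col e, Sym2.map k.vert e.1, (hEd _ _).2 (k.mem_edgeSet e)⟩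

variable {Ed : Col → Finset (Sym2 (Fin r × W))} {hEd : ∀ c e, e ∈ Ed c ↔ e ∈ (H c).edgeSet}

theorem copyEdge_injective (k : ColouredCopy E H) : Function.Injective (copyEdge hEd k) :=
  fun _ _ h => k.col_injective (Sigma.mk.inj_iff.1 h).1

/-- The coloured edges of a coloured copy. -/
def copyEdges (hEd : ∀ c e, e ∈ Ed c ↔ e ∈ (H c).edgeSet) (k : ColouredCopy E H) :
    Finset (Σ c, {e // e ∈ Ed c}) :=
  Finset.univ.map ⟨copyEdge hEd k, copyEdge_injective k⟩

theorem card_copyEdges (k : ColouredCopy E H) : (copyEdges hEd k).card = E.card := by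
  simp [copyEdges]

theorem mem_copyEdges {k : ColouredCopy E H} {x : Σ c, {e // e ∈ Ed c}} :
    x ∈ copyEdges hEd k ↔ ∃ e, copyEdge hEd k e = x := by
  simp [copyEdges]

open Classical in
theorem hasTransversalFactorSG_of_isTiling {t n : ℕ} {F : SimpleGraph (Fin s)}
    (ht : F.edgeFinset.card = t) {W : Type} {Hs : Fin (t * r * n) → SimpleGraph (Fin r × W)}
    {B : ∀ c, Finset (ClassPts r (Fin (t * r * n)) W c)}
    {S : Finset (ColouredCopy F.edgeFinset Hs)} (hS : IsTiling copyPts (r * n) B S)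
    {σ : Fin (t * r * n) → Finset (Sym2 (Fin r × W))}
    (hσ : ∀ k ∈ S, ∀ e, Sym2.map k.vert e.1 ∈ σ (k.col e)) :
    HasTransversalFactorSG F
      (fun i => SimpleGraph.fromEdgeSet (σ i : Set (Sym2 (Fin r × W)))) (r * n) := by
  obtain ⟨-, hdisj, hcard⟩ := hS
  set k : Fin (r * n) → ColouredCopy F.edgeFinset Hs := fun j =>
    ((Finset.equivFinOfCardEq hcard).symm j).1
  have hkS : ∀ j, k j ∈ S := fun j => ((Finset.equivFinOfCardEq hcard).symm j).2
  have hkne : ∀ j j', j ≠ j' → k j ≠ k j' := fun j j' hjj h =>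
    hjj ((Finset.equivFinOfCardEq hcard).symm.injective (Subtype.ext h))
  refine ⟨fun j => (k j).vert, fun j => (k j).vert_injective, fun j j' hjj a b hab => ?_,
    fun x => (k x.1).col x.2, ?_, fun j e => ?_⟩
  · exact Finset.disjoint_left.1 (hdisj _ (hkS j) _ (hkS j') (hkne _ _ hjj)
      (some ((k j).vert a).1)) (mem_copyPts_some.2 ⟨a, rfl⟩) (mem_copyPts_some.2 ⟨b, hab.symm⟩)
  · rw [Fintype.bijective_iff_injective_and_card]
    constructor
    · rintro ⟨j, e⟩ ⟨j', e'⟩ h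
      by_cases hjj : j = j'
      · subst hjj
        have he : e = e' := (k j).col_injective h
        rw [he]
      · exact absurd (mem_copyPts_none.2 ⟨e', h.symm⟩) (Finset.disjoint_left.1
          (hdisj _ (hkS j) _ (hkS j') (hkne _ _ hjj) none) (mem_copyPts_none.2 ⟨e, rfl⟩))
    · rw [Fintype.card_prod, Fintype.card_fin, Fintype.card_fin, Fintype.card_coe, ht]
      ring
  · rw [SimpleGraph.edgeSet_fromEdgeSet]
    exact ⟨hσ _ (hkS j) e, SimpleGraph.not_isDiag_of_mem_edgeSet _ ((k j).mem_edgeSet e)⟩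

end CopyEdges

section Codegree

open Classical in
theorem mul_le_of_strictlyOneBalanced {s t : ℕ} {F : SimpleGraph (Fin s)} (hs : 2 ≤ s)
    (hbal : SGStrictlyOneBalanced F) (ht : F.edgeFinset.card = t) {E' : Finset (Sym2 (Fin s))}
    (hE : E' ⊆ F.edgeFinset) (hne : E'.Nonempty) :
    2 ≤ (Finset.univ.filter fun a => ∃ e ∈ E', a ∈ e).card ∧
    E'.card * (s - 1) + (if E'.card < t then 1 else 0) ≤
      t * ((Finset.univ.filter fun a => ∃ e ∈ E', a ∈ e).card - 1) := by
  set Y := Finset.univ.filter fun a => ∃ e ∈ E', a ∈ e with hY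
  have h2 : 2 ≤ Y.card := by
    obtain ⟨e, he⟩ := hne
    have hd := F.not_isDiag_of_mem_edgeFinset (hE he)
    rw [← Sym2.card_toFinset_of_not_isDiag e hd]
    exact Finset.card_le_card fun a ha =>
      Finset.mem_filter.2 ⟨Finset.mem_univ _, e, he, Sym2.mem_toFinset.1 ha⟩
  refine ⟨h2, ?_⟩
  have hYs : Y.card ≤ s := (Finset.card_le_univ _).trans (by simp)
  have hEt : E'.card ≤ t := ht ▸ Finset.card_le_card hE
  have key : (Y ≠ Finset.univ ∨ E' ≠ F.edgeFinset) → E'.card * (s - 1) < t * (Y.card - 1) := by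
    intro h
    have := hbal Y E' hE (fun e he v hv => Finset.mem_filter.2 ⟨Finset.mem_univ _, e, he, hv⟩) h2 h
    have a1 : (0 : ℝ) < (Y.card : ℝ) - 1 := by
      have : (2 : ℝ) ≤ Y.card := by exact_mod_cast h2
      linarith
    have a2 : (0 : ℝ) < (s : ℝ) - 1 := by
      have : (2 : ℝ) ≤ s := by exact_mod_cast hs
      linarith
    rw [div_lt_div_iff₀ a1 a2, ht] at this
    have h3 : ((E'.card * (s - 1) : ℕ) : ℝ) < (t * (Y.card - 1) : ℕ) := by
      push_cast [Nat.cast_sub (show 1 ≤ s by omega), Nat.cast_sub (show 1 ≤ Y.card by omega)]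
      exact this
    exact_mod_cast h3
  by_cases hlt : E'.card < t
  · rw [if_pos hlt]
    exact key (Or.inr fun h => by rw [h, ht] at hlt; exact lt_irrefl _ hlt)
  · rw [if_neg hlt, add_zero]
    by_cases hu : Y = Finset.univ
    · rw [hu, Finset.card_univ, Fintype.card_fin]
      exact Nat.mul_le_mul_right _ hEt
    · exact (key (Or.inl hu)).le

open Classical in
theorem card_le_of_subset_copyEdges {s r t : ℕ} {F : SimpleGraph (Fin s)} (hs : 2 ≤ s)
    (hbal : SGStrictlyOneBalanced F) (ht : F.edgeFinset.card = t) {Col W : Type} [Fintype Col]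
    [Fintype W] {H : Col → SimpleGraph (Fin r × W)} {Ed : Col → Finset (Sym2 (Fin r × W))}
    {hEd : ∀ c e, e ∈ Ed c ↔ e ∈ (H c).edgeSet} {B : Finset (Σ c, {e // e ∈ Ed c})}
    (hB : B.Nonempty) {Q : ℝ} (hQ0 : 0 ≤ Q)
    (hQ : ∀ w, 2 ≤ w → w ≤ s → B.card ≤ t →
      B.card * (s - 1) + (if B.card < t then 1 else 0) ≤ t * (w - 1) →
      (r * Fintype.card W : ℝ) ^ (s - w) * (Fintype.card Col : ℝ) ^ (t - B.card) ≤ Q)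
    {T : Finset (ColouredCopy F.edgeFinset H)} (hT : ∀ k ∈ T, B ⊆ copyEdges hEd k) :
    (T.card : ℝ) ≤ t ^ t * (2 ^ s * Q) := by
  rcases T.eq_empty_or_nonempty with h0 | ⟨k₀, hk₀⟩
  · rw [h0, Finset.card_empty, Nat.cast_zero]
    positivity
  have hBt : B.card ≤ t := by
    have := Finset.card_le_card (hT _ hk₀)
    rwa [card_copyEdges, ht] at this
  have ht0 : 1 ≤ t := hB.card_pos.trans_le hBt
  set fib : ({x // x ∈ B} → {e // e ∈ F.edgeFinset}) → Finset (ColouredCopy F.edgeFinset H) :=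
    fun g => Finset.univ.filter fun k => ∀ x, copyEdge hEd k (g x) = x.1 with hfib
  have hcover : T ⊆ Finset.univ.biUnion fib := by
    intro k hk
    have hk' := hT k hk
    choose g hg using fun x : {x // x ∈ B} => mem_copyEdges.1 (hk' x.2)
    exact Finset.mem_biUnion.2 ⟨g, Finset.mem_univ _, Finset.mem_filter.2 ⟨Finset.mem_univ _, hg⟩⟩
  have hbound : ∀ g, ((fib g).card : ℝ) ≤ 2 ^ s * Q := by
    intro g
    rcases (fib g).eq_empty_or_nonempty with h0 | ⟨k₁, hk₁⟩
    · rw [h0, Finset.card_empty, Nat.cast_zero]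
      positivity
    have hk₁' := (Finset.mem_filter.1 hk₁).2
    have hginj : Function.Injective g := fun x y h =>
      Subtype.ext ((hk₁' x).symm.trans ((congrArg _ h).trans (hk₁' y)))
    set E' : Finset (Sym2 (Fin s)) := Finset.univ.image (Subtype.val ∘ g) with hE'
    have hE'c : E'.card = B.card := by
      rw [hE', Finset.card_image_of_injective _ (Subtype.val_injective.comp hginj),
        Finset.card_univ, Fintype.card_coe]
    obtain ⟨hY2, hYt⟩ := mul_le_of_strictlyOneBalanced hs hbal ht (E' := E') (fun e he => by
      obtain ⟨x, -, rfl⟩ := Finset.mem_image.1 he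
      exact (g x).2) (Finset.card_pos.1 (hE'c ▸ hB.card_pos))
    set Y := Finset.univ.filter fun a => ∃ e ∈ E', a ∈ e with hY
    have hYs : Y.card ≤ s := (Finset.card_le_univ _).trans (by simp)
    rw [hE'c] at hYt
    have hYx : ∀ a ∈ Y, ∃ x, a ∈ (g x).1 := fun a ha => by
      obtain ⟨e, he, hae⟩ := (Finset.mem_filter.1 ha).2
      obtain ⟨x, -, rfl⟩ := Finset.mem_image.1 he
      exact ⟨x, hae⟩
    set SV : Fin s → Finset (Fin r × W) := fun a =>
      if h : a ∈ Y then (hYx a h).choose.1.2.1.toFinset else Finset.univ with hSV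
    set SC : {e // e ∈ F.edgeFinset} → Finset Col := fun e =>
      if h : ∃ x, g x = e then {h.choose.1.1} else Finset.univ with hSC
    have hsub : ((fib g).image fun k => (k.vert, k.col)) ⊆
        Fintype.piFinset SV ×ˢ Fintype.piFinset SC := by
      intro y hy
      obtain ⟨k, hk, rfl⟩ := Finset.mem_image.1 hy
      have hk' := (Finset.mem_filter.1 hk).2
      refine Finset.mem_product.2 ⟨Fintype.mem_piFinset.2 fun a => ?_,
        Fintype.mem_piFinset.2 fun e => ?_⟩
      · simp only [hSV]
        split_ifs with h
        · rw [Sym2.mem_toFinset, ← hk' (hYx a h).choose]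
          exact Sym2.mem_map.2 ⟨a, (hYx a h).choose_spec, rfl⟩
        · exact Finset.mem_univ _
      · simp only [hSC]
        split_ifs with h
        · rw [Finset.mem_singleton, ← hk' h.choose, h.choose_spec]
          rfl
        · exact Finset.mem_univ _
    have hc := Finset.card_le_card hsub
    rw [Finset.card_image_of_injective _ ColouredCopy.toProd_injective, Finset.card_product,
      Fintype.card_piFinset, Fintype.card_piFinset] at hc
    have hV : ∏ a, (SV a).card ≤ 2 ^ s * (r * Fintype.card W) ^ (s - Y.card) := by
      calc ∏ a, (SV a).card ≤ ∏ a, if a ∈ Y then 2 else r * Fintype.card W := by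
            refine Finset.prod_le_prod' fun a _ => ?_
            simp only [hSV]
            split_ifs with h
            · rw [Sym2.card_toFinset]
              split_ifs <;> omega
            · rw [Finset.card_univ, Fintype.card_prod, Fintype.card_fin]
        _ = 2 ^ Y.card * (r * Fintype.card W) ^ (s - Y.card) := by
            rw [Finset.prod_ite, Finset.prod_const, Finset.prod_const]
            congr 2
            · congr 1; ext; simp
            · rw [show (Finset.univ.filter fun a => a ∉ Y) = Yᶜ by ext; simp, Finset.card_compl,
                Fintype.card_fin]
        _ ≤ _ := Nat.mul_le_mul_right _ (Nat.pow_le_pow_right (by norm_num) hYs)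
    have hC : ∏ e, (SC e).card ≤ Fintype.card Col ^ (t - B.card) := by
      calc ∏ e, (SC e).card = ∏ e, if e ∈ Finset.univ.image g then 1 else Fintype.card Col := by
            refine Finset.prod_congr rfl fun e _ => ?_
            simp only [hSC, Finset.mem_image, Finset.mem_univ, true_and]
            split_ifs with h
            · rfl
            · rw [Finset.card_univ]
        _ = Fintype.card Col ^ (t - B.card) := by
            rw [Finset.prod_ite, Finset.prod_const, Finset.prod_const, one_pow, one_mul]
            congr 1
            rw [show (Finset.univ.filter fun a => a ∉ Finset.univ.image g) = (Finset.univ.image g)ᶜ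
              by ext; simp, Finset.card_compl, Finset.card_image_of_injective _ hginj,
              Finset.card_univ, Fintype.card_coe, Fintype.card_coe, ht]
        _ ≤ _ := le_rfl
    have h3 : (fib g).card ≤
        2 ^ s * ((r * Fintype.card W) ^ (s - Y.card) * Fintype.card Col ^ (t - B.card)) := by
      rw [← mul_assoc]
      exact hc.trans (Nat.mul_le_mul hV hC)
    calc ((fib g).card : ℝ) ≤ 2 ^ s * ((r * Fintype.card W : ℝ) ^ (s - Y.card) *
          (Fintype.card Col : ℝ) ^ (t - B.card)) := by exact_mod_cast h3
      _ ≤ _ := mul_le_mul_of_nonneg_left (hQ _ hY2 hYs hBt hYt) (by positivity)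
  calc (T.card : ℝ) ≤ ∑ g, ((fib g).card : ℝ) := by
        exact_mod_cast (Finset.card_le_card hcover).trans Finset.card_biUnion_le
    _ ≤ ∑ _g : {x // x ∈ B} → {e // e ∈ F.edgeFinset}, 2 ^ s * Q :=
        Finset.sum_le_sum fun g _ => hbound g
    _ = t ^ B.card * (2 ^ s * Q) := by
        rw [Finset.sum_const, Finset.card_univ, Fintype.card_fun, Fintype.card_coe,
          Fintype.card_coe, ht, nsmul_eq_mul, Nat.cast_pow]
    _ ≤ _ := by
        refine mul_le_mul_of_nonneg_right (pow_le_pow_right₀ ?_ hBt) (by positivity)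
        exact_mod_cast ht0

theorem card_colouredCopy_le {s r : ℕ} {E : Finset (Sym2 (Fin s))} {Col W : Type} [Fintype Col]
    [Fintype W] {H : Col → SimpleGraph (Fin r × W)} :
    Fintype.card (ColouredCopy E H) ≤ (r * Fintype.card W) ^ s * Fintype.card Col ^ E.card := by
  classical
  refine (Fintype.card_le_of_injective _ ColouredCopy.toProd_injective).trans_eq ?_
  simp

end Codegree

section Robustness

theorem mem_presentCopies {X V : Type*} [Fintype V] {E : V → Finset X}
    {g : X → Bool} {k : V} : k ∈ presentCopies E g ↔ ∀ x ∈ E k, g x = true := by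
  simp [presentCopies]

theorem pow_mul_rpow_pow_le {x : ℝ} (hx : 1 ≤ x) {s t b w θ : ℕ} (ht : 0 < t) (hs : 1 ≤ s)
    (hw : 1 ≤ w) (hws : w ≤ s) (hbt : b ≤ t) (h : b * (s - 1) + θ ≤ t * (w - 1)) :
    x ^ (s - w) * x ^ (t - b) * (x ^ (-(((s : ℝ) - 1) / t) - 1)) ^ t ≤
      x ^ (-(θ / t : ℝ)) * (x ^ (-(((s : ℝ) - 1) / t) - 1)) ^ b := by
  have hx0 : 0 < x := by linarith
  have ht' : (0 : ℝ) < t := by exact_mod_cast ht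
  have h' : (b : ℝ) * (s - 1) + θ ≤ t * (w - 1) := by
    have := Nat.cast_le (α := ℝ).2 h
    push_cast [Nat.cast_sub hs, Nat.cast_sub hw] at this
    exact this
  rw [← Real.rpow_natCast x (s - w), ← Real.rpow_natCast x (t - b), ← Real.rpow_mul_natCast hx0.le,
    ← Real.rpow_mul_natCast hx0.le, ← Real.rpow_add hx0, ← Real.rpow_add hx0, ← Real.rpow_add hx0]
  refine Real.rpow_le_rpow_of_exponent_le hx ?_
  rw [Nat.cast_sub hws, Nat.cast_sub hbt]
  have e1 : (s : ℝ) - w + (t - b) + (-(((s : ℝ) - 1) / t) - 1) * t = 1 - w - b := by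
    field_simp
    ring
  have e2 : -(θ / t : ℝ) + (-(((s : ℝ) - 1) / t) - 1) * b = -((b * (s - 1) + θ) / t) - b := by
    field_simp
    ring
  rw [e1, e2]
  have : ((b : ℝ) * (s - 1) + θ) / t ≤ w - 1 := by
    rw [div_le_iff₀ ht']
    linarith
  linarith

theorem rpow_pow_eq {x : ℝ} (hx : 0 < x) {s t : ℕ} (ht : 0 < t) :
    (x ^ (-(((s : ℝ) - 1) / t) - 1)) ^ t = x * (1 / x) ^ (s + t) := by
  have ht' : (0 : ℝ) < t := by exact_mod_cast ht
  rw [← Real.rpow_mul_natCast hx.le, one_div, inv_pow, ← Real.rpow_natCast x (s + t),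
    ← Real.rpow_neg hx.le]
  nth_rw 2 [← Real.rpow_one x]
  rw [← Real.rpow_add hx]
  congr 1
  push_cast
  field_simp
  ring

open Classical in
theorem sysEdgeSparsProb_eq_prodExp {M : ℕ} {W : Type} [Fintype W] [DecidableEq W]
    (Hs : Fin M → SimpleGraph W) (p : ℝ) (P : (Fin M → Finset (Sym2 W)) → Prop) :
    sysEdgeSparsProb Hs p P =
      prodExp (coin p) fun g : (Σ i, {e // e ∈ (Hs i).edgeFinset}) → Bool =>
        if P fun i => (Finset.univ.filter fun e => g ⟨i, e⟩ = true).map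
          (Function.Embedding.subtype _) then 1 else 0 := by
  rw [sysEdgeSparsProb, ← sum_powerset_eq_prodExp _ _ fun σ => if P σ then 1 else 0]
  refine Finset.sum_congr rfl fun σ _ => ?_
  split_ifs <;> simp


open Classical in
theorem exists_constant_of_strictlyOneBalanced {α : ℝ} (hα : 0 < α) {r s t : ℕ} (hr : 2 ≤ r)
    (hs : 2 ≤ s) (ht : 0 < t) {F : SimpleGraph (Fin s)} (hbal : SGStrictlyOneBalanced F)
    (hF : F.edgeFinset.card = t) :
    ∃ C : ℝ, 0 < C ∧ ∀ ε : ℝ, 0 < ε → ∃ n₀ : ℕ, ∀ n : ℕ, n₀ ≤ n →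
      ∀ Hs : Fin (t * r * n) → SimpleGraph (Fin r × Fin (s * n)),
        (∀ i, ∀ a b : Fin r × Fin (s * n), a.1 = b.1 → ¬ (Hs i).Adj a b) →
        (∀ i' : Fin (t * r * n), ∀ i j : Fin r, i ≠ j → ∀ v : Fin (s * n),
          (multipartiteTransversalDirac r s t F + α) * (s * n : ℕ) ≤
            ((Finset.univ.filter fun w => (Hs i').Adj (i, v) (j, w)).card : ℝ)) →
      ∀ p : ℝ, p ≤ 1 →
        C * (n : ℝ) ^ (-(((s : ℝ) - 1) / t) - 1) * (Real.log n) ^ ((1 : ℝ) / t) ≤ p →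
        1 - ε ≤ sysEdgeSparsProb Hs p (fun σ =>
          HasTransversalFactorSG F
            (fun i => SimpleGraph.fromEdgeSet (σ i : Set (Sym2 (Fin r × Fin (s * n)))))
            (r * n)) := by
  obtain ⟨C₀, hC₀, n₁, hspread⟩ := exists_spread_factors hr (by omega) ht hF
    (α := min α 1) (lt_min hα one_pos) (min_le_right _ _)
  set a : ℝ := r * s + 1 with ha
  set b : ℝ := t * r + 1 with hb
  have ha1 : 1 ≤ a := by rw [ha]; exact le_add_of_nonneg_left (by positivity)
  have hb1 : 1 ≤ b := by rw [hb]; exact le_add_of_nonneg_left (by positivity)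
  have has : 1 ≤ a ^ s := one_le_pow₀ ha1
  have hbt : 1 ≤ b ^ t := one_le_pow₀ hb1
  set K : ℝ := t ^ t * (2 ^ s * (a ^ s * b ^ t)) with hK
  have ht1 : (1 : ℝ) ≤ t ^ t := one_le_pow₀ (by exact_mod_cast ht)
  have h2s : (1 : ℝ) ≤ 2 ^ s := one_le_pow₀ (by norm_num)
  have hab : a ^ s * b ^ t ≤ K := by
    rw [hK, ← mul_assoc]
    exact le_mul_of_one_le_left (by positivity) (one_le_mul_of_one_le_of_one_le ht1 h2s)
  have haK : a ^ s ≤ K := (le_mul_of_one_le_right (by positivity) hbt).trans hab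
  have hK1 : 1 ≤ K := has.trans haK
  have hrK : (r : ℝ) ≤ K := by
    refine le_trans ?_ ((le_self_pow₀ ha1 (by omega)).trans haK)
    have : (1 : ℝ) ≤ s := by exact_mod_cast (by omega : 1 ≤ s)
    rw [ha]
    nlinarith [Nat.cast_nonneg (α := ℝ) r]
  obtain ⟨C, hC, hcover⟩ := random_cover ht (C₁ := K + C₀) (by linarith)
  refine ⟨C, hC, fun ε hε => ?_⟩
  obtain ⟨n₂, hn₂⟩ := hcover ε hε
  refine ⟨n₁ + n₂ + 1, fun n hn Hs hpart hdeg p hp1 hp => ?_⟩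
  have hx1 : (1 : ℝ) ≤ n := by exact_mod_cast (by omega : 1 ≤ n)
  have hx0 : (0 : ℝ) < n := by linarith
  set p₀ : ℝ := (n : ℝ) ^ (-(((s : ℝ) - 1) / t) - 1) with hp₀
  have hp0 : 0 < p₀ := Real.rpow_pos_of_pos hx0 _
  have hpt : p₀ ^ t = n * (1 / (n : ℝ)) ^ (s + t) := rpow_pow_eq hx0 ht
  obtain ⟨ι, _, w, S, hw, hw1, hS, hb'⟩ := hspread n (by omega) (Fin (t * r * n)) (Fin (s * n)) Hs
    (fun c => match c with
      | none => (Finset.univ : Finset (Fin (t * r * n)))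
      | some _ => (Finset.univ : Finset (Fin (s * n)))) hpart
    (fun c => by
      cases c
      · exact Finset.card_fin _
      · exact Finset.card_fin _)
    (fun c _ i j hij v _ => (mul_le_mul_of_nonneg_right (by
      linarith [min_le_left α 1]) (Nat.cast_nonneg _)).trans (hdeg c i j hij v))
  rw [sysEdgeSparsProb_eq_prodExp]
  have hcod : ∀ B : Finset (Σ c, {e // e ∈ (Hs c).edgeFinset}), B.Nonempty → ∀ θ : ℕ,
      θ = (if B.card < t then 1 else 0) →
      ∀ T : Finset (ColouredCopy F.edgeFinset Hs),
        (∀ k ∈ T, B ⊆ copyEdges (fun c e => SimpleGraph.mem_edgeFinset) k) →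
        (T.card : ℝ) * p₀ ^ t ≤ K * ((n : ℝ) ^ (-(θ / t : ℝ)) * p₀ ^ B.card) := by
    intro B hB θ hθ T hT
    have h := card_le_of_subset_copyEdges (r := r) hs hbal hF
      (hEd := fun c e => SimpleGraph.mem_edgeFinset (G := Hs c)) hB
      (Q := a ^ s * b ^ t * ((n : ℝ) ^ (-(θ / t : ℝ)) * p₀ ^ B.card / p₀ ^ t)) (by positivity)
      (fun w hw2 hws hBt hbw => by
        rw [← hθ] at hbw
        have h1 := pow_mul_rpow_pow_le hx1 ht (by omega) (by omega) hws hBt hbw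
        rw [← le_div_iff₀ (by positivity)] at h1
        rw [Fintype.card_fin, Fintype.card_fin]
        have e1 : (r * (s * n : ℕ) : ℝ) ^ (s - w) ≤ a ^ s * (n : ℝ) ^ (s - w) := by
          rw [Nat.cast_mul, ← mul_assoc, mul_pow]
          refine mul_le_mul_of_nonneg_right ?_ (by positivity)
          calc (r * s : ℝ) ^ (s - w) ≤ a ^ (s - w) :=
                pow_le_pow_left₀ (by positivity) (by rw [ha]; linarith) _
            _ ≤ a ^ s := pow_le_pow_right₀ ha1 (by omega)
        have e2 : ((t * r * n : ℕ) : ℝ) ^ (t - B.card) ≤ b ^ t * (n : ℝ) ^ (t - B.card) := by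
          rw [Nat.cast_mul, mul_pow, Nat.cast_mul]
          refine mul_le_mul_of_nonneg_right ?_ (by positivity)
          calc (t * r : ℝ) ^ (t - B.card) ≤ b ^ (t - B.card) :=
                pow_le_pow_left₀ (by positivity) (by rw [hb]; linarith) _
            _ ≤ b ^ t := pow_le_pow_right₀ hb1 (by omega)
        calc _ ≤ (a ^ s * (n : ℝ) ^ (s - w)) * (b ^ t * (n : ℝ) ^ (t - B.card)) :=
              mul_le_mul e1 e2 (by positivity) (by positivity)
          _ = a ^ s * b ^ t * ((n : ℝ) ^ (s - w) * (n : ℝ) ^ (t - B.card)) := by ring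
          _ ≤ _ := mul_le_mul_of_nonneg_left h1 (by positivity)) hT
    have hpt0 : 0 < p₀ ^ t := by positivity
    refine (mul_le_mul_of_nonneg_right h hpt0.le).trans_eq ?_
    rw [hK]
    field_simp
  refine (hn₂ n (by omega) (Σ c, {e // e ∈ (Hs c).edgeFinset}) (ColouredCopy F.edgeFinset Hs) ι
    (copyEdges fun c e => SimpleGraph.mem_edgeFinset) w S p₀ p
    (fun k => (card_copyEdges k).trans hF) hw hw1 hp0 (fun A => ?_) (fun i => ?_)
    (fun B hB => ?_) (fun B hB hBt => ?_) ?_ hp hp1).trans ?_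
  · refine le_trans (le_of_eq (Finset.sum_congr rfl fun i _ => by congr)) ((hb' A).trans ?_)
    rw [mul_assoc, ← hpt]
    exact pow_le_pow_left₀ (by positivity)
      (mul_le_mul_of_nonneg_right (by linarith) (by positivity)) _
  · rw [(hS i).2.2, Nat.cast_mul]
    exact mul_le_mul_of_nonneg_right (by linarith) hx0.le
  · refine (hcod B hB _ rfl _ fun k hk => (Finset.mem_filter.1 hk).2).trans ?_
    have h1 : (n : ℝ) ^ (-(((if B.card < t then 1 else 0 : ℕ) : ℝ) / t)) ≤ 1 :=
      Real.rpow_le_one_of_one_le_of_nonpos hx1 (neg_nonpos.2 (by positivity))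
    have h2 : (0 : ℝ) < p₀ ^ B.card := by positivity
    exact mul_le_mul (by linarith) (mul_le_of_le_one_left h2.le h1) (by positivity) (by linarith)
  · refine (hcod B hB 1 (by rw [if_pos hBt]) _ fun k hk => (Finset.mem_filter.1 hk).2).trans ?_
    have hKC : K ≤ K + C₀ := by linarith
    rw [Nat.cast_one]
    refine (mul_le_mul_of_nonneg_right hKC ?_).trans_eq (mul_assoc _ _ _).symm
    positivity
  · have h1 : (Fintype.card (ColouredCopy F.edgeFinset Hs) : ℝ) ≤
        (a * n) ^ s * (b * n) ^ t := by
      have h := card_colouredCopy_le (E := F.edgeFinset) (H := Hs)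
      rw [Fintype.card_fin, Fintype.card_fin, hF] at h
      refine (Nat.cast_le.2 h).trans ?_
      push_cast
      rw [← mul_assoc]
      gcongr
      · rw [ha]; linarith
      · rw [hb]; linarith
    refine le_trans (mul_le_mul_of_nonneg_right (le_trans (le_of_eq ?_) h1) (by positivity)) ?_
    · congr!
    rw [hpt]
    calc _ = a ^ s * b ^ t * n * ((n : ℝ) * (1 / n)) ^ (s + t) := by
          rw [mul_pow, mul_pow, mul_pow, pow_add]; ring
      _ = a ^ s * b ^ t * n := by rw [mul_one_div_cancel hx0.ne', one_pow, mul_one]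
      _ ≤ _ := mul_le_mul_of_nonneg_right (by linarith) hx0.le
  · have hp' : 0 ≤ p := le_trans (mul_nonneg (by positivity)
      (Real.rpow_nonneg (Real.log_natCast_nonneg n) _)) hp
    refine prodExp_mono (coin_nonneg hp' hp1) fun g => ?_
    by_cases h : ∃ i, S i ⊆ presentCopies (copyEdges fun c e => SimpleGraph.mem_edgeFinset) g
    · rw [if_pos h, if_pos]
      obtain ⟨i, hi⟩ := h
      refine hasTransversalFactorSG_of_isTiling hF (hS i) fun k hk e => ?_
      have := mem_presentCopies.1 (hi hk) _ (mem_copyEdges.2 ⟨e, rfl⟩)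
      exact Finset.mem_map.2 ⟨_, Finset.mem_filter.2 ⟨Finset.mem_univ _, this⟩, rfl⟩
    · rw [if_neg h]
      split_ifs <;> norm_num

end Robustness

end TransversalFactor

open Classical in
theorem transversal_multipartite_factor_robustness
    (α : ℝ) (hα : 0 < α) (r s t : ℕ) (hr : 0 < r) (hs : 2 ≤ s) (ht : 0 < t) :
    ∃ C : ℝ, 0 < C ∧
      ∀ F : SimpleGraph (Fin s),
        SGStrictlyOneBalanced F → F.edgeFinset.card = t → F.chromaticNumber = (r : ℕ∞) →
      ∀ ε : ℝ, 0 < ε →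
      ∃ n₀ : ℕ, ∀ n : ℕ, n₀ ≤ n →
      ∀ Hs : Fin (t * r * n) → SimpleGraph (Fin r × Fin (s * n)),
        (∀ i, ∀ a b : Fin r × Fin (s * n), a.1 = b.1 → ¬ (Hs i).Adj a b) →
        (∀ i' : Fin (t * r * n), ∀ i j : Fin r, i ≠ j → ∀ v : Fin (s * n),
          (multipartiteTransversalDirac r s t F + α) * (s * n : ℕ) ≤
            ((Finset.univ.filter fun w => (Hs i').Adj (i, v) (j, w)).card : ℝ)) →
      ∀ p : ℝ, 0 ≤ p → p ≤ 1 →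
        C * (n : ℝ) ^ (-(1 / sgOneDensity F) - 1) * (Real.log n) ^ ((1 : ℝ) / t) ≤ p →
        1 - ε ≤ sysEdgeSparsProb Hs p (fun σ =>
          HasTransversalFactorSG F
            (fun i => SimpleGraph.fromEdgeSet (σ i : Set (Sym2 (Fin r × Fin (s * n)))))
            (r * n)) := by
  have key : ∀ F : SimpleGraph (Fin s), ∃ C : ℝ, 0 < C ∧
      (SGStrictlyOneBalanced F → F.edgeFinset.card = t → F.chromaticNumber = (r : ℕ∞) →
      ∀ ε : ℝ, 0 < ε → ∃ n₀ : ℕ, ∀ n : ℕ, n₀ ≤ n →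
      ∀ Hs : Fin (t * r * n) → SimpleGraph (Fin r × Fin (s * n)),
        (∀ i, ∀ a b : Fin r × Fin (s * n), a.1 = b.1 → ¬ (Hs i).Adj a b) →
        (∀ i' : Fin (t * r * n), ∀ i j : Fin r, i ≠ j → ∀ v : Fin (s * n),
          (multipartiteTransversalDirac r s t F + α) * (s * n : ℕ) ≤
            ((Finset.univ.filter fun w => (Hs i').Adj (i, v) (j, w)).card : ℝ)) →
      ∀ p : ℝ, p ≤ 1 →
        C * (n : ℝ) ^ (-(((s : ℝ) - 1) / t) - 1) * (Real.log n) ^ ((1 : ℝ) / t) ≤ p →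
        1 - ε ≤ sysEdgeSparsProb Hs p (fun σ =>
          HasTransversalFactorSG F
            (fun i => SimpleGraph.fromEdgeSet (σ i : Set (Sym2 (Fin r × Fin (s * n)))))
            (r * n))) := fun F => by
    by_cases h : SGStrictlyOneBalanced F ∧ F.edgeFinset.card = t ∧ F.chromaticNumber = (r : ℕ∞)
    · obtain ⟨hbal, hF, hχ⟩ := h
      have hr2 : 2 ≤ r := by
        obtain ⟨e, he⟩ := Finset.card_pos.1 (hF ▸ ht)
        induction e using Sym2.ind with
        | _ u v =>
          have := SimpleGraph.two_le_chromaticNumber_of_adj (SimpleGraph.mem_edgeFinset.1 he)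
          rw [hχ] at this
          exact_mod_cast this
      obtain ⟨C, hC, h⟩ :=
        TransversalFactor.exists_constant_of_strictlyOneBalanced hα hr2 hs ht hbal hF
      exact ⟨C, hC, fun _ _ _ => h⟩
    · exact ⟨1, one_pos, fun h1 h2 h3 => absurd ⟨h1, h2, h3⟩ h⟩
  choose C hC h using key
  refine ⟨∑ F, C F, Finset.sum_pos (fun F _ => hC F) ⟨⊥, Finset.mem_univ _⟩,
    fun F hbal hF hχ ε hε => ?_⟩
  obtain ⟨n₀, hn₀⟩ := h F hbal hF hχ ε hε
  refine ⟨n₀, fun n hn Hs hpart hdeg p _ hp1 hp => hn₀ n hn Hs hpart hdeg p hp1 (le_trans ?_ hp)⟩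
  have hd : 1 / sgOneDensity F = ((s : ℝ) - 1) / t := by
    rw [sgOneDensity, hF, one_div_div]
  rw [hd]
  exact mul_le_mul_of_nonneg_right (mul_le_mul_of_nonneg_right
    (Finset.single_le_sum (fun F _ => (hC F).le) (Finset.mem_univ F))
    (Real.rpow_nonneg (Nat.cast_nonneg _) _))
    (Real.rpow_nonneg (Real.log_natCast_nonneg n) _)
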